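/- For every ε > 0 one has ∫₁^T |ζ(1/2+it)|² S(t) dt ≪_ε T log T (log log T)^{3/2+ε}. -/

import Mathlib

open Complex Real MeasureTheory Set Filter

noncomputable section

/-- The multiplicity of `ρ` as a zero of the Riemann zeta function
(the order of vanishing, i.e. the least `n` with `ζ⁽ⁿ⁾(ρ) ≠ 0`). -/
def zetaMult (ρ : ℂ) : ℕ := sInf {n : ℕ | iteratedDeriv n riemannZeta ρ ≠ 0}

/-- `ρ` is a nontrivial zero of the Riemann zeta function. -/
def IsNontrivialZero (ρ : ℂ) : Prop := riemannZeta ρ = 0 ∧ 0 < ρ.re ∧ ρ.re < 1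

/-- `S` is the function `S(T) = (1/π) arg ζ(1/2 + iT)`, where the argument is obtained by
continuous variation along the straight segments joining `2`, `2 + iT`, `1/2 + iT`, starting
with the value `0` at `2`; if `T` is an ordinate of a zero then `S(T) = S(T+0)`
(right-continuity). -/
def IsS (S : ℝ → ℝ) : Prop :=
  (∀ T : ℝ, 0 < T →
    (∀ σ : ℝ, 1/2 ≤ σ → σ ≤ 2 → riemannZeta (σ + T * I) ≠ 0) →
    ∃ θ : ℝ → ℂ, ContinuousOn θ (Icc 0 2) ∧
      θ 0 = Complex.log (riemannZeta 2) ∧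
      (∀ u ∈ Icc (0:ℝ) 1, Complex.exp (θ u) = riemannZeta (2 + u * T * I)) ∧
      (∀ u ∈ Icc (1:ℝ) 2, Complex.exp (θ u) = riemannZeta (2 - 3/2 * (u - 1) + T * I)) ∧
      S T = (θ 2).im / π) ∧
  (∀ T : ℝ, 0 < T → Tendsto S (nhdsWithin T (Ioi T)) (nhds (S T)))

/-! ### Mean values of Dirichlet polynomials -/

lemma natCast_cpow_neg_mul_I {n : ℕ} (hn : n ≠ 0) (t : ℝ) :
    (n : ℂ) ^ (-(t * I)) = cexp ((-(Real.log n) * I : ℂ) * t) := by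
  rw [Complex.cpow_def_of_ne_zero (by exact_mod_cast hn), Complex.natCast_log]
  congr 1
  ring

lemma norm_exp_neg_mul_I_mul (x t : ℝ) : ‖cexp ((-(x : ℂ) * I) * t)‖ = 1 := by
  rw [← Complex.norm_exp_ofReal_mul_I (-x * t)]
  congr 2
  push_cast
  ring

lemma norm_integral_natCast_cpow_mul_conj_le {m n : ℕ} (hm : m ≠ 0) (hn : n ≠ 0) (hmn : m ≠ n)
    (a b : ℝ) :
    ‖∫ t in a..b, (n : ℂ) ^ (-(t * I)) * (starRingEnd ℂ) ((m : ℂ) ^ (-(t * I)))‖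
      ≤ 2 / |Real.log n - Real.log m| := by
  have hlog : Real.log n - Real.log m ≠ 0 := by
    intro h
    have := Real.log_injOn_pos (by simp; positivity) (by simp; positivity) (sub_eq_zero.mp h)
    exact hmn (by exact_mod_cast this.symm)
  have hc : (-((Real.log n - Real.log m : ℝ) : ℂ) * I : ℂ) ≠ 0 := by
    exact mul_ne_zero (neg_ne_zero.mpr (by exact_mod_cast hlog)) I_ne_zero
  have : ∀ t : ℝ, (n : ℂ) ^ (-(t * I)) * (starRingEnd ℂ) ((m : ℂ) ^ (-(t * I)))
      = cexp ((-((Real.log n - Real.log m : ℝ) : ℂ) * I) * t) := by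
    intro t
    rw [natCast_cpow_neg_mul_I hn, natCast_cpow_neg_mul_I hm, ← Complex.exp_conj,
      ← Complex.exp_add]
    congr 1
    simp only [map_mul, map_neg, Complex.conj_ofReal, Complex.conj_I]
    push_cast
    ring
  simp_rw [this]
  rw [integral_exp_mul_complex hc, norm_div]
  have h1 : ∀ x : ℝ, ‖cexp ((-((Real.log n - Real.log m : ℝ) : ℂ) * I) * x)‖ = 1 := by
    intro x
    exact norm_exp_neg_mul_I_mul _ _
  have h2 : ‖(-((Real.log n - Real.log m : ℝ) : ℂ) * I : ℂ)‖ = |Real.log n - Real.log m| := by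
    rw [norm_mul, norm_neg, Complex.norm_real, Complex.norm_I, mul_one, Real.norm_eq_abs]
  rw [h2]
  gcongr
  calc _ ≤ _ := norm_sub_le _ _
    _ = 2 := by rw [h1, h1]; norm_num

/-- The near-diagonal kernel bounding `1 / |log n - log m|`. -/
def nearKernel (m n : ℕ) : ℝ :=
  if m ≠ n ∧ n ≤ 2 * m ∧ m ≤ 2 * n then 1 / |(n : ℝ) - m| else 0

lemma nearKernel_comm (m n : ℕ) : nearKernel m n = nearKernel n m := by
  unfold nearKernel
  rw [abs_sub_comm]
  congr 1
  simp only [eq_iff_iff]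
  tauto

lemma nearKernel_nonneg (m n : ℕ) : 0 ≤ nearKernel m n := by
  unfold nearKernel
  split_ifs <;> positivity

lemma inv_abs_log_sub_log_le_of_lt {m n : ℕ} (hm : m ≠ 0) (hmn : m < n) :
    1 / |Real.log n - Real.log m| ≤ 2 + Real.sqrt m * Real.sqrt n * nearKernel m n := by
  have hm' : (0 : ℝ) < m := by positivity
  have hmn' : (m : ℝ) < n := by exact_mod_cast hmn
  have hn' : (0 : ℝ) < n := hm'.trans hmn'
  have hlow : ((n : ℝ) - m) / n ≤ Real.log n - Real.log m := by
    have := Real.one_sub_inv_le_log_of_pos (x := (n : ℝ) / m) (by positivity)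
    rw [Real.log_div hn'.ne' hm'.ne'] at this
    convert this using 1
    field_simp
  have hpos : 0 < ((n : ℝ) - m) / n := div_pos (by linarith) hn'
  have h1 : 1 / |Real.log n - Real.log m| ≤ n / ((n : ℝ) - m) := by
    rw [abs_of_pos (hpos.trans_le hlow)]
    calc _ ≤ 1 / (((n : ℝ) - m) / n) := one_div_le_one_div_of_le hpos hlow
      _ = _ := by rw [one_div_div]
  refine h1.trans ?_
  have hd : 0 < (n : ℝ) - m := by linarith
  unfold nearKernel
  split_ifs with h
  · rw [abs_of_pos hd]
    have h3 : (n : ℝ) / (n - m) = 1 + m / (n - m) := by field_simp; ring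
    have h4 : (m : ℝ) ≤ Real.sqrt m * Real.sqrt n := by
      rw [← Real.sqrt_mul hm'.le]
      apply Real.le_sqrt_of_sq_le
      nlinarith
    have h5 : (m : ℝ) / (n - m) ≤ Real.sqrt m * Real.sqrt n / (n - m) := by gcongr
    rw [h3, mul_one_div]
    linarith
  · have : 2 * m < n := by
      by_contra hc
      exact h ⟨hmn.ne, by omega, by omega⟩
    have h' : 2 * (m : ℝ) < n := by exact_mod_cast this
    rw [mul_zero, add_zero, div_le_iff₀ hd]
    linarith

lemma inv_abs_log_sub_log_le {m n : ℕ} (hm : m ≠ 0) (hn : n ≠ 0) (hmn : m ≠ n) :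
    1 / |Real.log n - Real.log m| ≤ 2 + Real.sqrt m * Real.sqrt n * nearKernel m n := by
  rcases lt_or_gt_of_ne hmn with h | h
  · exact inv_abs_log_sub_log_le_of_lt hm h
  · rw [abs_sub_comm, nearKernel_comm, mul_comm (Real.sqrt m)]
    exact inv_abs_log_sub_log_le_of_lt hn h

lemma sum_nearKernel_le (s : Finset ℕ) (m : ℕ) :
    ∑ n ∈ s, nearKernel m n ≤ 2 * (1 + Real.log m) := by
  have hh : ((harmonic m : ℚ) : ℝ) = ∑ j ∈ Finset.Icc 1 m, (1 : ℝ) / j := by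
    rw [harmonic_eq_sum_Icc]
    push_cast
    simp
  have hle : ∀ n, nearKernel m n ≤
      (if n ∈ Finset.Icc (m + 1) (m + m) then (1 : ℝ) / ((n - m : ℕ) : ℝ) else 0) +
      (if n ∈ Finset.Icc 0 (m - 1) ∧ m ≠ 0 then (1 : ℝ) / ((m - n : ℕ) : ℝ) else 0) := by
    intro n
    unfold nearKernel
    split_ifs with h1 h2 h3 h3 h2 h3 h3
    · simp only [Finset.mem_Icc] at h2 h3; omega
    · simp only [Finset.mem_Icc] at h2
      rw [Nat.cast_sub (by omega), abs_of_pos]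
      · simp
      · have : (m : ℝ) < n := by exact_mod_cast (by omega : m < n)
        linarith
    · simp only [Finset.mem_Icc] at h3
      have : (n : ℝ) < m := by exact_mod_cast (by omega : n < m)
      rw [Nat.cast_sub (by omega), abs_of_neg (by linarith)]
      simp
    · simp only [Finset.mem_Icc] at h2 h3
      exfalso
      omega
    all_goals positivity
  calc ∑ n ∈ s, nearKernel m n
      ≤ ∑ n ∈ s ∪ Finset.range (2 * m + 1), nearKernel m n :=
        Finset.sum_le_sum_of_subset_of_nonneg Finset.subset_union_left
          (fun _ _ _ => nearKernel_nonneg _ _)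
    _ ≤ ∑ n ∈ s ∪ Finset.range (2 * m + 1),
        ((if n ∈ Finset.Icc (m + 1) (m + m) then (1 : ℝ) / ((n - m : ℕ) : ℝ) else 0) +
        (if n ∈ Finset.Icc 0 (m - 1) ∧ m ≠ 0 then (1 : ℝ) / ((m - n : ℕ) : ℝ) else 0)) :=
        Finset.sum_le_sum fun n _ => hle n
    _ ≤ ∑ j ∈ Finset.Icc 1 m, (1 : ℝ) / j + ∑ j ∈ Finset.Icc 1 m, (1 : ℝ) / j := by
        rw [Finset.sum_add_distrib]
        apply add_le_add
        · rw [← Finset.sum_filter]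
          apply le_of_eq
          apply Finset.sum_nbij' (fun n => n - m) (fun j => j + m)
          · intro n hn; simp at hn ⊢; omega
          · intro n hn; simp at hn ⊢; omega
          · intro n hn; simp at hn ⊢; omega
          · intro n hn; simp
          · intro n hn; rfl
        · rw [← Finset.sum_filter]
          apply le_of_eq
          apply Finset.sum_nbij' (fun n => m - n) (fun j => m - j)
          · intro n hn; simp at hn ⊢; omega
          · intro n hn; simp at hn ⊢; omega
          · intro n hn; simp at hn ⊢; omega
          · intro n hn; simp at hn ⊢; omega
          · intro n hn; rfl
    _ ≤ _ := by
        rw [← hh]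
        have := harmonic_le_one_add_log m
        linarith

lemma continuous_natCast_cpow_neg_mul_I {n : ℕ} (hn : n ≠ 0) :
    Continuous fun t : ℝ => (n : ℂ) ^ (-(t * I)) := by
  simp_rw [natCast_cpow_neg_mul_I hn]
  fun_prop

/-- Mean value theorem for Dirichlet polynomials. -/
theorem integral_norm_sq_dirichlet_le {s : Finset ℕ} (hs : ∀ n ∈ s, n ≠ 0) (c : ℕ → ℂ) {a b : ℝ}
    (hab : a ≤ b) :
    ∫ t in a..b, ‖∑ n ∈ s, c n * (n : ℂ) ^ (-(t * I))‖ ^ 2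
      ≤ ∑ n ∈ s, ‖c n‖ ^ 2 * ((b - a) + 4 * n * (1 + Real.log n)) + 4 * (∑ n ∈ s, ‖c n‖) ^ 2 := by
  set e : ℕ → ℝ → ℂ := fun n t => (n : ℂ) ^ (-(t * I)) with he
  have hcont : ∀ n ∈ s, Continuous (e n) := fun n hn => continuous_natCast_cpow_neg_mul_I (hs n hn)
  have hexp : ∀ t : ℝ, ((‖∑ n ∈ s, c n * e n t‖ ^ 2 : ℝ) : ℂ)
      = ∑ n ∈ s, ∑ m ∈ s, (c n * (starRingEnd ℂ) (c m)) * (e n t * (starRingEnd ℂ) (e m t)) := by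
    intro t
    push_cast
    rw [← Complex.mul_conj', map_sum, Finset.sum_mul_sum]
    refine Finset.sum_congr rfl fun n _ => Finset.sum_congr rfl fun m _ => ?_
    rw [map_mul]
    ring
  have hInt : ((∫ t in a..b, ‖∑ n ∈ s, c n * e n t‖ ^ 2 : ℝ) : ℂ)
      = ∑ n ∈ s, ∑ m ∈ s, (c n * (starRingEnd ℂ) (c m)) *
          ∫ t in a..b, e n t * (starRingEnd ℂ) (e m t) := by
    rw [← intervalIntegral.integral_ofReal]
    simp_rw [hexp]
    have hc2 : ∀ n ∈ s, ∀ m ∈ s, Continuous fun t =>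
        (c n * (starRingEnd ℂ) (c m)) * (e n t * (starRingEnd ℂ) (e m t)) := fun n hn m hm =>
      continuous_const.mul ((hcont n hn).mul (Complex.continuous_conj.comp (hcont m hm)))
    rw [intervalIntegral.integral_finsetSum]
    · refine Finset.sum_congr rfl fun n hn => ?_
      rw [intervalIntegral.integral_finsetSum]
      · refine Finset.sum_congr rfl fun m hm => ?_
        rw [intervalIntegral.integral_const_mul]
      · intro m hm
        exact (hc2 n hn m hm).intervalIntegrable _ _
    · intro n hn
      exact (continuous_finsetSum _ fun m hm => hc2 n hn m hm).intervalIntegrable _ _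
  have hterm : ∀ n ∈ s, ∀ m ∈ s, ‖(c n * (starRingEnd ℂ) (c m)) *
      ∫ t in a..b, e n t * (starRingEnd ℂ) (e m t)‖ ≤
      (if n = m then ‖c n‖ ^ 2 * (b - a) else 0) + 4 * (‖c n‖ * ‖c m‖) +
      (‖c n‖ ^ 2 * n * nearKernel n m + ‖c m‖ ^ 2 * m * nearKernel m n) := by
    intro n hn m hm
    have hk := nearKernel_nonneg n m
    have hk' := nearKernel_nonneg m n
    rw [norm_mul, norm_mul, RCLike.norm_conj]
    split_ifs with h
    · subst h
      have h1 : ‖∫ t in a..b, e n t * (starRingEnd ℂ) (e n t)‖ ≤ b - a := by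
        have := intervalIntegral.norm_integral_le_of_norm_le_const (a := a) (b := b) (C := 1)
          (f := fun t => e n t * (starRingEnd ℂ) (e n t)) (by
            intro t _
            rw [norm_mul, RCLike.norm_conj, he]
            simp only
            rw [natCast_cpow_neg_mul_I (hs n hn), norm_exp_neg_mul_I_mul, one_mul])
        rwa [one_mul, abs_of_nonneg (by linarith)] at this
      have h2 : ‖c n‖ * ‖c n‖ * ‖∫ t in a..b, e n t * (starRingEnd ℂ) (e n t)‖
          ≤ ‖c n‖ * ‖c n‖ * (b - a) := by gcongr
      have : 0 ≤ ‖c n‖ ^ 2 * n * nearKernel n n := by positivity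
      have : 0 ≤ ‖c n‖ * ‖c n‖ := by positivity
      rw [sq]
      rw [sq] at *
      linarith
    · have h1 := norm_integral_natCast_cpow_mul_conj_le (hs m hm) (hs n hn) (Ne.symm h) a b
      have h2 := inv_abs_log_sub_log_le (hs m hm) (hs n hn) (Ne.symm h)
      have h3 : ‖∫ t in a..b, e n t * (starRingEnd ℂ) (e m t)‖ ≤
          2 * (2 + Real.sqrt m * Real.sqrt n * nearKernel m n) := by
        refine h1.trans ?_
        rw [← mul_one_div]
        gcongr
      have h4 : ‖c n‖ * ‖c m‖ * ‖∫ t in a..b, e n t * (starRingEnd ℂ) (e m t)‖ ≤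
          ‖c n‖ * ‖c m‖ * (2 * (2 + Real.sqrt m * Real.sqrt n * nearKernel m n)) := by gcongr
      have h5 : 2 * (‖c n‖ * Real.sqrt n) * (‖c m‖ * Real.sqrt m)
          ≤ ‖c n‖ ^ 2 * n + ‖c m‖ ^ 2 * m := by
        have := two_mul_le_add_sq (‖c n‖ * Real.sqrt n) (‖c m‖ * Real.sqrt m)
        rwa [mul_pow, mul_pow, Real.sq_sqrt (by positivity), Real.sq_sqrt (by positivity)] at this
      have h6 := mul_le_mul_of_nonneg_right h5 hk'
      rw [nearKernel_comm n m]
      nlinarith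
  have hfinal : ∫ t in a..b, ‖∑ n ∈ s, c n * e n t‖ ^ 2 ≤
      ∑ n ∈ s, ∑ m ∈ s, ((if n = m then ‖c n‖ ^ 2 * (b - a) else 0) + 4 * (‖c n‖ * ‖c m‖) +
      (‖c n‖ ^ 2 * n * nearKernel n m + ‖c m‖ ^ 2 * m * nearKernel m n)) := by
    have h0 : ∫ t in a..b, ‖∑ n ∈ s, c n * e n t‖ ^ 2
        ≤ ‖((∫ t in a..b, ‖∑ n ∈ s, c n * e n t‖ ^ 2 : ℝ) : ℂ)‖ := by
      rw [Complex.norm_real]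
      exact le_abs_self _
    refine h0.trans ?_
    rw [hInt]
    refine (norm_sum_le _ _).trans (Finset.sum_le_sum fun n hn => ?_)
    exact (norm_sum_le _ _).trans (Finset.sum_le_sum fun m hm => hterm n hn m hm)
  refine hfinal.trans ?_
  have hS : ∑ n ∈ s, ∑ m ∈ s, ‖c n‖ ^ 2 * n * nearKernel n m
      ≤ ∑ n ∈ s, ‖c n‖ ^ 2 * (2 * n * (1 + Real.log n)) := by
    refine Finset.sum_le_sum fun n _ => ?_
    rw [← Finset.mul_sum]
    calc _ ≤ ‖c n‖ ^ 2 * n * (2 * (1 + Real.log n)) := by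
          gcongr
          exact sum_nearKernel_le s n
      _ = _ := by ring
  have hS2 : ∑ n ∈ s, ∑ m ∈ s, ‖c m‖ ^ 2 * m * nearKernel m n
      = ∑ n ∈ s, ∑ m ∈ s, ‖c n‖ ^ 2 * n * nearKernel n m := Finset.sum_comm
  have hS3 : ∑ n ∈ s, ∑ m ∈ s, (if n = m then ‖c n‖ ^ 2 * (b - a) else 0)
      = ∑ n ∈ s, ‖c n‖ ^ 2 * (b - a) := by
    refine Finset.sum_congr rfl fun n hn => ?_
    rw [Finset.sum_ite_eq, if_pos hn]
  have hS4 : ∑ n ∈ s, ∑ m ∈ s, 4 * (‖c n‖ * ‖c m‖) = 4 * (∑ n ∈ s, ‖c n‖) ^ 2 := by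
    rw [sq, Finset.sum_mul_sum, Finset.mul_sum]
    refine Finset.sum_congr rfl fun n _ => ?_
    rw [Finset.mul_sum]
  simp only [Finset.sum_add_distrib]
  rw [hS2, hS3, hS4]
  have hS5 : ∑ n ∈ s, ‖c n‖ ^ 2 * ((b - a) + 4 * n * (1 + Real.log n)) =
      ∑ n ∈ s, ‖c n‖ ^ 2 * (b - a) + 2 * ∑ n ∈ s, ‖c n‖ ^ 2 * (2 * n * (1 + Real.log n)) := by
    rw [Finset.mul_sum, ← Finset.sum_add_distrib]
    refine Finset.sum_congr rfl fun n _ => ?_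
    ring
  rw [hS5]
  linarith

/-- The Dirichlet polynomial `∑ n ∈ s, c n n^{-w}`. -/
def dpoly (s : Finset ℕ) (c : ℕ → ℂ) (w : ℂ) : ℂ := ∑ n ∈ s, c n * (n : ℂ) ^ (-w)

lemma dpoly_differentiable {s : Finset ℕ} (hs : ∀ n ∈ s, n ≠ 0) (c : ℕ → ℂ) :
    Differentiable ℂ (dpoly s c) := by
  unfold dpoly
  refine Differentiable.fun_sum fun n hn => ?_
  have : (n : ℂ) ≠ 0 := by exact_mod_cast hs n hn
  intro w
  exact ((differentiableAt_id.neg).const_cpow (Or.inl this)).const_mul _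

lemma norm_natCast_cpow_neg {n : ℕ} (hn : n ≠ 0) (w : ℂ) :
    ‖(n : ℂ) ^ (-w)‖ = (n : ℝ) ^ (-w.re) := by
  rw [Complex.norm_natCast_cpow_of_pos (Nat.pos_of_ne_zero hn), neg_re]

lemma norm_dpoly_le {s : Finset ℕ} (hs : ∀ n ∈ s, n ≠ 0) (c : ℕ → ℂ) (w : ℂ) :
    ‖dpoly s c w‖ ≤ ∑ n ∈ s, ‖c n‖ * (n : ℝ) ^ (-w.re) := by
  refine (norm_sum_le _ _).trans (Finset.sum_le_sum fun n hn => ?_)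
  rw [norm_mul, norm_natCast_cpow_neg (hs n hn)]

lemma integral_norm_sq_dpoly_le' {s : Finset ℕ} (hs : ∀ n ∈ s, n ≠ 0) (c : ℕ → ℂ) (σ : ℝ) {a b : ℝ}
    (hab : a ≤ b) :
    ∫ t in a..b, ‖dpoly s c (σ + t * I)‖ ^ 2
      ≤ ∑ n ∈ s, ‖c n‖ ^ 2 * (n : ℝ) ^ (-2 * σ) * ((b - a) + 4 * n * (1 + Real.log n)) +
        4 * (∑ n ∈ s, ‖c n‖ * (n : ℝ) ^ (-σ)) ^ 2 := by
  have key := integral_norm_sq_dirichlet_le hs (fun n => c n * (n : ℂ) ^ (-(σ : ℂ))) hab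
  have hnorm : ∀ n ∈ s, ‖c n * (n : ℂ) ^ (-(σ : ℂ))‖ = ‖c n‖ * (n : ℝ) ^ (-σ) := by
    intro n hn
    rw [norm_mul, norm_natCast_cpow_neg (hs n hn), Complex.ofReal_re]
  have h1 : ∀ t : ℝ, dpoly s c (σ + t * I) =
      ∑ n ∈ s, c n * (n : ℂ) ^ (-(σ : ℂ)) * (n : ℂ) ^ (-(t * I)) := by
    intro t
    refine Finset.sum_congr rfl fun n hn => ?_
    rw [mul_assoc, ← Complex.cpow_add _ _ (by exact_mod_cast hs n hn), neg_add]
  simp_rw [h1]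
  refine key.trans (le_of_eq ?_)
  rw [Finset.sum_congr rfl hnorm]
  congr 1
  refine Finset.sum_congr rfl fun n hn => ?_
  rw [hnorm n hn, mul_pow, ← Real.rpow_natCast ((n : ℝ) ^ (-σ)), ← Real.rpow_mul (by positivity)]
  congr 3
  push_cast
  ring

lemma integral_norm_sq_dpoly_le {s : Finset ℕ} (hs : ∀ n ∈ s, n ≠ 0) (c : ℕ → ℂ) (σ : ℝ) {a b : ℝ}
    (hab : a ≤ b) {N : ℝ} (hN : ∀ n ∈ s, (n : ℝ) ≤ N) (hN1 : 1 ≤ N) :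
    ∫ t in a..b, ‖dpoly s c (σ + t * I)‖ ^ 2
      ≤ ((b - a) + 8 * N * (1 + Real.log N)) * ∑ n ∈ s, ‖c n‖ ^ 2 * (n : ℝ) ^ (-2 * σ) := by
  refine (integral_norm_sq_dpoly_le' hs c σ hab).trans ?_
  have hlog : 0 ≤ Real.log N := Real.log_nonneg hN1
  have hcard : (s.card : ℝ) ≤ N := by
    have h1 : s ⊆ Finset.Icc 1 ⌊N⌋₊ := by
      intro n hn
      rw [Finset.mem_Icc]
      exact ⟨Nat.one_le_iff_ne_zero.mpr (hs n hn), Nat.le_floor (hN n hn)⟩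
    have h2 := Finset.card_le_card h1
    rw [Nat.card_Icc, Nat.add_sub_cancel] at h2
    exact (Nat.cast_le.mpr h2).trans (Nat.floor_le (by linarith))
  have h1 : (∑ n ∈ s, ‖c n‖ * (n : ℝ) ^ (-σ)) ^ 2 ≤
      N * ∑ n ∈ s, ‖c n‖ ^ 2 * (n : ℝ) ^ (-2 * σ) := by
    refine (sq_sum_le_card_mul_sum_sq).trans ?_
    have : ∑ n ∈ s, (‖c n‖ * (n : ℝ) ^ (-σ)) ^ 2 = ∑ n ∈ s, ‖c n‖ ^ 2 * (n : ℝ) ^ (-2 * σ) := by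
      refine Finset.sum_congr rfl fun n hn => ?_
      rw [mul_pow, ← Real.rpow_natCast ((n : ℝ) ^ (-σ)), ← Real.rpow_mul (by positivity)]
      congr 2
      push_cast
      ring
    rw [this]
    gcongr
  have h2 : ∑ n ∈ s, ‖c n‖ ^ 2 * (n : ℝ) ^ (-2 * σ) * ((b - a) + 4 * n * (1 + Real.log n)) ≤
      ((b - a) + 4 * N * (1 + Real.log N)) * ∑ n ∈ s, ‖c n‖ ^ 2 * (n : ℝ) ^ (-2 * σ) := by
    rw [Finset.mul_sum]
    refine Finset.sum_le_sum fun n hn => ?_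
    rw [mul_comm]
    have hn1 : (1 : ℝ) ≤ n := by exact_mod_cast Nat.one_le_iff_ne_zero.mpr (hs n hn)
    have := Real.log_nonneg hn1
    gcongr
    all_goals exact hN n hn
  have h3 : 0 ≤ ∑ n ∈ s, ‖c n‖ ^ 2 * (n : ℝ) ^ (-2 * σ) :=
    Finset.sum_nonneg fun n _ => by positivity
  have h4 : 0 ≤ N * Real.log N * ∑ n ∈ s, ‖c n‖ ^ 2 * (n : ℝ) ^ (-2 * σ) := by positivity
  nlinarith

/-- Dirichlet convolution of the coefficients of two Dirichlet polynomials. -/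
def dconv (s t : Finset ℕ) (c d : ℕ → ℂ) (n : ℕ) : ℂ :=
  ∑ p ∈ s ×ˢ t with p.1 * p.2 = n, c p.1 * d p.2

lemma dpoly_mul (s t : Finset ℕ) (c d : ℕ → ℂ) (w : ℂ) :
    dpoly s c w * dpoly t d w =
      dpoly (Finset.image₂ (· * ·) s t) (dconv s t c d) w := by
  unfold dpoly dconv
  rw [Finset.sum_mul_sum, ← Finset.sum_product']
  rw [← Finset.sum_fiberwise_of_maps_to (s := s ×ˢ t) (t := Finset.image₂ (· * ·) s t)
    (g := fun p => p.1 * p.2)]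
  · refine Finset.sum_congr rfl fun n hn => ?_
    rw [Finset.sum_mul]
    refine Finset.sum_congr rfl fun p hp => ?_
    rw [Finset.mem_filter] at hp
    rw [← hp.2, Nat.cast_mul, Complex.natCast_mul_natCast_cpow]
    ring
  · intro p hp
    rw [Finset.mem_product] at hp
    exact Finset.mem_image₂_of_mem hp.1 hp.2

lemma sum_inv_Icc_le (N : ℕ) : ∑ n ∈ Finset.Icc 1 N, (1 : ℝ) / n ≤ 1 + Real.log N := by
  have := harmonic_le_one_add_log N
  rw [harmonic_eq_sum_Icc] at this
  push_cast at this
  simpa using this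

lemma card_divisors_mul_le (m n : ℕ) :
    (m * n).divisors.card ≤ m.divisors.card * n.divisors.card := by
  rw [Nat.divisors_mul]
  exact Finset.card_mul_le

/-- Summation over divisors: `∑_{n ≤ N} ∑_{d ∣ n} f d (n/d) ≤ ∑_{d ≤ N} ∑_{m ≤ N} f d m`. -/
lemma sum_sum_divisors_le (N : ℕ) (f : ℕ → ℕ → ℝ) (hf : ∀ d m, 0 ≤ f d m) :
    ∑ n ∈ Finset.Icc 1 N, ∑ d ∈ n.divisors, f d (n / d) ≤
      ∑ d ∈ Finset.Icc 1 N, ∑ m ∈ Finset.Icc 1 N, f d m := by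
  rw [Finset.sum_sigma', ← Finset.sum_product']
  have hinj : Set.InjOn (fun x : (_ : ℕ) × ℕ => (x.2, x.1 / x.2))
      ((Finset.Icc 1 N).sigma fun n => n.divisors) := by
    rintro ⟨n, d⟩ hx ⟨n', d'⟩ hy h
    simp only [Finset.coe_sigma, Set.mem_sigma_iff, Finset.mem_coe, Nat.mem_divisors] at hx hy
    simp only [Prod.mk.injEq] at h
    obtain ⟨h1, h2⟩ := h
    subst h1
    have : n = n' := by
      rw [← Nat.div_mul_cancel hx.2.1, ← Nat.div_mul_cancel hy.2.1, h2]
    subst this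
    rfl
  have himg := Finset.sum_image (f := fun p : ℕ × ℕ => f p.1 p.2) hinj
  rw [← himg]
  refine Finset.sum_le_sum_of_subset_of_nonneg ?_ fun p _ _ => hf _ _
  intro p hp
  simp only [Finset.mem_image, Finset.mem_sigma, Finset.mem_Icc, Nat.mem_divisors] at hp
  obtain ⟨⟨n, d⟩, ⟨⟨hn1, hn2⟩, hd, hn0⟩, rfl⟩ := hp
  simp only [Finset.mem_product, Finset.mem_Icc]
  dsimp only at hn1 hn2 hd hn0
  have hd0 : 0 < d := Nat.pos_of_dvd_of_pos hd (by omega)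
  exact ⟨⟨hd0, (Nat.le_of_dvd (by omega) hd).trans hn2⟩,
    Nat.div_pos (Nat.le_of_dvd (by omega) hd) hd0, (Nat.div_le_self _ _).trans hn2⟩

lemma sum_card_divisors_div_le (N : ℕ) :
    ∑ n ∈ Finset.Icc 1 N, (n.divisors.card : ℝ) / n ≤ (1 + Real.log N) ^ 2 := by
  have h := sum_sum_divisors_le N (fun d m => (1 : ℝ) / d * (1 / m)) fun d m => by positivity
  have h1 : ∑ n ∈ Finset.Icc 1 N, ∑ d ∈ n.divisors, (1 : ℝ) / d * (1 / (n / d : ℕ)) =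
      ∑ n ∈ Finset.Icc 1 N, (n.divisors.card : ℝ) / n := by
    refine Finset.sum_congr rfl fun n hn => ?_
    rw [Finset.sum_congr rfl (g := fun _ => (1 : ℝ) / n), Finset.sum_const, nsmul_eq_mul,
      mul_one_div]
    intro d hd
    rw [Nat.mem_divisors] at hd
    rw [one_div_mul_one_div, ← Nat.cast_mul, Nat.mul_div_cancel' hd.1]
  rw [h1, ← Finset.sum_mul_sum] at h
  refine h.trans ?_
  rw [← sq]
  gcongr
  exact sum_inv_Icc_le N

lemma sum_card_divisors_sq_div_le (N : ℕ) :
    ∑ n ∈ Finset.Icc 1 N, (n.divisors.card : ℝ) ^ 2 / n ≤ (1 + Real.log N) ^ 4 := by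
  have h := sum_sum_divisors_le N
    (fun d m => (d.divisors.card : ℝ) / d * (m.divisors.card / m)) fun d m => by positivity
  have h1 : ∑ n ∈ Finset.Icc 1 N, (n.divisors.card : ℝ) ^ 2 / n ≤
      ∑ n ∈ Finset.Icc 1 N, ∑ d ∈ n.divisors,
        (d.divisors.card : ℝ) / d * ((n / d).divisors.card / (n / d : ℕ)) := by
    refine Finset.sum_le_sum fun n hn => ?_
    have : (n.divisors.card : ℝ) ^ 2 / n = ∑ d ∈ n.divisors, (n.divisors.card : ℝ) / n := by
      rw [Finset.sum_const, nsmul_eq_mul]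
      ring
    rw [this]
    refine Finset.sum_le_sum fun d hd => ?_
    rw [Nat.mem_divisors] at hd
    rw [div_mul_div_comm, ← Nat.cast_mul d, Nat.mul_div_cancel' hd.1]
    gcongr
    have := card_divisors_mul_le d (n / d)
    rw [Nat.mul_div_cancel' hd.1] at this
    exact_mod_cast this
  refine h1.trans (h.trans ?_)
  rw [← Finset.sum_mul_sum, ← sq]
  have h2 := sum_card_divisors_div_le N
  have h3 : (1 + Real.log N) ^ 4 = ((1 + Real.log N) ^ 2) ^ 2 := by ring
  rw [h3]
  gcongr

/-- The fourth moment of `∑_{n ≤ N} n^{-1/2-it}`. -/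
lemma integral_norm_pow_four_dpoly_le {N : ℕ} (hN : 1 ≤ N) {a b : ℝ} (hab : a ≤ b) :
    ∫ t in a..b, ‖dpoly (Finset.Icc 1 N) 1 ((1 / 2 : ℝ) + t * I)‖ ^ 4
      ≤ ((b - a) + 8 * (N : ℝ) ^ 2 * (1 + 2 * Real.log N)) * (1 + 2 * Real.log N) ^ 4 := by
  set s := Finset.Icc 1 N
  set s2 := Finset.image₂ (· * ·) s s
  have hs2 : s2 ⊆ Finset.Icc 1 (N ^ 2) := by
    intro n hn
    obtain ⟨x, hx, y, hy, rfl⟩ := Finset.mem_image₂.mp hn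
    simp only [s, Finset.mem_Icc] at hx hy ⊢
    exact ⟨Nat.mul_pos hx.1 hy.1, by nlinarith⟩
  have h0 : ∀ n ∈ s2, n ≠ 0 := fun n hn => by
    have := Finset.mem_Icc.mp (hs2 hn)
    omega
  have h1 := integral_norm_sq_dpoly_le h0 (dconv s s 1 1) (1 / 2) hab (N := (N : ℝ) ^ 2)
    (fun n hn => by exact_mod_cast (Finset.mem_Icc.mp (hs2 hn)).2)
    (by exact_mod_cast Nat.one_le_pow _ _ hN)
  have h2 : ∀ w, ‖dpoly s 1 w‖ ^ 4 = ‖dpoly s2 (dconv s s 1 1) w‖ ^ 2 := by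
    intro w
    rw [← dpoly_mul, norm_mul]
    ring
  simp_rw [h2]
  refine h1.trans ?_
  have hlogN : 0 ≤ Real.log N := Real.log_nonneg (by exact_mod_cast hN)
  rw [Real.log_pow]
  push_cast
  refine mul_le_mul_of_nonneg_left ?_ (by
    have : 0 ≤ b - a := by linarith
    positivity)
  have h3 : ∀ n ∈ s2, ‖dconv s s 1 1 n‖ ≤ n.divisors.card := by
    intro n hn
    unfold dconv
    simp only [Pi.one_apply, mul_one, Finset.sum_const, nsmul_eq_mul, Complex.norm_natCast]
    rw [Nat.cast_le]
    refine Finset.card_le_card_of_injOn (fun p => p.1) ?_ ?_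
    · intro p hp
      simp only [Finset.mem_coe, Finset.mem_filter] at hp
      simp only [Finset.mem_coe, Nat.mem_divisors]
      exact ⟨⟨p.2, hp.2.symm⟩, h0 n hn⟩
    · intro p hp q hq hpq
      simp only [Finset.mem_coe, Finset.mem_filter, Finset.mem_product] at hp hq hpq
      have : 0 < p.1 := by have := hp.1.1; simp only [s, Finset.mem_Icc] at this; omega
      refine Prod.ext hpq ?_
      have h5 : p.1 * p.2 = p.1 * q.2 := by rw [hp.2, hpq, hq.2]
      exact Nat.eq_of_mul_eq_mul_left this h5
  calc ∑ n ∈ s2, ‖dconv s s 1 1 n‖ ^ 2 * (n : ℝ) ^ (-2 * (1 / 2) : ℝ)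
      ≤ ∑ n ∈ s2, (n.divisors.card : ℝ) ^ 2 / n := by
        refine Finset.sum_le_sum fun n hn => ?_
        have : (-2 * (1 / 2) : ℝ) = -1 := by norm_num
        rw [this, Real.rpow_neg_one, div_eq_mul_inv]
        gcongr
        exact h3 n hn
    _ ≤ ∑ n ∈ Finset.Icc 1 (N ^ 2), (n.divisors.card : ℝ) ^ 2 / n :=
        Finset.sum_le_sum_of_subset_of_nonneg hs2 fun _ _ _ => by positivity
    _ ≤ _ := by
        refine (sum_card_divisors_sq_div_le (N ^ 2)).trans (le_of_eq ?_)
        push_cast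
        rw [Real.log_pow]
        push_cast
        ring

lemma norm_mellin_le {E : Type*} [NormedAddCommGroup E] [NormedSpace ℂ E] (f : ℝ → E) {σ₁ σ₂ : ℝ}
    (h1 : MellinConvergent f σ₁) (h2 : MellinConvergent f σ₂) {s : ℂ}
    (hs1 : σ₁ ≤ s.re) (hs2 : s.re ≤ σ₂) :
    ‖mellin f s‖ ≤ ∫ x in Ioi (0 : ℝ), (‖(x : ℂ) ^ ((σ₁ : ℂ) - 1) • f x‖ +
      ‖(x : ℂ) ^ ((σ₂ : ℂ) - 1) • f x‖) := by
  unfold mellin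
  refine norm_integral_le_of_norm_le (h1.norm.add h2.norm) ?_
  filter_upwards [ae_restrict_mem measurableSet_Ioi] with x hx
  have hx : 0 < x := hx
  rw [norm_smul, norm_smul, norm_smul, ← add_mul]
  refine mul_le_mul_of_nonneg_right ?_ (norm_nonneg _)
  rw [Complex.norm_cpow_eq_rpow_re_of_pos hx, Complex.norm_cpow_eq_rpow_re_of_pos hx,
    Complex.norm_cpow_eq_rpow_re_of_pos hx]
  simp only [sub_re, ofReal_re, one_re]
  rcases le_total 1 x with h | h
  · have := Real.rpow_le_rpow_of_exponent_le h (sub_le_sub_right hs2 1)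
    have : 0 ≤ x ^ (σ₁ - 1) := by positivity
    linarith
  · have := Real.rpow_le_rpow_of_exponent_ge hx h (sub_le_sub_right hs1 1)
    have : 0 ≤ x ^ (σ₂ - 1) := by positivity
    linarith

lemma exists_norm_completedRiemannZeta₀_le (σ₁ σ₂ : ℝ) :
    ∃ C, ∀ s : ℂ, σ₁ ≤ s.re → s.re ≤ σ₂ → ‖completedRiemannZeta₀ s‖ ≤ C := by
  set P := (HurwitzZeta.hurwitzEvenFEPair 0) with hP
  have hconv : ∀ s, MellinConvergent P.f_modif s := fun s =>
    (P.isStrongFEPair_toStrongFEPair.hasMellin s).1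
  refine ⟨∫ x in Ioi (0 : ℝ), (‖(x : ℂ) ^ (((σ₁ / 2 : ℝ) : ℂ) - 1) • P.f_modif x‖ +
      ‖(x : ℂ) ^ (((σ₂ / 2 : ℝ) : ℂ) - 1) • P.f_modif x‖), fun s h1 h2 => ?_⟩
  have h3 : completedRiemannZeta₀ s = mellin P.f_modif (s / 2) / 2 := rfl
  have hre : (s / 2).re = s.re / 2 := by simp
  have := norm_mellin_le P.f_modif (hconv (σ₁ / 2 : ℝ)) (hconv (σ₂ / 2 : ℝ)) (s := s / 2)
    (by rw [hre]; linarith) (by rw [hre]; linarith)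
  rw [h3, norm_div]
  refine (div_le_self (norm_nonneg _) (by norm_num)).trans this

lemma norm_Gamma_le {s : ℂ} (hs : 0 < s.re) : ‖Complex.Gamma s‖ ≤ Real.Gamma s.re := by
  rw [Complex.Gamma_eq_integral hs, Real.Gamma_eq_integral hs, Complex.GammaIntegral]
  refine norm_integral_le_of_norm_le (Real.GammaIntegral_convergent hs) ?_
  filter_upwards [ae_restrict_mem measurableSet_Ioi] with x hx
  have hx : 0 < x := hx
  rw [norm_mul, Complex.norm_cpow_eq_rpow_re_of_pos hx, Complex.norm_real,
    Real.norm_of_nonneg (Real.exp_nonneg _)]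
  simp

lemma norm_cos_le_exp (z : ℂ) : ‖Complex.cos z‖ ≤ Real.exp |z.im| := by
  rw [Complex.cos, norm_div, Complex.norm_two, div_le_iff₀ two_pos]
  refine (norm_add_le _ _).trans ?_
  rw [Complex.norm_exp, Complex.norm_exp]
  have h1 : Real.exp (z * I).re ≤ Real.exp |z.im| := by
    simpa using neg_le_abs z.im
  have h2 : Real.exp (-z * I).re ≤ Real.exp |z.im| := by
    simpa using le_abs_self z.im
  linarith

lemma norm_sin_le_exp (z : ℂ) : ‖Complex.sin z‖ ≤ Real.exp |z.im| := by
  have := norm_cos_le_exp (z - π / 2)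
  rwa [Complex.cos_sub_pi_div_two, show (z - (π : ℂ) / 2).im = z.im by simp] at this

lemma exists_realGamma_le {a b : ℝ} (ha : 0 < a) :
    ∃ C, ∀ x ∈ Icc a b, Real.Gamma x ≤ C := by
  have : ContinuousOn Real.Gamma (Icc a b) := fun x hx =>
    (Real.differentiableAt_Gamma fun m => by
      have := hx.1
      have : (0 : ℝ) ≤ m := by positivity
      linarith).continuousAt.continuousWithinAt
  obtain ⟨C, hC⟩ := isCompact_Icc.exists_bound_of_continuousOn this
  exact ⟨C, fun x hx => (le_abs_self _).trans (hC x hx)⟩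

/-- The factor `ψ` of the functional equation `ζ(1 - s) = ψ(s) ζ(s)`. -/
def feFactor (s : ℂ) : ℂ := 2 * (2 * π) ^ (-s) * Complex.Gamma s * Complex.cos (π * s / 2)

lemma ne_neg_natCast_of_im_ne_zero {s : ℂ} (hs : s.im ≠ 0) (n : ℕ) : s ≠ -n := by
  rintro rfl
  simp at hs

lemma ne_one_of_im_ne_zero {s : ℂ} (hs : s.im ≠ 0) : s ≠ 1 := by
  rintro rfl
  simp at hs

lemma riemannZeta_one_sub_eq_feFactor_mul {s : ℂ} (hs : s.im ≠ 0) :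
    riemannZeta (1 - s) = feFactor s * riemannZeta s :=
  riemannZeta_one_sub (ne_neg_natCast_of_im_ne_zero hs) (ne_one_of_im_ne_zero hs)

lemma sin_pi_mul_ne_zero_of_im_ne_zero {s : ℂ} (hs : s.im ≠ 0) : Complex.sin (π * s) ≠ 0 := by
  intro h
  obtain ⟨k, hk⟩ := Complex.sin_eq_zero_iff.mp h
  have : s = k := by
    have hpi : (π : ℂ) ≠ 0 := by exact_mod_cast Real.pi_ne_zero
    apply mul_left_cancel₀ hpi
    rw [hk]
    ring
  rw [this] at hs
  simp at hs

lemma two_pi_ne_zero' : (2 * π : ℂ) ≠ 0 := by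
  exact mul_ne_zero two_ne_zero (by exact_mod_cast Real.pi_ne_zero)

lemma feFactor_mul_feFactor_one_sub {s : ℂ} (hs : s.im ≠ 0) :
    feFactor s * feFactor (1 - s) = 1 := by
  have hpi : (π : ℂ) ≠ 0 := by exact_mod_cast Real.pi_ne_zero
  have h1 : Complex.cos (π * (1 - s) / 2) = Complex.sin (π * s / 2) := by
    rw [← Complex.cos_pi_div_two_sub]
    congr 1
    ring
  have h2 : (2 * π : ℂ) ^ (-s) * (2 * π : ℂ) ^ (-(1 - s)) = (2 * π : ℂ)⁻¹ := by
    rw [← Complex.cpow_add _ _ two_pi_ne_zero', ← Complex.cpow_neg_one]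
    congr 1
    ring
  have h3 : Complex.sin (π * s) = 2 * Complex.sin (π * s / 2) * Complex.cos (π * s / 2) := by
    rw [← Complex.sin_two_mul]
    congr 1
    ring
  have h4 := sin_pi_mul_ne_zero_of_im_ne_zero hs
  have h5 := Complex.Gamma_mul_Gamma_one_sub s
  unfold feFactor
  rw [h1]
  calc _ = 4 * ((2 * π : ℂ) ^ (-s) * (2 * π : ℂ) ^ (-(1 - s))) *
        (Complex.Gamma s * Complex.Gamma (1 - s)) *
        (Complex.sin (π * s / 2) * Complex.cos (π * s / 2)) := by ring
    _ = 4 * (2 * π : ℂ)⁻¹ * (π / Complex.sin (π * s)) * (Complex.sin (π * s) / 2) := by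
        rw [h2, h5, h3]
        ring
    _ = 1 := by
        field_simp
        norm_num

lemma feFactor_conj (s : ℂ) : feFactor ((starRingEnd ℂ) s) = (starRingEnd ℂ) (feFactor s) := by
  unfold feFactor
  have h1 : (2 * π : ℂ) ^ (-(starRingEnd ℂ) s) = (starRingEnd ℂ) ((2 * π : ℂ) ^ (-s)) := by
    have h0 : (2 * π : ℂ) = ((2 * π : ℝ) : ℂ) := by push_cast; ring
    rw [h0, ← map_neg, Complex.cpow_conj, Complex.conj_ofReal]
    rw [Complex.arg_ofReal_of_nonneg (by positivity)]
    exact Real.pi_ne_zero.symm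
  have h2 : (π * (starRingEnd ℂ) s / 2 : ℂ) = (starRingEnd ℂ) (π * s / 2) := by
    rw [map_div₀, map_mul, Complex.conj_ofReal, Complex.conj_ofNat]
  rw [h1, h2, Complex.Gamma_conj, Complex.cos_conj]
  simp only [map_mul, Complex.conj_ofNat]

lemma norm_feFactor_one_half (t : ℝ) (ht : t ≠ 0) : ‖feFactor (1 / 2 + t * I)‖ = 1 := by
  have h1 := feFactor_mul_feFactor_one_sub (s := 1 / 2 + t * I) (by simpa using ht)
  have h2 : (1 - (1 / 2 + t * I) : ℂ) = (starRingEnd ℂ) (1 / 2 + t * I) := by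
    apply Complex.ext
    · norm_num
    · simp
  rw [h2, feFactor_conj, Complex.mul_conj'] at h1
  have h3 : ‖feFactor (1 / 2 + t * I)‖ ^ 2 = 1 := by exact_mod_cast h1
  exact (pow_eq_one_iff_of_nonneg (norm_nonneg _) two_ne_zero).mp h3

lemma norm_feFactor_three_half (t : ℝ) (ht : t ≠ 0) :
    ‖feFactor (3 / 2 + t * I)‖ = ‖(1 / 2 + t * I : ℂ)‖ / (2 * π) := by
  have h1 := norm_feFactor_one_half t ht
  set s : ℂ := 1 / 2 + t * I with hs
  have hs0 : s ≠ 0 := by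
    intro h
    have := congrArg Complex.im h
    simp [hs] at this
    exact ht this
  have h2 : (3 / 2 + t * I : ℂ) = s + 1 := by rw [hs]; ring
  have h3 : ‖Complex.cos (π * (s + 1) / 2)‖ = ‖Complex.cos (π * s / 2)‖ := by
    have h4 : Complex.cos (π * (s + 1) / 2) = - Complex.sin (π * s / 2) := by
      rw [← Complex.cos_add_pi_div_two]
      congr 1
      ring
    have h5 : Complex.sin (π * s / 2) = (starRingEnd ℂ) (Complex.cos (π * s / 2)) := by
      rw [← Complex.cos_conj, ← Complex.cos_pi_div_two_sub]
      congr 1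
      rw [map_div₀, map_mul, Complex.conj_ofReal, Complex.conj_ofNat]
      have h6 : (starRingEnd ℂ) s = 1 - s := by
        apply Complex.ext
        · norm_num [hs]
        · simp [hs]
      rw [h6]
      ring
    rw [h4, norm_neg, h5, RCLike.norm_conj]
  have h4 : (2 * π : ℂ) ^ (-(s + 1)) = (2 * π : ℂ) ^ (-s) / (2 * π) := by
    rw [neg_add, Complex.cpow_add _ _ two_pi_ne_zero', Complex.cpow_neg_one, div_eq_mul_inv]
  have h5 : ‖feFactor (s + 1)‖ = ‖feFactor s‖ * (‖s‖ / (2 * π)) := by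
    unfold feFactor
    rw [h4, Complex.Gamma_add_one _ hs0]
    simp only [norm_mul, norm_div]
    rw [h3, Complex.norm_real, Real.norm_of_nonneg Real.pi_pos.le, Complex.norm_two]
    ring
  rw [h2, h5, h1, one_mul]

lemma differentiableAt_feFactor {s : ℂ} (hs : s.im ≠ 0) : DifferentiableAt ℂ feFactor s := by
  unfold feFactor
  have h1 : DifferentiableAt ℂ Complex.Gamma s :=
    Complex.differentiableAt_Gamma s (ne_neg_natCast_of_im_ne_zero hs)
  have h2 : DifferentiableAt ℂ (fun s : ℂ => (2 * π : ℂ) ^ (-s)) s :=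
    differentiableAt_id.neg.const_cpow (Or.inl two_pi_ne_zero')
  have h3 : DifferentiableAt ℂ (fun s : ℂ => Complex.cos (π * s / 2)) s := by fun_prop
  exact ((h2.const_mul 2).mul h1).mul h3

lemma norm_ge_one_of_im {s : ℂ} (hs : 1 ≤ |s.im|) : 1 ≤ ‖s‖ := hs.trans (Complex.abs_im_le_norm s)

lemma exists_norm_feFactor_le_exp :
    ∃ C, 0 < C ∧ ∀ s : ℂ, -(1 / 2) ≤ s.re → s.re ≤ 3 / 2 → 1 ≤ |s.im| →
      ‖feFactor s‖ ≤ C * Real.exp (2 * |s.im|) := by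
  obtain ⟨C, hC⟩ := exists_realGamma_le (a := 1 / 2) (b := 5 / 2) (by norm_num)
  refine ⟨2 * (2 * π) * (|C| + 1), by positivity, fun s h1 h2 h3 => ?_⟩
  have hs0 : s ≠ 0 := norm_pos_iff.mp (zero_lt_one.trans_le (norm_ge_one_of_im h3))
  have hG : ‖Complex.Gamma s‖ ≤ |C| + 1 := by
    have h4 : Complex.Gamma s = Complex.Gamma (s + 1) / s := by
      rw [Complex.Gamma_add_one _ hs0]
      field_simp
    rw [h4, norm_div]
    refine (div_le_self (norm_nonneg _) (norm_ge_one_of_im h3)).trans ?_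
    have h5 : (s + 1).re = s.re + 1 := by simp
    refine (norm_Gamma_le (by rw [h5]; linarith)).trans ?_
    have := hC (s + 1).re ⟨by rw [h5]; linarith, by rw [h5]; linarith⟩
    have := le_abs_self C
    linarith
  have hP : ‖(2 * π : ℂ) ^ (-s)‖ ≤ 2 * π := by
    have h0 : (2 * π : ℂ) = ((2 * π : ℝ) : ℂ) := by push_cast; ring
    rw [h0, Complex.norm_cpow_eq_rpow_re_of_pos (by positivity), neg_re]
    have : (2 * π : ℝ) ^ (-s.re) ≤ (2 * π) ^ (1 : ℝ) :=
      Real.rpow_le_rpow_of_exponent_le (by linarith [Real.pi_gt_three]) (by linarith)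
    rwa [Real.rpow_one] at this
  have hcos : ‖Complex.cos (π * s / 2)‖ ≤ Real.exp (2 * |s.im|) := by
    refine (norm_cos_le_exp _).trans (Real.exp_le_exp.mpr ?_)
    have : (π * s / 2 : ℂ).im = π / 2 * s.im := by
      have : (π * s / 2 : ℂ) = ((π / 2 : ℝ) : ℂ) * s := by push_cast; ring
      rw [this, Complex.im_ofReal_mul]
    rw [this, abs_mul, abs_of_pos (by positivity)]
    gcongr
    linarith [Real.pi_lt_four]
  unfold feFactor
  simp only [norm_mul, Complex.norm_two]
  rw [mul_comm (2 : ℂ) (π : ℂ), mul_comm (π : ℂ) (2 : ℂ)]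
  gcongr

lemma exists_norm_riemannZeta_le_exp :
    ∃ C, 0 < C ∧ ∀ s : ℂ, -(1 / 2) ≤ s.re → s.re ≤ 3 / 2 → 1 ≤ |s.im| →
      ‖riemannZeta s‖ ≤ C * Real.exp (2 * |s.im|) := by
  obtain ⟨C₁, hC₁⟩ := exists_norm_completedRiemannZeta₀_le (-(1 / 2)) (3 / 2)
  obtain ⟨C₂, hC₂⟩ := exists_realGamma_le (a := 1 / 4) (b := 5 / 4) (by norm_num)
  refine ⟨(|C₁| + 2) * (π * (|C₂| + 1)), by positivity, fun s h1 h2 h3 => ?_⟩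
  have hs0 : s ≠ 0 := norm_pos_iff.mp (zero_lt_one.trans_le (norm_ge_one_of_im h3))
  have him : s.im ≠ 0 := by
    intro h
    rw [h] at h3
    norm_num at h3
  rw [riemannZeta_eq_completedRiemannZeta₀ hs0, norm_div, div_eq_mul_inv, ← norm_inv, mul_assoc]
  have hnum : ‖completedRiemannZeta₀ s - 1 / s - 1 / (1 - s)‖ ≤ |C₁| + 2 := by
    have h4 : ‖1 / s‖ ≤ 1 := by
      rw [norm_div, norm_one]
      exact div_le_one_of_le₀ (norm_ge_one_of_im h3) (norm_nonneg _)
    have h5 : ‖1 / (1 - s)‖ ≤ 1 := by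
      rw [norm_div, norm_one]
      exact div_le_one_of_le₀ (norm_ge_one_of_im (by simpa using h3)) (norm_nonneg _)
    have h6 := hC₁ s h1 h2
    have h7 := le_abs_self C₁
    have h8 := norm_sub_le (completedRiemannZeta₀ s - 1 / s) (1 / (1 - s))
    have h9 := norm_sub_le (completedRiemannZeta₀ s) (1 / s)
    linarith
  have hden : ‖((π : ℂ) ^ (-s / 2) * Complex.Gamma (s / 2))⁻¹‖ ≤
      π * (|C₂| + 1) * Real.exp (2 * |s.im|) := by
    have hw : (s / 2).im ≠ 0 := by simpa using him
    have hre : (s / 2).re = s.re / 2 := by simp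
    have himw : (s / 2).im = s.im / 2 := by simp
    have hsin := sin_pi_mul_ne_zero_of_im_ne_zero hw
    have hpi : (π : ℂ) ≠ 0 := by exact_mod_cast Real.pi_ne_zero
    have hGne : Complex.Gamma (s / 2) ≠ 0 :=
      Complex.Gamma_ne_zero (ne_neg_natCast_of_im_ne_zero hw)
    have h4 : (Complex.Gamma (s / 2))⁻¹ =
        Complex.Gamma (1 - s / 2) * Complex.sin (π * (s / 2)) / π := by
      have := Complex.Gamma_mul_Gamma_one_sub (s / 2)
      rw [eq_div_iff hsin] at this
      rw [eq_div_iff hpi, inv_mul_eq_iff_eq_mul₀ hGne, ← mul_assoc]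
      exact this.symm
    have h5 : ‖Complex.Gamma (1 - s / 2)‖ ≤ |C₂| + 1 := by
      have h6 : (1 - s / 2).re = 1 - s.re / 2 := by simp
      refine (norm_Gamma_le (by rw [h6]; linarith)).trans ?_
      have := hC₂ (1 - s / 2).re ⟨by rw [h6]; linarith, by rw [h6]; linarith⟩
      have := le_abs_self C₂
      linarith
    have h6 : ‖Complex.sin (π * (s / 2))‖ ≤ Real.exp (2 * |s.im|) := by
      refine (norm_sin_le_exp _).trans (Real.exp_le_exp.mpr ?_)
      rw [Complex.im_ofReal_mul, himw, abs_mul, abs_div, abs_of_pos Real.pi_pos, abs_two]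
      have : 0 ≤ |s.im| := abs_nonneg _
      nlinarith [Real.pi_lt_four]
    have h7 : ‖((π : ℂ) ^ (-s / 2))⁻¹‖ ≤ π := by
      rw [← Complex.cpow_neg, Complex.norm_cpow_eq_rpow_re_of_pos Real.pi_pos]
      have h8 : (-(-s / 2)).re = s.re / 2 := by simp; ring
      rw [h8]
      have : π ^ (s.re / 2) ≤ π ^ (1 : ℝ) :=
        Real.rpow_le_rpow_of_exponent_le (by linarith [Real.pi_gt_three]) (by linarith)
      rwa [Real.rpow_one] at this
    rw [mul_inv, h4, norm_mul, norm_div, norm_mul, Complex.norm_real,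
      Real.norm_of_nonneg Real.pi_pos.le, mul_assoc]
    gcongr
    refine (div_le_self (by positivity) (by linarith [Real.pi_gt_three])).trans ?_
    gcongr
  gcongr

/-- Maximum modulus principle on a rectangle. -/
lemma norm_le_of_rectangle_boundary {f : ℂ → ℂ} {α β c d W : ℝ} 
    (hf : ∀ z : ℂ, z.re ∈ Icc α β → z.im ∈ Icc c d → DifferentiableAt ℂ f z)
    (hl : ∀ y ∈ Icc c d, ‖f (α + y * I)‖ ≤ W) (hr : ∀ y ∈ Icc c d, ‖f (β + y * I)‖ ≤ W)
    (hb : ∀ x ∈ Icc α β, ‖f (x + c * I)‖ ≤ W) (ht : ∀ x ∈ Icc α β, ‖f (x + d * I)‖ ≤ W)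
    {z : ℂ} (hz1 : z.re ∈ Icc α β) (hz2 : z.im ∈ Icc c d) : ‖f z‖ ≤ W := by
  have hz : z = z.re + z.im * I := (Complex.re_add_im z).symm
  rcases hz1.1.eq_or_lt with h | h1
  · rw [hz, ← h]; exact hl _ hz2
  rcases hz1.2.eq_or_lt with h | h2
  · rw [hz, h]; exact hr _ hz2
  rcases hz2.1.eq_or_lt with h | h3
  · rw [hz, ← h]; exact hb _ hz1
  rcases hz2.2.eq_or_lt with h | h4
  · rw [hz, h]; exact ht _ hz1
  set U : Set ℂ := Ioo α β ×ℂ Ioo c d with hU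
  have hUo : IsOpen U := isOpen_Ioo.reProdIm isOpen_Ioo
  have hcl : closure U ⊆ Icc α β ×ℂ Icc c d :=
    closure_minimal (fun w hw => ⟨⟨hw.1.1.le, hw.1.2.le⟩, ⟨hw.2.1.le, hw.2.2.le⟩⟩)
      (isClosed_Icc.reProdIm isClosed_Icc)
  have hbd : Bornology.IsBounded U :=
    (Metric.isBounded_Ioo α β).reProdIm (Metric.isBounded_Ioo c d)
  have hd : DiffContOnCl ℂ f U := by
    refine ⟨fun w hw => (hf w ?_ ?_).differentiableWithinAt,
      fun w hw => (hf w ?_ ?_).continuousAt.continuousWithinAt⟩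
    · exact (hcl (subset_closure hw)).1
    · exact (hcl (subset_closure hw)).2
    · exact (hcl hw).1
    · exact (hcl hw).2
  refine Complex.norm_le_of_forall_mem_frontier_norm_le hbd hd ?_
    (subset_closure (show z ∈ U from ⟨⟨h1, h2⟩, ⟨h3, h4⟩⟩))
  intro w hw
  have hw' : w = w.re + w.im * I := (Complex.re_add_im w).symm
  have hw1 := hcl hw.1
  have hw2 : w ∉ U := by
    have := hw.2
    rwa [hUo.interior_eq] at this
  obtain ⟨⟨a1, a2⟩, ⟨a3, a4⟩⟩ := hw1
  rcases a1.eq_or_lt with h | k1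
  · rw [hw', ← h]; exact hl _ ⟨a3, a4⟩
  rcases a2.eq_or_lt with h | k2
  · rw [hw', h]; exact hr _ ⟨a3, a4⟩
  rcases a3.eq_or_lt with h | k3
  · rw [hw', ← h]; exact hb _ ⟨a1, a2⟩
  rcases a4.eq_or_lt with h | k4
  · rw [hw', h]; exact ht _ ⟨a1, a2⟩
  exact absurd ⟨⟨k1, k2⟩, ⟨k3, k4⟩⟩ hw2

lemma differentiableAt_integral_shift {f : ℂ → ℂ} {g : ℝ → ℂ} {a b : ℝ}
    (hf : DifferentiableOn ℂ f {s | 0 < s.im}) (hab : a ≤ b) (hg : ContinuousOn g (Icc a b))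
    {s : ℂ} (hs : -a < s.im) :
    DifferentiableAt ℂ (fun s => ∫ u in a..b, f (s + u * I) * g u) s := by
  have hopen : IsOpen {s : ℂ | 0 < s.im} := isOpen_lt continuous_const Complex.continuous_im
  set ε := (s.im + a) / 2 with hε
  have hε0 : 0 < ε := by rw [hε]; linarith
  have hmem : ∀ z ∈ Metric.closedBall s ε, ∀ u ∈ Icc a b, 0 < (z + u * I).im := by
    intro z hz u hu
    have h1 : |(z - s).im| ≤ ε := (Complex.abs_im_le_norm _).trans (by
      rwa [← dist_eq_norm])
    rw [Complex.sub_im, abs_le] at h1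
    have h2 : (z + u * I).im = z.im + u := by simp
    rw [h2]
    have := hu.1
    linarith [h1.1]
  have hcf : ContinuousOn f {s | 0 < s.im} := hf.continuousOn
  have hdf : DifferentiableOn ℂ (deriv f) {s | 0 < s.im} := hf.deriv hopen
  have hK : IsCompact (Metric.closedBall s ε ×ˢ Icc a b) :=
    (isCompact_closedBall s ε).prod isCompact_Icc
  have hcont : ∀ F : ℂ → ℂ, ContinuousOn F {s | 0 < s.im} →
      ContinuousOn (fun p : ℂ × ℝ => F (p.1 + p.2 * I) * g p.2)
        (Metric.closedBall s ε ×ˢ Icc a b) := by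
    intro F hF
    refine ContinuousOn.mul (hF.comp (by fun_prop) ?_) (hg.comp continuousOn_snd ?_)
    · intro p hp
      exact hmem p.1 hp.1 p.2 hp.2
    · intro p hp
      exact hp.2
  obtain ⟨C, hC⟩ := hK.exists_bound_of_continuousOn (hcont _ hdf.continuousOn)
  have hsl : ∀ F : ℂ → ℂ, ContinuousOn F {s | 0 < s.im} → ∀ z ∈ Metric.closedBall s ε,
      ContinuousOn (fun u : ℝ => F (z + u * I) * g u) (Icc a b) := by
    intro F hF z hz
    exact (hcont F hF).comp (f := fun u : ℝ => (z, u)) (by fun_prop) fun u hu => ⟨hz, hu⟩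
  have huIcc : uIcc a b = Icc a b := uIcc_of_le hab
  have hball : Metric.ball s ε ∈ nhds s := Metric.ball_mem_nhds s hε0
  have key := intervalIntegral.hasDerivAt_integral_of_dominated_loc_of_deriv_le
    (μ := volume) (a := a) (b := b) (F := fun z u => f (z + u * I) * g u)
    (F' := fun z u => deriv f (z + u * I) * g u) (x₀ := s) (bound := fun _ => C)
    (s := Metric.ball s ε) hball ?_ ?_ ?_ ?_ ?_ ?_
  · exact key.2.differentiableAt
  · filter_upwards [hball] with z hz
    have := (hsl f hcf z (Metric.ball_subset_closedBall hz))
    rw [uIoc_of_le hab]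
    exact (this.mono Ioc_subset_Icc_self).aestronglyMeasurable measurableSet_Ioc
  · exact ContinuousOn.intervalIntegrable (by
      rw [huIcc]; exact hsl f hcf s (Metric.mem_closedBall_self hε0.le))
  · rw [uIoc_of_le hab]
    exact ((hsl _ hdf.continuousOn s (Metric.mem_closedBall_self hε0.le)).mono
      Ioc_subset_Icc_self).aestronglyMeasurable measurableSet_Ioc
  · refine Eventually.of_forall fun u hu z hz => ?_
    rw [uIoc_of_le hab] at hu
    exact hC (z, u) ⟨Metric.ball_subset_closedBall hz, Ioc_subset_Icc_self hu⟩
  · exact intervalIntegrable_const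
  · refine Eventually.of_forall fun u hu z hz => ?_
    rw [uIoc_of_le hab] at hu
    have h1 := hmem z (Metric.ball_subset_closedBall hz) u (Ioc_subset_Icc_self hu)
    have h2 : HasDerivAt f (deriv f (z + u * I)) (z + u * I) :=
      (hf.differentiableAt (hopen.mem_nhds h1)).hasDerivAt
    exact (h2.comp_add_const z (u * I)).mul_const _

lemma integral_mul_le_sqrt_mul_sqrt {X : Type*} [MeasurableSpace X] {μ : Measure X} {f g : X → ℝ}
    (hf0 : 0 ≤ᵐ[μ] f) (hg0 : 0 ≤ᵐ[μ] g) (hf : MemLp f 2 μ) (hg : MemLp g 2 μ) :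
    ∫ x, f x * g x ∂μ ≤ √(∫ x, f x ^ 2 ∂μ) * √(∫ x, g x ^ 2 ∂μ) := by
  have h := integral_mul_le_Lp_mul_Lq_of_nonneg (μ := μ) Real.HolderConjugate.two_two hf0 hg0
    (by simpa using hf) (by simpa using hg)
  rw [Real.sqrt_eq_rpow, Real.sqrt_eq_rpow]
  simpa using h

lemma norm_intervalIntegral_mul_le_sqrt {f g : ℝ → ℂ} {a b : ℝ} (hab : a ≤ b)
    (hf : ContinuousOn f (Icc a b)) (hg : ContinuousOn g (Icc a b)) :
    ‖∫ u in a..b, f u * g u‖ ≤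
      √(∫ u in a..b, ‖f u‖ ^ 2) * √(∫ u in a..b, ‖g u‖ ^ 2) := by
  refine (intervalIntegral.norm_integral_le_integral_norm hab).trans ?_
  simp_rw [norm_mul]
  rw [intervalIntegral.integral_of_le hab, intervalIntegral.integral_of_le hab,
    intervalIntegral.integral_of_le hab]
  have hmem : ∀ f : ℝ → ℂ, ContinuousOn f (Icc a b) →
      MemLp (fun u => ‖f u‖) 2 (volume.restrict (Ioc a b)) := by
    intro f hf
    have h1 : MemLp f 2 (volume.restrict (Icc a b)) := by
      obtain ⟨C, hC⟩ := isCompact_Icc.exists_bound_of_continuousOn hf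
      exact MemLp.of_bound (hf.aestronglyMeasurable measurableSet_Icc) C
        ((ae_restrict_mem measurableSet_Icc).mono fun x hx => hC x hx)
    exact (h1.mono_measure (Measure.restrict_mono Ioc_subset_Icc_self le_rfl)).norm
  exact integral_mul_le_sqrt_mul_sqrt (Eventually.of_forall fun _ => norm_nonneg _)
    (Eventually.of_forall fun _ => norm_nonneg _) (hmem f hf) (hmem g hg)

/-- A mean-square version of the three lines theorem. -/
theorem integral_norm_sq_le_of_three_lines {f : ℂ → ℂ} {α β σ a b H κ A B Q W : ℝ}
    (hf : DifferentiableOn ℂ f {s | 0 < s.im}) (hσ1 : α ≤ σ) (hσ2 : σ ≤ β) (hab : a ≤ b)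
    (hH : 0 < H) (hHa : H < a) (hA0 : 0 ≤ A) (hB0 : 0 ≤ B) (hQ0 : 0 ≤ Q)
    (hA : ∫ t in (a - H)..(b + H), ‖f (α + t * I)‖ ^ 2 ≤ A ^ 2)
    (hB : ∫ t in (a - H)..(b + H), ‖f (β + t * I)‖ ^ 2 ≤ B ^ 2)
    (hQ : ∀ x ∈ Icc α β, ∀ t ∈ Icc (a - H) (b + H), ‖f (x + t * I)‖ ≤ Q)
    (hWA : A * Real.exp (κ * (α - σ)) ≤ W) (hWB : B * Real.exp (κ * (β - σ)) ≤ W)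
    (hWQ : Q * √(b - a) * Real.exp (|κ| * (β - α) - H ^ 2) ≤ W) :
    ∫ t in a..b, ‖f (σ + t * I)‖ ^ 2 ≤ (Real.exp ((β - α) ^ 2) * W) ^ 2 := by
  have hcf : ContinuousOn f {s | 0 < s.im} := hf.continuousOn
  have hline : ∀ x : ℝ, ∀ c d : ℝ, 0 < c → ContinuousOn (fun t : ℝ => f (x + t * I)) (Icc c d) := by
    intro x c d hc
    refine hcf.comp (by fun_prop) fun t ht => ?_
    have : (x + t * I : ℂ).im = t := by simp
    change 0 < (x + t * I : ℂ).im
    rw [this]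
    linarith [ht.1]
  set J := ∫ t in a..b, ‖f (σ + t * I)‖ ^ 2 with hJ
  have hJ0 : 0 ≤ J := intervalIntegral.integral_nonneg hab fun _ _ => by positivity
  set g : ℝ → ℂ := fun u => (starRingEnd ℂ) (f (σ + u * I)) with hg
  have hgc : ContinuousOn g (Icc a b) :=
    Complex.continuous_conj.comp_continuousOn (hline σ a b (by linarith))
  set Φ : ℂ → ℂ := fun s => ∫ u in a..b, f (s + u * I) * g u with hΦ
  have hΦd : ∀ s : ℂ, -a < s.im → DifferentiableAt ℂ Φ s := fun s hs =>
    differentiableAt_integral_shift hf hab hgc hs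
  have hΦσ : Φ σ = J := by
    rw [hJ, ← intervalIntegral.integral_ofReal]
    refine intervalIntegral.integral_congr fun u _ => ?_
    simp only [hg, Complex.mul_conj']
    push_cast
    rfl
  have hgJ : ∫ u in a..b, ‖g u‖ ^ 2 = J := by
    refine intervalIntegral.integral_congr fun u _ => ?_
    simp only [hg, RCLike.norm_conj]
  have hcs : ∀ x y : ℝ, |y| ≤ H → ‖Φ (x + y * I)‖ ≤
      √(∫ u in a..b, ‖f (x + (u + y : ℝ) * I)‖ ^ 2) * √J := by
    intro x y hy
    rw [abs_le] at hy
    have h1 : ∀ u : ℝ, (x + y * I + u * I : ℂ) = x + (u + y : ℝ) * I := by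
      intro u; push_cast; ring
    simp only [hΦ, h1]
    rw [← hgJ]
    refine norm_intervalIntegral_mul_le_sqrt hab ?_ hgc
    refine (hline x (a - H) (b + H) (by linarith)).comp
      (f := fun u : ℝ => u + y) (by fun_prop) fun u hu => ?_
    exact ⟨by linarith [hu.1, hy.1], by linarith [hu.2, hy.2]⟩
  have hside : ∀ x y C : ℝ, |y| ≤ H → 0 ≤ C →
      ∫ t in (a - H)..(b + H), ‖f (x + t * I)‖ ^ 2 ≤ C ^ 2 → ‖Φ (x + y * I)‖ ≤ C * √J := by
    intro x y C hy hC hInt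
    refine (hcs x y hy).trans ?_
    gcongr
    rw [abs_le] at hy
    apply Real.sqrt_le_iff.mpr ⟨hC, ?_⟩
    refine le_trans ?_ hInt
    rw [intervalIntegral.integral_comp_add_right (fun t => ‖f (x + (t : ℝ) * I)‖ ^ 2)]
    refine intervalIntegral.integral_mono_interval (by linarith) (by linarith) (by linarith)
      (Eventually.of_forall fun t => by positivity) ?_
    refine ContinuousOn.intervalIntegrable ?_
    rw [uIcc_of_le (by linarith)]
    exact (hline x _ _ (by linarith)).norm.pow 2
  have hhor : ∀ x ∈ Icc α β, ∀ y : ℝ, |y| ≤ H → ‖Φ (x + y * I)‖ ≤ Q * √(b - a) * √J := by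
    intro x hx y hy
    refine (hcs x y hy).trans ?_
    gcongr
    apply Real.sqrt_le_iff.mpr ⟨by positivity, ?_⟩
    rw [mul_pow, Real.sq_sqrt (by linarith)]
    have hb : ∀ u ∈ uIoc a b, ‖‖f (x + (u + y : ℝ) * I)‖ ^ 2‖ ≤ Q ^ 2 := by
      intro u hu
      rw [uIoc_of_le hab] at hu
      rw [abs_le] at hy
      rw [Real.norm_of_nonneg (by positivity)]
      have := hQ x hx (u + y) ⟨by linarith [hu.1], by linarith [hu.2]⟩
      gcongr
    have := intervalIntegral.norm_integral_le_of_norm_le_const hb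
    rw [abs_of_nonneg (by linarith)] at this
    exact (le_abs_self _).trans this
  set G : ℂ → ℂ := fun s => Φ s * cexp (κ * (s - σ) + (s - σ) ^ 2) with hG
  have hGn : ∀ x y : ℝ, ‖G (x + y * I)‖ =
      ‖Φ (x + y * I)‖ * Real.exp (κ * (x - σ) + ((x - σ) ^ 2 - y ^ 2)) := by
    intro x y
    simp only [hG, norm_mul, Complex.norm_exp]
    congr 2
    simp [sq]
  have hαβ : 0 ≤ β - α := by linarith
  have hsq : ∀ x ∈ Icc α β, (x - σ) ^ 2 ≤ (β - α) ^ 2 := by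
    intro x hx
    apply sq_le_sq'
    · linarith [hx.1]
    · linarith [hx.2]
  have hvert : ∀ x ∈ Icc α β, ∀ C : ℝ, 0 ≤ C → C * Real.exp (κ * (x - σ)) ≤ W →
      ∫ t in (a - H)..(b + H), ‖f (x + t * I)‖ ^ 2 ≤ C ^ 2 → ∀ y ∈ Icc (-H) H,
      ‖G (x + y * I)‖ ≤ Real.exp ((β - α) ^ 2) * W * √J := by
    intro x hx C hC hCW hInt y hy
    rw [hGn]
    calc _ ≤ C * √J * Real.exp (κ * (x - σ) + (β - α) ^ 2) := by
          gcongr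
          · exact hside x y C (abs_le.mpr hy) hC hInt
          · nlinarith [hsq x hx, sq_nonneg y]
      _ = Real.exp ((β - α) ^ 2) * (C * Real.exp (κ * (x - σ))) * √J := by
          rw [Real.exp_add]
          ring
      _ ≤ _ := by gcongr
  have hhorG : ∀ x ∈ Icc α β, ∀ y : ℝ, |y| = H →
      ‖G (x + y * I)‖ ≤ Real.exp ((β - α) ^ 2) * W * √J := by
    intro x hx y hy
    rw [hGn]
    have hy2 : y ^ 2 = H ^ 2 := by rw [← hy, sq_abs]
    have hκ : κ * (x - σ) ≤ |κ| * (β - α) := by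
      refine (le_abs_self _).trans ?_
      rw [abs_mul]
      gcongr
      rw [abs_le]
      exact ⟨by linarith [hx.1], by linarith [hx.2]⟩
    calc _ ≤ Q * √(b - a) * √J * Real.exp (|κ| * (β - α) - H ^ 2 + (β - α) ^ 2) := by
          refine mul_le_mul (hhor x hx y hy.le) (Real.exp_le_exp.mpr ?_) (by positivity)
            (by positivity)
          rw [hy2]
          linarith [hsq x hx]
      _ = Real.exp ((β - α) ^ 2) * (Q * √(b - a) * Real.exp (|κ| * (β - α) - H ^ 2)) * √J := by
          rw [Real.exp_add (|κ| * (β - α) - H ^ 2)]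
          ring
      _ ≤ _ := by gcongr
  have hmain : ‖G σ‖ ≤ Real.exp ((β - α) ^ 2) * W * √J := by
    refine norm_le_of_rectangle_boundary (α := α) (β := β) (c := -H) (d := H) ?_ ?_ ?_ ?_ ?_
      (by simpa using ⟨hσ1, hσ2⟩) (by simpa using hH.le)
    · intro z _ hz
      have h1 := hΦd z (by linarith [hz.1])
      have h2 : DifferentiableAt ℂ (fun s : ℂ => cexp (κ * (s - σ) + (s - σ) ^ 2)) z := by fun_prop
      exact h1.mul h2
    · exact hvert α ⟨le_rfl, by linarith⟩ A hA0 hWA hA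
    · exact hvert β ⟨by linarith, le_rfl⟩ B hB0 hWB hB
    · intro x hx
      have := hhorG x hx (-H) (by rw [abs_neg, abs_of_pos hH])
      push_cast at this ⊢
      exact this
    · intro x hx
      exact hhorG x hx H (abs_of_pos hH)
  have hGσ : ‖G σ‖ = J := by
    simp only [hG, sub_self, mul_zero, ne_eq, OfNat.ofNat_ne_zero, not_false_eq_true, zero_pow,
      add_zero, Complex.exp_zero, mul_one, hΦσ, Complex.norm_real, Real.norm_of_nonneg hJ0]
  rw [hGσ] at hmain
  have hW0 : 0 ≤ W := le_trans (by positivity) hWA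
  have hs : √J * √J = J := Real.mul_self_sqrt hJ0
  have h3 : √J ≤ Real.exp ((β - α) ^ 2) * W := by
    rcases (Real.sqrt_nonneg J).eq_or_lt with h | h
    · rw [← h]; positivity
    · refine le_of_mul_le_mul_right ?_ h
      rw [hs]
      exact hmain
  rw [← hs, ← sq]
  gcongr

lemma summable_mul_natCast_cpow_neg {c : ℕ → ℂ} (hc : ∀ n, ‖c n‖ ≤ 1) {w : ℂ} (hw : 1 < w.re) :
    Summable fun n : ℕ => c n * (n : ℂ) ^ (-w) := by
  refine Summable.of_norm_bounded (Real.summable_nat_rpow.mpr (show -w.re < -1 by linarith))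
    fun n => ?_
  rcases Nat.eq_zero_or_pos n with rfl | hn
  · have : w ≠ 0 := by rintro rfl; simp at hw; linarith
    simp [this]
    positivity
  · rw [norm_mul, norm_natCast_cpow_neg hn.ne']
    exact mul_le_of_le_one_left (by positivity) (hc n)

lemma norm_tsum_sub_dpoly_le {c : ℕ → ℂ} (hc : ∀ n, ‖c n‖ ≤ 1) {w : ℂ} (hw : 1 < w.re) (M : ℕ) :
    ‖∑' n : ℕ, c n * (n : ℂ) ^ (-w) - dpoly (Finset.Icc 1 M) c w‖ ≤
      ∑' n : ℕ, ((n + (M + 1) : ℕ) : ℝ) ^ (-w.re) := by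
  have hw0 : w ≠ 0 := by rintro rfl; simp at hw; linarith
  have h1 := (summable_mul_natCast_cpow_neg hc hw).sum_add_tsum_nat_add (M + 1)
  have h2 : ∑ n ∈ Finset.range (M + 1), c n * (n : ℂ) ^ (-w) = dpoly (Finset.Icc 1 M) c w := by
    unfold dpoly
    rw [Finset.range_eq_Ico, Finset.sum_eq_sum_Ico_succ_bot (by omega)]
    simp [hw0]
    rfl
  rw [← h1, h2, add_sub_cancel_left]
  have hs : Summable fun n : ℕ => ((n + (M + 1) : ℕ) : ℝ) ^ (-w.re) :=
    (summable_nat_add_iff (M + 1)).mpr (Real.summable_nat_rpow.mpr (show -w.re < -1 by linarith))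
  refine tsum_of_norm_bounded hs.hasSum fun n => ?_
  rw [norm_mul, norm_natCast_cpow_neg (by omega)]
  exact mul_le_of_le_one_left (by positivity) (hc _)

lemma riemannZeta_eq_tsum_cpow_neg {w : ℂ} (hw : 1 < w.re) :
    riemannZeta w = ∑' n : ℕ, (1 : ℕ → ℂ) n * (n : ℂ) ^ (-w) := by
  rw [zeta_eq_tsum_one_div_nat_cpow hw]
  refine tsum_congr fun n => ?_
  rw [Complex.cpow_neg, Pi.one_apply, one_mul, one_div]

lemma exists_norm_riemannZeta_sub_dpoly_le {σ : ℝ} (hσ : 1 < σ) (N : ℕ) {δ : ℝ} (hδ : 0 < δ) :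
    ∃ M ≥ N, ∀ t : ℝ, ‖riemannZeta (σ + t * I) - dpoly (Finset.Icc 1 M) 1 (σ + t * I)‖ ≤ δ := by
  have h1 := tendsto_sum_nat_add fun n : ℕ => (n : ℝ) ^ (-σ)
  have h2 := (h1.comp (tendsto_add_atTop_nat 1)).eventually (gt_mem_nhds hδ)
  obtain ⟨M, hM1, hM2⟩ := (h2.and (eventually_ge_atTop N)).exists
  refine ⟨M, hM2, fun t => ?_⟩
  have hre : (σ + t * I : ℂ).re = σ := by simp
  rw [riemannZeta_eq_tsum_cpow_neg (by rw [hre]; exact hσ)]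
  refine (norm_tsum_sub_dpoly_le (by simp) (by rw [hre]; exact hσ) M).trans ?_
  rw [hre]
  exact hM1.le

lemma sum_Ioc_rpow_neg_three_le {N : ℕ} (hN : 1 ≤ N) (M : ℕ) :
    ∑ n ∈ Finset.Ioc N M, (n : ℝ) ^ (-3 : ℝ) ≤ 1 / (N : ℝ) ^ 2 := by
  rcases le_or_gt N M with hNM | hNM
  · have h1 := sum_Ioc_inv_sq_le_sub (α := ℝ) (k := N) (n := M) (by omega) hNM
    have hN0 : (0 : ℝ) < N := by exact_mod_cast hN
    calc _ ≤ ∑ n ∈ Finset.Ioc N M, (1 / (N : ℝ)) * ((n : ℝ) ^ 2)⁻¹ := by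
          refine Finset.sum_le_sum fun n hn => ?_
          have hn' : N < n := (Finset.mem_Ioc.mp hn).1
          have hnN : (N : ℝ) ≤ n := by exact_mod_cast hn'.le
          have hn0 : (0 : ℝ) < n := hN0.trans_le hnN
          rw [Real.rpow_neg hn0.le]
          have : (n : ℝ) ^ (3 : ℝ) = n * n ^ 2 := by
            rw [show (3 : ℝ) = ((3 : ℕ) : ℝ) by norm_num, Real.rpow_natCast]; ring
          rw [this, mul_inv]
          gcongr
          rw [one_div]
          gcongr
      _ ≤ (1 / (N : ℝ)) * ((N : ℝ)⁻¹ - (M : ℝ)⁻¹) := by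
          rw [← Finset.mul_sum]
          gcongr
      _ ≤ (1 / (N : ℝ)) * (1 / N) := by
          gcongr
          rw [one_div]
          have : (0 : ℝ) ≤ (M : ℝ)⁻¹ := by positivity
          linarith
      _ = _ := by ring
  · rw [Finset.Ioc_eq_empty (by omega)]
    simp

lemma one_add_log_le_two_sqrt {x : ℝ} (hx : 0 < x) : 1 + Real.log x ≤ 2 * √x := by
  have h := Real.log_le_sub_one_of_pos (Real.sqrt_pos.mpr hx)
  rw [Real.log_sqrt hx.le] at h
  linarith

lemma exists_integral_zeta_sub_dpoly_three_half_le :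
    ∃ C, 0 < C ∧ ∀ N : ℕ, 1 ≤ N → ∀ a b : ℝ, a ≤ b →
      ∫ t in a..b, ‖riemannZeta ((3 / 2 : ℝ) + t * I) -
        dpoly (Finset.Icc 1 N) 1 ((3 / 2 : ℝ) + t * I)‖ ^ 2 ≤ C * (1 + (b - a) / (N : ℝ) ^ 2) := by
  have hsum : Summable fun n : ℕ => (n : ℝ) ^ (-(3 / 2 : ℝ)) :=
    Real.summable_nat_rpow.mpr (by norm_num)
  set Z := ∑' n : ℕ, (n : ℝ) ^ (-(3 / 2 : ℝ)) with hZ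
  have hZ0 : 0 ≤ Z := tsum_nonneg fun n => by positivity
  refine ⟨16 * Z + 8 * Z ^ 2 + 4, by positivity, fun N hN a b hab => ?_⟩
  have hN0 : (0 : ℝ) < N := by exact_mod_cast hN
  obtain ⟨M, hMN, hM⟩ := exists_norm_riemannZeta_sub_dpoly_le (σ := 3 / 2) (by norm_num) N
    (δ := 1 / N) (by positivity)
  have hpart : ∀ w, dpoly (Finset.Icc 1 M) 1 w = dpoly (Finset.Icc 1 N) 1 w +
      dpoly (Finset.Ioc N M) 1 w := by
    intro w
    unfold dpoly
    rw [← Finset.sum_union]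
    · congr 1
      ext n
      simp only [Finset.mem_union, Finset.mem_Icc, Finset.mem_Ioc]
      omega
    · rw [Finset.disjoint_left]
      intro n h1 h2
      have := Finset.mem_Icc.mp h1
      have := Finset.mem_Ioc.mp h2
      omega
  have hs0 : ∀ n ∈ Finset.Ioc N M, n ≠ 0 := fun n hn => by
    have := Finset.mem_Ioc.mp hn; omega
  have hs1 : ∀ n ∈ Finset.Icc 1 N, n ≠ 0 := fun n hn => by
    have := Finset.mem_Icc.mp hn; omega
  have hcz : Continuous fun t : ℝ => riemannZeta ((3 / 2 : ℝ) + t * I) := by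
    refine continuous_iff_continuousAt.mpr fun t => ?_
    have : ((3 / 2 : ℝ) + t * I : ℂ) ≠ 1 := by
      intro h
      have := congrArg Complex.re h
      simp at this
      norm_num at this
    exact ContinuousAt.comp (f := fun t : ℝ => ((3 / 2 : ℝ) + t * I : ℂ))
      (differentiableAt_riemannZeta this).continuousAt (by fun_prop)
  have hcd : ∀ s : Finset ℕ, (∀ n ∈ s, n ≠ 0) →
      Continuous fun t : ℝ => dpoly s 1 ((3 / 2 : ℝ) + t * I) := by
    intro s hs
    exact (dpoly_differentiable hs 1).continuous.comp (by fun_prop)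
  have hpt : ∀ t : ℝ, ‖riemannZeta ((3 / 2 : ℝ) + t * I) -
        dpoly (Finset.Icc 1 N) 1 ((3 / 2 : ℝ) + t * I)‖ ^ 2 ≤
      2 * ‖dpoly (Finset.Ioc N M) 1 ((3 / 2 : ℝ) + t * I)‖ ^ 2 + 2 * (1 / (N : ℝ)) ^ 2 := by
    intro t
    have h1 := hM t
    have h2 : riemannZeta ((3 / 2 : ℝ) + t * I) - dpoly (Finset.Icc 1 N) 1 ((3 / 2 : ℝ) + t * I) =
      dpoly (Finset.Ioc N M) 1 ((3 / 2 : ℝ) + t * I) + (riemannZeta ((3 / 2 : ℝ) + t * I) -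
        dpoly (Finset.Icc 1 M) 1 ((3 / 2 : ℝ) + t * I)) := by rw [hpart]; ring
    rw [h2]
    calc _ ≤ (‖dpoly (Finset.Ioc N M) 1 ((3 / 2 : ℝ) + t * I)‖ + 1 / N) ^ 2 := by
          gcongr
          exact (norm_add_le _ _).trans (by gcongr)
      _ ≤ _ := by
          nlinarith [sq_nonneg (‖dpoly (Finset.Ioc N M) 1 ((3 / 2 : ℝ) + t * I)‖ - 1 / N)]
  have hmv := integral_norm_sq_dpoly_le' hs0 1 (3 / 2) hab
  have hZs : ∑ n ∈ Finset.Ioc N M, (n : ℝ) ^ (-(3 / 2 : ℝ)) ≤ Z :=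
    hsum.sum_le_tsum _ fun n _ => by positivity
  have hmv2 : ∫ t in a..b, ‖dpoly (Finset.Ioc N M) 1 ((3 / 2 : ℝ) + t * I)‖ ^ 2 ≤
      (b - a) / (N : ℝ) ^ 2 + 8 * Z + 4 * Z ^ 2 := by
    refine hmv.trans ?_
    simp only [Pi.one_apply, norm_one, one_pow, one_mul]
    have hS0 : 0 ≤ ∑ n ∈ Finset.Ioc N M, (n : ℝ) ^ (-(3 / 2 : ℝ)) :=
      Finset.sum_nonneg fun n _ => by positivity
    refine add_le_add ?_ (by gcongr)
    calc _ ≤ ∑ n ∈ Finset.Ioc N M, ((b - a) * (n : ℝ) ^ (-3 : ℝ) +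
          8 * (n : ℝ) ^ (-(3 / 2 : ℝ))) := by
          refine Finset.sum_le_sum fun n hn => ?_
          have hn0 : (0 : ℝ) < n := by exact_mod_cast Nat.pos_of_ne_zero (hs0 n hn)
          have h1 := one_add_log_le_two_sqrt hn0
          have h2 : (n : ℝ) ^ (-2 * (3 / 2) : ℝ) = (n : ℝ) ^ (-3 : ℝ) := by norm_num
          have h3 : (n : ℝ) ^ (-3 : ℝ) * (n * √n) = (n : ℝ) ^ (-(3 / 2 : ℝ)) := by
            rw [Real.sqrt_eq_rpow]
            nth_rw 2 [← Real.rpow_one (n : ℝ)]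
            rw [← Real.rpow_add hn0, ← Real.rpow_add hn0]
            norm_num
          rw [h2, mul_add, mul_comm (_ ^ _) (b - a)]
          refine add_le_add le_rfl ?_
          calc _ ≤ (n : ℝ) ^ (-3 : ℝ) * (4 * n * (2 * √n)) := by gcongr
            _ = 8 * ((n : ℝ) ^ (-3 : ℝ) * (n * √n)) := by ring
            _ = _ := by rw [h3]
      _ ≤ (b - a) * (1 / (N : ℝ) ^ 2) + 8 * Z := by
          rw [Finset.sum_add_distrib, ← Finset.mul_sum, ← Finset.mul_sum]
          have := sum_Ioc_rpow_neg_three_le hN M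
          have hba : 0 ≤ b - a := by linarith
          gcongr
      _ = _ := by ring
  calc _ ≤ ∫ t in a..b, (2 * ‖dpoly (Finset.Ioc N M) 1 ((3 / 2 : ℝ) + t * I)‖ ^ 2 +
        2 * (1 / (N : ℝ)) ^ 2) := by
        refine intervalIntegral.integral_mono_on hab ?_ ?_ fun t _ => hpt t
        · exact (((hcz.sub (hcd _ hs1)).norm).pow 2).intervalIntegrable _ _
        · exact (((hcd _ hs0).norm.pow 2).const_mul 2 |>.add continuous_const).intervalIntegrable _ _
    _ = 2 * (∫ t in a..b, ‖dpoly (Finset.Ioc N M) 1 ((3 / 2 : ℝ) + t * I)‖ ^ 2) +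
        (b - a) * (2 * (1 / (N : ℝ)) ^ 2) := by
        rw [intervalIntegral.integral_add, intervalIntegral.integral_const_mul,
          intervalIntegral.integral_const, smul_eq_mul]
        · exact ((hcd _ hs0).norm.pow 2).const_mul 2 |>.intervalIntegrable _ _
        · exact intervalIntegrable_const
    _ ≤ 2 * ((b - a) / (N : ℝ) ^ 2 + 8 * Z + 4 * Z ^ 2) + (b - a) * (2 * (1 / (N : ℝ)) ^ 2) := by
        gcongr
    _ ≤ _ := by
        have h1 : (b - a) * (2 * (1 / (N : ℝ)) ^ 2) = 2 * ((b - a) / (N : ℝ) ^ 2) := by ring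
        have h2 : 0 ≤ (b - a) / (N : ℝ) ^ 2 := div_nonneg (by linarith) (by positivity)
        rw [h1]
        nlinarith [mul_nonneg h2 hZ0, mul_nonneg h2 (sq_nonneg Z)]

/-- The remainder in the approximate functional equation with two sums of length `N`. -/
def afeRemainder (N : ℕ) (s : ℂ) : ℂ :=
  riemannZeta s - dpoly (Finset.Icc 1 N) 1 s - feFactor (1 - s) * dpoly (Finset.Icc 1 N) 1 (1 - s)

lemma ne_zero_of_mem_Icc_one {N n : ℕ} (hn : n ∈ Finset.Icc 1 N) : n ≠ 0 := by
  have := Finset.mem_Icc.mp hn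
  omega

lemma afeRemainder_one_sub (N : ℕ) {s : ℂ} (hs : s.im ≠ 0) :
    afeRemainder N (1 - s) = feFactor s * afeRemainder N s := by
  have h1 := riemannZeta_one_sub_eq_feFactor_mul hs
  have h2 := feFactor_mul_feFactor_one_sub hs
  unfold afeRemainder
  rw [h1, sub_sub_cancel]
  linear_combination dpoly (Finset.Icc 1 N) 1 (1 - s) * h2

lemma differentiableAt_afeRemainder (N : ℕ) {s : ℂ} (hs : s.im ≠ 0) :
    DifferentiableAt ℂ (afeRemainder N) s := by
  have hd := dpoly_differentiable (fun n hn => ne_zero_of_mem_Icc_one (N := N) hn) 1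
  have h1 : (1 - s).im ≠ 0 := by simpa using hs
  have h2 : DifferentiableAt ℂ (fun s => feFactor (1 - s)) s :=
    DifferentiableAt.comp s (differentiableAt_feFactor h1) (by fun_prop)
  have h3 : DifferentiableAt ℂ (fun s => dpoly (Finset.Icc 1 N) 1 (1 - s)) s :=
    DifferentiableAt.comp (g := dpoly (Finset.Icc 1 N) 1) (f := fun s => 1 - s) s (hd (1 - s))
      (by fun_prop)
  exact ((differentiableAt_riemannZeta (ne_one_of_im_ne_zero hs)).sub (hd s)).sub (h2.mul h3)

lemma norm_feFactor_neg_half_sq_le {t : ℝ} (ht : t ≠ 0) :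
    ‖feFactor (1 - ((3 / 2 : ℝ) + t * I))‖ ^ 2 ≤ 40 / t ^ 2 := by
  have him : ((3 / 2 : ℝ) + t * I : ℂ).im ≠ 0 := by simpa using ht
  have h1 := congrArg norm (feFactor_mul_feFactor_one_sub him)
  rw [norm_mul, norm_one] at h1
  have h2 := norm_feFactor_three_half t ht
  have h3 : ((3 / 2 : ℝ) + t * I : ℂ) = 3 / 2 + t * I := by push_cast; ring
  rw [h3] at h1 ⊢
  rw [h2] at h1
  set x := ‖feFactor (1 - (3 / 2 + t * I))‖
  have h4 : |t| ≤ ‖(1 / 2 + t * I : ℂ)‖ := by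
    have := Complex.abs_im_le_norm (1 / 2 + t * I : ℂ)
    simpa using this
  have ht2 : 0 < |t| := abs_pos.mpr ht
  have hx0 : 0 ≤ x := norm_nonneg _
  have h5 : x * |t| ≤ 2 * π := by
    have : ‖(1 / 2 + t * I : ℂ)‖ * x = 2 * π := by
      rw [div_mul_eq_mul_div, div_eq_one_iff_eq (by positivity)] at h1
      exact h1
    nlinarith
  have h6 : (x * |t|) ^ 2 ≤ 40 := by
    have : x * |t| ≤ 6.3 := by linarith [Real.pi_lt_d2]
    nlinarith [mul_nonneg hx0 ht2.le]
  rw [mul_pow, sq_abs] at h6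
  rw [le_div_iff₀ (by positivity)]
  exact h6

lemma floor_sqrt_facts {T : ℝ} (hT : 1 ≤ T) :
    1 ≤ ⌊√T⌋₊ ∧ (⌊√T⌋₊ : ℝ) ^ 2 ≤ T ∧ T ≤ 4 * (⌊√T⌋₊ : ℝ) ^ 2 := by
  have h1 : 1 ≤ √T := Real.one_le_sqrt.mpr hT
  have h2 : (⌊√T⌋₊ : ℝ) ≤ √T := Nat.floor_le (by positivity)
  have h3 : √T < ⌊√T⌋₊ + 1 := Nat.lt_floor_add_one _
  have h4 : 1 ≤ ⌊√T⌋₊ := Nat.le_floor (by simpa using h1)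
  have h5 : (1 : ℝ) ≤ ⌊√T⌋₊ := by exact_mod_cast h4
  have h6 := Real.sq_sqrt (show 0 ≤ T by linarith)
  refine ⟨h4, ?_, ?_⟩ <;> nlinarith

lemma integral_dpoly_neg_half_le {N : ℕ} (hN : 1 ≤ N) {a b : ℝ} (hab : a ≤ b) :
    ∫ t in a..b, ‖dpoly (Finset.Icc 1 N) 1 (1 - ((3 / 2 : ℝ) + t * I))‖ ^ 2 ≤
      ((b - a) + 8 * N ^ 2) * N ^ 2 := by
  have hN1 : (1 : ℝ) ≤ N := by exact_mod_cast hN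
  have h1 : ∀ t : ℝ, (1 - ((3 / 2 : ℝ) + t * I) : ℂ) = ((-1 / 2 : ℝ) : ℂ) + ((-t : ℝ) : ℂ) * I := by
    intro t; push_cast; ring
  simp_rw [h1]
  rw [intervalIntegral.integral_comp_neg
    (fun t => ‖dpoly (Finset.Icc 1 N) 1 (((-1 / 2 : ℝ) : ℂ) + (t : ℝ) * I)‖ ^ 2)]
  refine (integral_norm_sq_dpoly_le (fun n hn => ne_zero_of_mem_Icc_one hn) 1 (-1 / 2)
    (by linarith) (N := N) (fun n hn => by exact_mod_cast (Finset.mem_Icc.mp hn).2) hN1).trans ?_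
  have h2 : ∑ n ∈ Finset.Icc 1 N, ‖(1 : ℕ → ℂ) n‖ ^ 2 * (n : ℝ) ^ (-2 * (-1 / 2) : ℝ) ≤
      (N : ℝ) ^ 2 := by
    calc _ ≤ ∑ n ∈ Finset.Icc 1 N, (N : ℝ) := by
          refine Finset.sum_le_sum fun n hn => ?_
          have h3 : (n : ℝ) ≤ N := by exact_mod_cast (Finset.mem_Icc.mp hn).2
          norm_num
          exact_mod_cast h3
      _ = _ := by simp [sq]
  have h4 : 1 + Real.log N ≤ N := by
    have := Real.log_le_sub_one_of_pos (show (0 : ℝ) < N by linarith)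
    linarith
  have h5 : 0 ≤ Real.log N := Real.log_nonneg hN1
  have h6 : 8 * (N : ℝ) * (1 + Real.log N) ≤ 8 * (N : ℝ) ^ 2 := by nlinarith
  have hba : 0 ≤ b - a := by linarith
  calc _ ≤ ((b - a) + 8 * (N : ℝ) ^ 2) * (N : ℝ) ^ 2 := by
        refine mul_le_mul (by linarith) h2 (Finset.sum_nonneg fun n _ => by positivity)
          (by positivity)
    _ = _ := rfl

lemma continuousOn_line_afeRemainder (N : ℕ) (σ : ℝ) {a b : ℝ} (h : ∀ t ∈ Icc a b, t ≠ 0) :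
    ContinuousOn (fun t : ℝ => afeRemainder N (σ + t * I)) (Icc a b) := by
  intro t ht
  refine ContinuousAt.continuousWithinAt ?_
  refine ContinuousAt.comp (g := afeRemainder N) (f := fun t : ℝ => (σ + t * I : ℂ)) (x := t)
    ?_ (by fun_prop)
  exact (differentiableAt_afeRemainder N (by simpa using h t ht)).continuousAt

lemma exists_integral_afeRemainder_three_half_le :
    ∃ C, 0 < C ∧ ∀ T : ℝ, 1 ≤ T → ∀ a b : ℝ, a ≤ b → b - a ≤ 5 * T →
      (∀ t ∈ Icc a b, T / 8 ≤ |t|) →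
      ∫ t in a..b, ‖afeRemainder ⌊√T⌋₊ ((3 / 2 : ℝ) + t * I)‖ ^ 2 ≤ C := by
  obtain ⟨C, hC0, hC⟩ := exists_integral_zeta_sub_dpoly_three_half_le
  refine ⟨2 * (C * 21) + 2 * (2560 * 13), by positivity, fun T hT a b hab hba hab' => ?_⟩
  obtain ⟨hN1, hN2, hN3⟩ := floor_sqrt_facts hT
  set N := ⌊√T⌋₊
  have hN0 : (0 : ℝ) < N := by exact_mod_cast hN1
  have hne : ∀ t ∈ Icc a b, t ≠ 0 := by
    intro t ht h0
    have := hab' t ht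
    rw [h0, abs_zero] at this
    linarith
  have hz := hC N hN1 a b hab
  have hd := integral_dpoly_neg_half_le hN1 hab
  have hdc := dpoly_differentiable (fun n hn => ne_zero_of_mem_Icc_one (N := N) hn) 1
  have hcz : Continuous fun t : ℝ => riemannZeta ((3 / 2 : ℝ) + t * I) := by
    refine continuous_iff_continuousAt.mpr fun t => ?_
    have : ((3 / 2 : ℝ) + t * I : ℂ) ≠ 1 := by
      intro h
      have := congrArg Complex.re h
      simp at this
      norm_num at this
    exact ContinuousAt.comp (f := fun t : ℝ => ((3 / 2 : ℝ) + t * I : ℂ))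
      (differentiableAt_riemannZeta this).continuousAt (by fun_prop)
  have hc1 : Continuous fun t : ℝ => riemannZeta ((3 / 2 : ℝ) + t * I) -
      dpoly (Finset.Icc 1 N) 1 ((3 / 2 : ℝ) + t * I) :=
    hcz.sub (hdc.continuous.comp (by fun_prop))
  have hc2 : Continuous fun t : ℝ => dpoly (Finset.Icc 1 N) 1 (1 - ((3 / 2 : ℝ) + t * I)) :=
    hdc.continuous.comp (by fun_prop)
  have hpt : ∀ t ∈ Icc a b, ‖afeRemainder N ((3 / 2 : ℝ) + t * I)‖ ^ 2 ≤
      2 * ‖riemannZeta ((3 / 2 : ℝ) + t * I) - dpoly (Finset.Icc 1 N) 1 ((3 / 2 : ℝ) + t * I)‖ ^ 2 +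
      2 * (2560 / T ^ 2) * ‖dpoly (Finset.Icc 1 N) 1 (1 - ((3 / 2 : ℝ) + t * I))‖ ^ 2 := by
    intro t ht
    have h1 := norm_feFactor_neg_half_sq_le (hne t ht)
    have h2 : 40 / t ^ 2 ≤ 2560 / T ^ 2 := by
      have h3 : (T / 8) ^ 2 ≤ t ^ 2 := by
        rw [← sq_abs t]
        have := hab' t ht
        gcongr
      calc 40 / t ^ 2 ≤ 40 / (T / 8) ^ 2 := by gcongr
        _ = _ := by ring
    unfold afeRemainder
    set x := riemannZeta ((3 / 2 : ℝ) + t * I) - dpoly (Finset.Icc 1 N) 1 ((3 / 2 : ℝ) + t * I)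
    set y := dpoly (Finset.Icc 1 N) 1 (1 - ((3 / 2 : ℝ) + t * I))
    set z := feFactor (1 - ((3 / 2 : ℝ) + t * I))
    have h4 := norm_sub_le x (z * y)
    calc _ ≤ (‖x‖ + ‖z * y‖) ^ 2 := by gcongr
      _ ≤ 2 * ‖x‖ ^ 2 + 2 * ‖z * y‖ ^ 2 := by nlinarith [sq_nonneg (‖x‖ - ‖z * y‖)]
      _ = 2 * ‖x‖ ^ 2 + 2 * ‖z‖ ^ 2 * ‖y‖ ^ 2 := by rw [norm_mul]; ring
      _ ≤ _ := by
          gcongr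
          exact h1.trans h2
  have hi1 := ((hc1.norm.pow 2).const_mul 2).intervalIntegrable (μ := volume) a b
  have hi2 := ((hc2.norm.pow 2).const_mul (2 * (2560 / T ^ 2))).intervalIntegrable (μ := volume) a b
  have hd' : 2560 / T ^ 2 * (∫ t in a..b,
      ‖dpoly (Finset.Icc 1 N) 1 (1 - ((3 / 2 : ℝ) + t * I))‖ ^ 2) ≤ 2560 * 13 := by
    calc _ ≤ 2560 / T ^ 2 * ((5 * T + 8 * T) * T) := by
          refine mul_le_mul_of_nonneg_left (hd.trans ?_) (by positivity)
          have : 0 ≤ b - a := by linarith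
          gcongr
      _ = _ := by field_simp; norm_num
  have hz' : C * (1 + (b - a) / (N : ℝ) ^ 2) ≤ C * 21 := by
    gcongr
    have : (b - a) / (N : ℝ) ^ 2 ≤ 20 := by
      rw [div_le_iff₀ (by positivity)]
      linarith
    linarith
  calc _ ≤ ∫ t in a..b, _ := by
        refine intervalIntegral.integral_mono_on hab ?_ (hi1.add hi2) hpt
        refine ContinuousOn.intervalIntegrable ?_
        rw [uIcc_of_le hab]
        exact (continuousOn_line_afeRemainder N _ hne).norm.pow 2
    _ = _ := intervalIntegral.integral_add hi1 hi2
    _ ≤ _ := by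
        rw [intervalIntegral.integral_const_mul, intervalIntegral.integral_const_mul, mul_assoc 2]
        simp only [Pi.pow_apply]
        linarith

lemma exists_integral_afeRemainder_neg_half_le :
    ∃ C, 0 < C ∧ ∀ T : ℝ, 1 ≤ T → ∀ a b : ℝ, a ≤ b → T / 8 ≤ a → b ≤ 5 * T →
      ∫ t in a..b, ‖afeRemainder ⌊√T⌋₊ ((-1 / 2 : ℝ) + t * I)‖ ^ 2 ≤ C * T ^ 2 := by
  obtain ⟨C, hC0, hC⟩ := exists_integral_afeRemainder_three_half_le
  refine ⟨C, hC0, fun T hT a b hab ha hb => ?_⟩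
  set N := ⌊√T⌋₊
  have h1 := hC T hT (-b) (-a) (by linarith) (by linarith) (by
    intro t ht
    rw [abs_of_nonpos (by linarith [ht.2])]
    linarith [ht.2])
  have hne : ∀ t ∈ Icc a b, t ≠ 0 := fun t ht h0 => by linarith [ht.1]
  have hpt : ∀ t ∈ Icc a b, ‖afeRemainder N ((-1 / 2 : ℝ) + t * I)‖ ^ 2 ≤
      T ^ 2 * ‖afeRemainder N ((3 / 2 : ℝ) + (-t : ℝ) * I)‖ ^ 2 := by
    intro t ht
    have h2 : ((-1 / 2 : ℝ) + t * I : ℂ) = 1 - ((3 / 2 : ℝ) + (-t : ℝ) * I) := by push_cast; ring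
    rw [h2, afeRemainder_one_sub _ (by simpa using hne t ht), norm_mul, mul_pow]
    gcongr
    have h3 : ((3 / 2 : ℝ) + (-t : ℝ) * I : ℂ) = 3 / 2 + (-t : ℝ) * I := by push_cast; ring
    rw [h3, norm_feFactor_three_half _ (neg_ne_zero.mpr (hne t ht)), div_le_iff₀ (by positivity)]
    have h4 : ‖(1 / 2 + (-t : ℝ) * I : ℂ)‖ ≤ 1 / 2 + t := by
      refine (norm_add_le _ _).trans ?_
      have : 0 ≤ t := by linarith [ht.1]
      rw [norm_mul, Complex.norm_I, Complex.norm_real, Real.norm_eq_abs, abs_neg, abs_of_nonneg this]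
      norm_num
    nlinarith [Real.pi_gt_three, ht.2]
  calc _ ≤ ∫ t in a..b, T ^ 2 * ‖afeRemainder N ((3 / 2 : ℝ) + (-t : ℝ) * I)‖ ^ 2 := by
        refine intervalIntegral.integral_mono_on hab ?_ ?_ hpt
        · refine ContinuousOn.intervalIntegrable ?_
          rw [uIcc_of_le hab]
          exact (continuousOn_line_afeRemainder N _ hne).norm.pow 2
        · refine ContinuousOn.intervalIntegrable ?_
          rw [uIcc_of_le hab]
          refine ContinuousOn.mul continuousOn_const (ContinuousOn.pow (ContinuousOn.norm ?_) 2)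
          refine (continuousOn_line_afeRemainder N (3 / 2) (a := -b) (b := -a) ?_).comp
            (f := fun t : ℝ => -t) (by fun_prop) ?_
          · intro t ht h0
            linarith [ht.2]
          · intro t ht
            exact ⟨by linarith [ht.2], by linarith [ht.1]⟩
    _ = T ^ 2 * ∫ t in (-b)..(-a), ‖afeRemainder N ((3 / 2 : ℝ) + t * I)‖ ^ 2 := by
        rw [intervalIntegral.integral_const_mul, intervalIntegral.integral_comp_neg
          (fun t => ‖afeRemainder N ((3 / 2 : ℝ) + (t : ℝ) * I)‖ ^ 2)]
    _ ≤ _ := by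
        rw [mul_comm C]
        gcongr

lemma exists_norm_afeRemainder_le_exp :
    ∃ C, 0 < C ∧ ∀ (N : ℕ), 1 ≤ N → ∀ s : ℂ, -(1 / 2) ≤ s.re → s.re ≤ 3 / 2 → 1 ≤ |s.im| →
      ‖afeRemainder N s‖ ≤ C * (N : ℝ) ^ 2 * Real.exp (2 * |s.im|) := by
  obtain ⟨C1, hC1, h1⟩ := exists_norm_riemannZeta_le_exp
  obtain ⟨C2, hC2, h2⟩ := exists_norm_feFactor_le_exp
  refine ⟨C1 + 1 + C2, by positivity, fun N hN s hs1 hs2 hs3 => ?_⟩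
  have hN1 : (1 : ℝ) ≤ N := by exact_mod_cast hN
  have hd : ∀ w : ℂ, -(1 / 2) ≤ w.re → ‖dpoly (Finset.Icc 1 N) 1 w‖ ≤ (N : ℝ) ^ 2 := by
    intro w hw
    refine (norm_dpoly_le (fun n hn => ne_zero_of_mem_Icc_one hn) 1 w).trans ?_
    calc _ ≤ ∑ n ∈ Finset.Icc 1 N, (N : ℝ) := by
          refine Finset.sum_le_sum fun n hn => ?_
          have hn1 : (1 : ℝ) ≤ n := by exact_mod_cast (Finset.mem_Icc.mp hn).1
          have hnN : (n : ℝ) ≤ N := by exact_mod_cast (Finset.mem_Icc.mp hn).2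
          rw [Pi.one_apply, norm_one, one_mul]
          calc (n : ℝ) ^ (-w.re) ≤ (n : ℝ) ^ (1 : ℝ) :=
                Real.rpow_le_rpow_of_exponent_le hn1 (by linarith)
            _ ≤ N := by simpa using hnN
      _ = _ := by simp [sq]
  have hexp : 1 ≤ Real.exp (2 * |s.im|) := Real.one_le_exp (by positivity)
  have h3 := h1 s hs1 hs2 hs3
  have h4 := h2 (1 - s) (by simp; linarith) (by simp; linarith) (by simpa using hs3)
  have h5 : |(1 - s).im| = |s.im| := by simp
  rw [h5] at h4
  have h6 := hd s hs1
  have h7 := hd (1 - s) (by simp; linarith)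
  unfold afeRemainder
  have hNN : (1 : ℝ) ≤ (N : ℝ) ^ 2 := by nlinarith
  set e := Real.exp (2 * |s.im|)
  calc _ ≤ ‖riemannZeta s‖ + ‖dpoly (Finset.Icc 1 N) 1 s‖ +
        ‖feFactor (1 - s) * dpoly (Finset.Icc 1 N) 1 (1 - s)‖ :=
        (norm_sub_le _ _).trans (by gcongr; exact norm_sub_le _ _)
    _ ≤ C1 * e + (N : ℝ) ^ 2 + C2 * e * (N : ℝ) ^ 2 := by
        rw [norm_mul]
        gcongr
    _ ≤ C1 * e * (N : ℝ) ^ 2 + (N : ℝ) ^ 2 * e + C2 * e * (N : ℝ) ^ 2 := by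
        have h8 : C1 * e ≤ C1 * e * (N : ℝ) ^ 2 := le_mul_of_one_le_right (by positivity) hNN
        have h9 : (N : ℝ) ^ 2 ≤ (N : ℝ) ^ 2 * e := le_mul_of_one_le_right (by positivity) hexp
        linarith
    _ = _ := by ring

lemma exists_integral_afeRemainder_half_le :
    ∃ C T₀, 0 < C ∧ 1 ≤ T₀ ∧ ∀ T : ℝ, T₀ ≤ T →
      ∫ t in (T / 4)..(4 * T), ‖afeRemainder ⌊√T⌋₊ ((1 / 2 : ℝ) + t * I)‖ ^ 2 ≤ C * T := by
  obtain ⟨CB, hCB, hB⟩ := exists_integral_afeRemainder_three_half_le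
  obtain ⟨CA, hCA, hA⟩ := exists_integral_afeRemainder_neg_half_le
  obtain ⟨CQ, hCQ, hQ⟩ := exists_norm_afeRemainder_le_exp
  set D := √CB + √CA + 1 with hD
  have hD0 : 0 < D := by positivity
  refine ⟨(Real.exp 4 * D) ^ 2, 8 + 2000 + CQ, by positivity, by linarith, fun T hT => ?_⟩
  have hT8 : 8 ≤ T := by linarith
  have hT1 : 1 ≤ T := by linarith
  have hT0 : 0 < T := by linarith
  obtain ⟨hN1, hN2, hN3⟩ := floor_sqrt_facts hT1
  set N := ⌊√T⌋₊
  have hsq : √T * √T = T := Real.mul_self_sqrt hT0.le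
  have hs1 : 1 ≤ √T := Real.one_le_sqrt.mpr hT1
  have hexp : Real.exp (Real.log T / 2) = √T := by
    rw [Real.sqrt_eq_rpow, Real.rpow_def_of_pos hT0]
    congr 1
    ring
  have key := integral_norm_sq_le_of_three_lines (f := afeRemainder N) (α := -1 / 2) (β := 3 / 2)
    (σ := 1 / 2) (a := T / 4) (b := 4 * T) (H := T / 8) (κ := Real.log T / 2)
    (A := √CA * T) (B := √CB) (Q := CQ * T * Real.exp (10 * T)) (W := D * √T)
    (fun s hs => (differentiableAt_afeRemainder N (ne_of_gt hs)).differentiableWithinAt)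
    (by norm_num) (by norm_num) (by linarith) (by linarith) (by linarith) (by positivity)
    (by positivity) (by positivity) ?_ ?_ ?_ ?_ ?_ ?_
  · refine key.trans (le_of_eq ?_)
    rw [← mul_assoc, mul_pow, Real.sq_sqrt hT0.le]
    norm_num
  · rw [mul_pow, Real.sq_sqrt hCA.le]
    exact hA T hT1 _ _ (by linarith) (by linarith) (by linarith)
  · rw [Real.sq_sqrt hCB.le]
    refine hB T hT1 _ _ (by linarith) (by linarith) fun t ht => ?_
    rw [abs_of_nonneg (by linarith [ht.1])]
    linarith [ht.1]
  · intro x hx t ht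
    have ht0 : 0 ≤ t := by linarith [ht.1]
    have him : (x + t * I : ℂ).im = t := by simp
    have hre : (x + t * I : ℂ).re = x := by simp
    have := hQ N hN1 (x + t * I) (by rw [hre]; linarith [hx.1]) (by rw [hre]; exact hx.2)
      (by rw [him, abs_of_nonneg ht0]; linarith [ht.1])
    refine this.trans ?_
    rw [him, abs_of_nonneg ht0]
    have : 2 * t ≤ 10 * T := by linarith [ht.2]
    gcongr
  · have h1 : Real.log T / 2 * (-1 / 2 - 1 / 2) = -(Real.log T / 2) := by ring
    rw [h1, Real.exp_neg, hexp]
    have h2 : √CA * T * (√T)⁻¹ = √CA * √T := by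
      rw [mul_inv_eq_iff_eq_mul₀ (by positivity), mul_assoc, hsq]
    rw [h2]
    gcongr
    rw [hD]
    linarith [Real.sqrt_nonneg CB]
  · have h1 : Real.log T / 2 * (3 / 2 - 1 / 2) = Real.log T / 2 := by ring
    rw [h1, hexp]
    gcongr
    rw [hD]
    linarith [Real.sqrt_nonneg CA]
  · have hlog0 : 0 ≤ Real.log T := Real.log_nonneg hT1
    have h1 : |Real.log T / 2| * (3 / 2 - -1 / 2) = Real.log T := by
      rw [abs_of_nonneg (by positivity)]; ring
    rw [h1, Real.exp_sub, Real.exp_log hT0]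
    have h2 : √(4 * T - T / 4) ≤ 2 * T := by
      rw [Real.sqrt_le_left (by positivity)]
      nlinarith
    have h3 : 1 ≤ D * √T := by
      have : 1 ≤ D := by rw [hD]; linarith [Real.sqrt_nonneg CA, Real.sqrt_nonneg CB]
      nlinarith
    refine le_trans ?_ h3
    have h4 : T ≤ Real.exp T := by linarith [Real.add_one_le_exp T]
    have h5 : CQ * T * Real.exp (10 * T) * √(4 * T - T / 4) * T ≤ Real.exp ((T / 8) ^ 2) := by
      calc _ ≤ T * T * Real.exp (10 * T) * (2 * T) * T := by
            gcongr
            linarith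
        _ ≤ Real.exp T * Real.exp T * Real.exp (10 * T) * (Real.exp T * Real.exp T) * Real.exp T := by
            have h6 : (2 : ℝ) * T ≤ Real.exp T * Real.exp T := by nlinarith
            gcongr
        _ = Real.exp (15 * T) := by
            simp only [← Real.exp_add]
            congr 1; ring
        _ ≤ _ := by
            rw [Real.exp_le_exp]
            nlinarith
    rw [mul_div_assoc', div_le_one (by positivity)]
    exact h5

lemma norm_dpoly_one_conj (s : Finset ℕ) (w : ℂ) :
    ‖dpoly s 1 ((starRingEnd ℂ) w)‖ = ‖dpoly s 1 w‖ := by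
  have : dpoly s 1 ((starRingEnd ℂ) w) = (starRingEnd ℂ) (dpoly s 1 w) := by
    unfold dpoly
    rw [map_sum]
    refine Finset.sum_congr rfl fun n _ => ?_
    rw [map_mul, Pi.one_apply, map_one, one_mul, one_mul]
    have := Complex.cpow_conj (n : ℂ) (-w) (by
      rw [Complex.natCast_arg]; exact Real.pi_pos.ne)
    rw [map_neg, Complex.conj_natCast] at this
    exact this
  rw [this, RCLike.norm_conj]

lemma continuousOn_line_riemannZeta (σ : ℝ) {a b : ℝ} (ha : 0 < a) :
    ContinuousOn (fun t : ℝ => riemannZeta (σ + t * I)) (Icc a b) := by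
  intro t ht
  refine ContinuousAt.continuousWithinAt ?_
  refine ContinuousAt.comp (g := riemannZeta) (f := fun t : ℝ => (σ + t * I : ℂ)) (x := t)
    ?_ (by fun_prop)
  refine (differentiableAt_riemannZeta (ne_one_of_im_ne_zero ?_)).continuousAt
  have : 0 < t := by linarith [ht.1]
  simpa using this.ne'

lemma norm_riemannZeta_half_sq_le (N : ℕ) {t : ℝ} (ht : t ≠ 0) :
    ‖riemannZeta ((1 / 2 : ℝ) + t * I)‖ ^ 2 ≤
      6 * ‖dpoly (Finset.Icc 1 N) 1 ((1 / 2 : ℝ) + t * I)‖ ^ 2 +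
        3 * ‖afeRemainder N ((1 / 2 : ℝ) + t * I)‖ ^ 2 := by
  set w : ℂ := (1 / 2 : ℝ) + t * I with hw
  have h1 : 1 - w = (starRingEnd ℂ) w := by
    rw [hw, map_add, map_mul, Complex.conj_ofReal, Complex.conj_ofReal, Complex.conj_I]
    push_cast
    ring
  have h2 : ‖feFactor (1 - w)‖ = 1 := by
    have : 1 - w = 1 / 2 + ((-t : ℝ) : ℂ) * I := by rw [hw]; push_cast; ring
    rw [this]
    exact norm_feFactor_one_half _ (neg_ne_zero.mpr ht)
  have h3 : riemannZeta w = dpoly (Finset.Icc 1 N) 1 w +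
      feFactor (1 - w) * dpoly (Finset.Icc 1 N) 1 (1 - w) + afeRemainder N w := by
    unfold afeRemainder; ring
  have h4 : ‖riemannZeta w‖ ≤ 2 * ‖dpoly (Finset.Icc 1 N) 1 w‖ + ‖afeRemainder N w‖ := by
    rw [h3]
    refine (norm_add_le _ _).trans ?_
    gcongr
    refine (norm_add_le _ _).trans ?_
    rw [norm_mul, h2, one_mul, h1, norm_dpoly_one_conj]
    linarith
  calc _ ≤ (2 * ‖dpoly (Finset.Icc 1 N) 1 w‖ + ‖afeRemainder N w‖) ^ 2 := by gcongr
    _ ≤ _ := by nlinarith [sq_nonneg (‖dpoly (Finset.Icc 1 N) 1 w‖ - ‖afeRemainder N w‖)]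

lemma continuous_line_dpoly (N : ℕ) (σ : ℝ) :
    Continuous fun t : ℝ => dpoly (Finset.Icc 1 N) 1 (σ + t * I) :=
  (dpoly_differentiable (fun n hn => ne_zero_of_mem_Icc_one (N := N) hn) 1).continuous.comp
    (by fun_prop)

lemma one_le_log_of_three_le {T : ℝ} (hT : 3 ≤ T) : 1 ≤ Real.log T := by
  rw [Real.le_log_iff_exp_le (by linarith)]
  linarith [Real.exp_one_lt_d9]

lemma log_floor_sqrt_le {T : ℝ} (hT : 1 ≤ T) : Real.log ⌊√T⌋₊ ≤ Real.log T / 2 := by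
  obtain ⟨hN1, hN2, -⟩ := floor_sqrt_facts hT
  have hN0 : (0 : ℝ) < ⌊√T⌋₊ := by exact_mod_cast hN1
  have := Real.log_le_log (by positivity) hN2
  rw [Real.log_pow] at this
  push_cast at this
  linarith

lemma exists_integral_norm_riemannZeta_half_sq_le :
    ∃ C T₀, 0 < C ∧ 3 ≤ T₀ ∧ ∀ T : ℝ, T₀ ≤ T →
      ∫ t in (T / 4)..(4 * T), ‖riemannZeta ((1 / 2 : ℝ) + t * I)‖ ^ 2 ≤ C * (T * Real.log T) := by
  obtain ⟨CR, T₀, hCR, hT₀, hR⟩ := exists_integral_afeRemainder_half_le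
  refine ⟨6 * 24 + 3 * CR, max T₀ 3, by positivity, le_max_right _ _, fun T hT => ?_⟩
  have hT3 : 3 ≤ T := (le_max_right _ _).trans hT
  have hT1 : 1 ≤ T := by linarith
  have hab : T / 4 ≤ 4 * T := by linarith
  have hL := one_le_log_of_three_le hT3
  have hR' := hR T ((le_max_left _ _).trans hT)
  obtain ⟨hN1, hN2, hN3⟩ := floor_sqrt_facts hT1
  have hlN := log_floor_sqrt_le hT1
  set N := ⌊√T⌋₊
  have hN1' : (1 : ℝ) ≤ N := by exact_mod_cast hN1
  have hD : ∫ t in (T / 4)..(4 * T), ‖dpoly (Finset.Icc 1 N) 1 ((1 / 2 : ℝ) + t * I)‖ ^ 2 ≤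
      24 * (T * Real.log T) := by
    refine (integral_norm_sq_dpoly_le (fun n hn => ne_zero_of_mem_Icc_one hn) 1 (1 / 2)
      hab (N := N) (fun n hn => by exact_mod_cast (Finset.mem_Icc.mp hn).2) hN1').trans ?_
    have h1 : ∑ n ∈ Finset.Icc 1 N, ‖(1 : ℕ → ℂ) n‖ ^ 2 * (n : ℝ) ^ (-2 * (1 / 2) : ℝ) ≤
        2 * Real.log T := by
      have h2 := sum_inv_Icc_le N
      refine le_trans (le_of_eq ?_) (h2.trans (by linarith))
      refine Finset.sum_congr rfl fun n _ => ?_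
      norm_num [Real.rpow_neg_one]
    have h4 : 1 + Real.log N ≤ N := by
      have := Real.log_le_sub_one_of_pos (show (0 : ℝ) < N by linarith)
      linarith
    have h5 : 0 ≤ Real.log N := Real.log_nonneg hN1'
    have h6 : 8 * (N : ℝ) * (1 + Real.log N) ≤ 8 * (N : ℝ) ^ 2 := by nlinarith
    calc _ ≤ (12 * T) * (2 * Real.log T) := by
          refine mul_le_mul (by linarith) h1 (Finset.sum_nonneg fun n _ => by positivity)
            (by positivity)
      _ = _ := by ring
  have hi1 := (((continuous_line_dpoly N (1 / 2)).norm.pow 2).const_mul 6).intervalIntegrable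
    (μ := volume) (T / 4) (4 * T)
  have hi2 : IntervalIntegrable (fun t : ℝ => 3 * ‖afeRemainder N ((1 / 2 : ℝ) + t * I)‖ ^ 2)
      volume (T / 4) (4 * T) := by
    refine ContinuousOn.intervalIntegrable ?_
    rw [uIcc_of_le hab]
    exact ((continuousOn_line_afeRemainder N _ (fun t ht h0 => by linarith [ht.1])).norm.pow 2
      ).const_mul 3
  calc _ ≤ ∫ t in (T / 4)..(4 * T), _ := by
        refine intervalIntegral.integral_mono_on hab ?_ (hi1.add hi2) fun t ht =>
          norm_riemannZeta_half_sq_le N (fun h0 => by linarith [ht.1])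
        refine ContinuousOn.intervalIntegrable ?_
        rw [uIcc_of_le hab]
        exact (continuousOn_line_riemannZeta _ (by linarith)).norm.pow 2
    _ = _ := intervalIntegral.integral_add hi1 hi2
    _ ≤ _ := by
        rw [intervalIntegral.integral_const_mul, intervalIntegral.integral_const_mul]
        simp only [Pi.pow_apply]
        have : CR * T ≤ CR * (T * Real.log T) := by
          gcongr
          exact le_mul_of_one_le_right (by linarith) hL
        linarith

lemma exists_setIntegral_norm_riemannZeta_half_sq_le :
    ∃ C T₀, 0 < C ∧ 3 ≤ T₀ ∧ ∀ T : ℝ, T₀ ≤ T → ∀ E ⊆ Icc T (2 * T), MeasurableSet E →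
      volume.real E ≤ T / Real.log T ^ 5 →
      ∫ t in E, ‖riemannZeta ((1 / 2 : ℝ) + t * I)‖ ^ 2 ≤ C * T := by
  obtain ⟨CR, T₀, hCR, hT₀, hR⟩ := exists_integral_afeRemainder_half_le
  refine ⟨6 * 100 + 3 * CR, max T₀ 3, by positivity, le_max_right _ _, fun T hT E hE hEm hEv => ?_⟩
  have hT3 : 3 ≤ T := (le_max_right _ _).trans hT
  have hT1 : 1 ≤ T := by linarith
  have hab : T ≤ 2 * T := by linarith
  have hL := one_le_log_of_three_le hT3
  have hR' := hR T ((le_max_left _ _).trans hT)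
  obtain ⟨hN1, hN2, hN3⟩ := floor_sqrt_facts hT1
  have hlN := log_floor_sqrt_le hT1
  set N := ⌊√T⌋₊
  have hN1' : (1 : ℝ) ≤ N := by exact_mod_cast hN1
  have hN0 : 0 ≤ Real.log N := Real.log_nonneg hN1'
  have h4 := integral_norm_pow_four_dpoly_le hN1 hab
  have h4' : ∫ t in T..(2 * T), ‖dpoly (Finset.Icc 1 N) 1 ((1 / 2 : ℝ) + t * I)‖ ^ 4 ≤
      T * (100 ^ 2 * Real.log T ^ 5) := by
    refine h4.trans ?_
    have h5 : 1 + 2 * Real.log N ≤ 2 * Real.log T := by linarith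
    calc _ ≤ ((2 * T - T) + 8 * T * (2 * Real.log T)) * (2 * Real.log T) ^ 4 := by gcongr
      _ ≤ (17 * T * Real.log T) * (2 * Real.log T) ^ 4 := by
          gcongr
          nlinarith
      _ ≤ _ := by
          have : 0 ≤ T * Real.log T ^ 5 := by positivity
          nlinarith
  have hcD := continuous_line_dpoly N (1 / 2)
  have hEsub : E ⊆ Icc (T / 4) (4 * T) := hE.trans (Icc_subset_Icc (by linarith) (by linarith))
  have hcontE : ∀ f : ℝ → ℝ, ContinuousOn f (Icc T (2 * T)) → IntegrableOn f E := fun f hf =>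
    (hf.integrableOn_Icc).mono_set hE
  have hRi : IntegrableOn (fun t : ℝ => ‖afeRemainder N ((1 / 2 : ℝ) + t * I)‖ ^ 2)
      (Icc (T / 4) (4 * T)) :=
    ((continuousOn_line_afeRemainder N _ (fun t ht h0 => by linarith [ht.1])).norm.pow 2
      ).integrableOn_Icc
  have hRE : ∫ t in E, ‖afeRemainder N ((1 / 2 : ℝ) + t * I)‖ ^ 2 ≤ CR * T := by
    refine le_trans ?_ hR'
    rw [intervalIntegral.integral_of_le (by linarith), ← integral_Icc_eq_integral_Ioc]
    exact setIntegral_mono_set hRi (Eventually.of_forall fun t => by positivity)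
      (Eventually.of_forall hEsub)
  have hDE : ∫ t in E, ‖dpoly (Finset.Icc 1 N) 1 ((1 / 2 : ℝ) + t * I)‖ ^ 2 ≤ 100 * T := by
    have hvol : volume E < ⊤ := (measure_mono hE).trans_lt (by simp)
    have : IsFiniteMeasure (volume.restrict E) := ⟨by simpa using hvol⟩
    have hmem : MemLp (fun t : ℝ => ‖dpoly (Finset.Icc 1 N) 1 ((1 / 2 : ℝ) + t * I)‖ ^ 2) 2
        (volume.restrict E) := by
      have hc2 : ContinuousOn (fun t : ℝ => ‖dpoly (Finset.Icc 1 N) 1 ((1 / 2 : ℝ) + t * I)‖ ^ 2)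
        (Icc T (2 * T)) := (hcD.norm.pow 2).continuousOn
      obtain ⟨C, hC⟩ := isCompact_Icc.exists_bound_of_continuousOn hc2
      exact MemLp.of_bound ((hc2.mono hE).aestronglyMeasurable hEm) C
        ((ae_restrict_mem hEm).mono fun x hx => hC x (hE hx))
    have h1 := integral_mul_le_sqrt_mul_sqrt (μ := volume.restrict E)
      (f := fun t : ℝ => ‖dpoly (Finset.Icc 1 N) 1 ((1 / 2 : ℝ) + t * I)‖ ^ 2) (g := fun _ => 1)
      (Eventually.of_forall fun t => by positivity) (Eventually.of_forall fun t => zero_le_one)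
      hmem (memLp_const 1)
    simp only [mul_one, one_pow, integral_const, MeasurableSet.univ, measureReal_restrict_apply,
      univ_inter, smul_eq_mul, ← pow_mul] at h1
    refine h1.trans ?_
    rw [← Real.sqrt_mul (integral_nonneg fun t => by positivity)]
    refine Real.sqrt_le_iff.mpr ⟨by positivity, ?_⟩
    have h2 : ∫ t in E, ‖dpoly (Finset.Icc 1 N) 1 ((1 / 2 : ℝ) + t * I)‖ ^ (2 * 2) ≤
        T * (100 ^ 2 * Real.log T ^ 5) := by
      refine le_trans ?_ h4'
      rw [intervalIntegral.integral_of_le (by linarith), ← integral_Icc_eq_integral_Ioc]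
      exact setIntegral_mono_set (hcD.norm.pow 4).continuousOn.integrableOn_Icc
        (Eventually.of_forall fun t => by positivity) (Eventually.of_forall hE)
    calc _ ≤ (T * (100 ^ 2 * Real.log T ^ 5)) * (T / Real.log T ^ 5) := by gcongr
      _ = _ := by field_simp
  have hi1 : IntegrableOn (fun t : ℝ => 6 * ‖dpoly (Finset.Icc 1 N) 1 ((1 / 2 : ℝ) + t * I)‖ ^ 2)
      E := hcontE _ ((hcD.norm.pow 2).const_mul 6).continuousOn
  have hi2 : IntegrableOn (fun t : ℝ => 3 * ‖afeRemainder N ((1 / 2 : ℝ) + t * I)‖ ^ 2) E :=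
    (hRi.mono_set hEsub).const_mul 3
  calc _ ≤ ∫ t in E, (6 * ‖dpoly (Finset.Icc 1 N) 1 ((1 / 2 : ℝ) + t * I)‖ ^ 2 +
        3 * ‖afeRemainder N ((1 / 2 : ℝ) + t * I)‖ ^ 2) := by
        refine setIntegral_mono_on ?_ (hi1.add hi2) hEm fun t ht =>
          norm_riemannZeta_half_sq_le N (fun h0 => by linarith [(hE ht).1])
        exact hcontE _ ((continuousOn_line_riemannZeta _ (by linarith)).norm.pow 2)
    _ = _ := integral_add hi1 hi2
    _ ≤ _ := by
        rw [integral_const_mul, integral_const_mul]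
        linarith

lemma exists_norm_riemannZeta_le_of_three_half_le :
    ∃ C, 0 < C ∧ ∀ s : ℂ, 3 / 2 ≤ s.re → ‖riemannZeta s‖ ≤ C := by
  have hsum : Summable fun n : ℕ => (n : ℝ) ^ (-(3 / 2 : ℝ)) :=
    Real.summable_nat_rpow.mpr (by norm_num)
  refine ⟨∑' n : ℕ, (n : ℝ) ^ (-(3 / 2 : ℝ)) + 1, ?_, fun s hs => ?_⟩
  · have : 0 ≤ ∑' n : ℕ, (n : ℝ) ^ (-(3 / 2 : ℝ)) := tsum_nonneg fun n => by positivity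
    linarith
  · rw [riemannZeta_eq_tsum_cpow_neg (by linarith)]
    refine le_trans (tsum_of_norm_bounded hsum.hasSum fun n => ?_) (by linarith)
    rcases Nat.eq_zero_or_pos n with rfl | hn
    · have : s ≠ 0 := by rintro rfl; simp at hs; linarith
      simp [this]
    · rw [norm_mul, norm_natCast_cpow_neg hn.ne', Pi.one_apply, norm_one, one_mul]
      exact Real.rpow_le_rpow_of_exponent_le (by exact_mod_cast hn) (by linarith)

lemma exp_mul_log_eq_rpow {T : ℝ} (hT : 0 < T) (x : ℝ) : Real.exp (Real.log T * x) = T ^ x := by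
  rw [Real.rpow_def_of_pos hT]

lemma crude_three_lines_bound {C T : ℝ} (hC0 : 0 < C) (hT : 2000 + C ≤ T) :
    C * Real.exp (10 * T) * √(3 * T - T / 2) * Real.exp (Real.log T - (T / 4) ^ 2) ≤ 1 := by
  have hT0 : 0 < T := by linarith
  rw [Real.exp_sub, Real.exp_log hT0]
  have h2 : √(3 * T - T / 2) ≤ 2 * T := by
    rw [Real.sqrt_le_left (by positivity)]
    nlinarith
  have h4 : T ≤ Real.exp T := by linarith [Real.add_one_le_exp T]
  rw [mul_div_assoc', div_le_one (by positivity)]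
  calc _ ≤ T * Real.exp (10 * T) * (2 * T) * T := by
        gcongr
        linarith
    _ ≤ Real.exp T * Real.exp (10 * T) * (Real.exp T * Real.exp T) * Real.exp T := by
        have h6 : (2 : ℝ) * T ≤ Real.exp T * Real.exp T := by nlinarith
        gcongr
    _ = Real.exp (14 * T) := by
        simp only [← Real.exp_add]
        congr 1; ring
    _ ≤ _ := by
        rw [Real.exp_le_exp]
        nlinarith

lemma exists_integral_norm_riemannZeta_sq_le :
    ∃ C T₀, 0 < C ∧ 3 ≤ T₀ ∧ ∀ T : ℝ, T₀ ≤ T → ∀ σ : ℝ, -(1 / 2) ≤ σ →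
      ∫ t in (T / 2)..(3 * T), ‖riemannZeta (σ + t * I)‖ ^ 2 ≤
        C * (T * Real.log T) * (T ^ (max (1 / 2 - σ) 0)) ^ 2 := by
  obtain ⟨C1, T₁, hC1, hT₁, h1⟩ := exists_integral_norm_riemannZeta_half_sq_le
  obtain ⟨C2, hC2, h2⟩ := exists_norm_riemannZeta_le_of_three_half_le
  obtain ⟨CQ, hCQ, hQ⟩ := exists_norm_riemannZeta_le_exp
  set D := √C1 + 8 * C2 + 1 with hD
  have hD1 : 1 ≤ D := by rw [hD]; linarith [Real.sqrt_nonneg C1]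
  have hDC2 : 8 * C2 ≤ D := by rw [hD]; linarith [Real.sqrt_nonneg C1]
  have hDC1 : √C1 ≤ D := by rw [hD]; linarith
  refine ⟨(Real.exp 1 * D) ^ 2, max T₁ (2000 + CQ), by positivity,
    hT₁.trans (le_max_left _ _), fun T hT σ hσ => ?_⟩
  have hTQ : 2000 + CQ ≤ T := (le_max_right _ _).trans hT
  have hT1 := h1 T ((le_max_left _ _).trans hT)
  have hT0 : 0 < T := by linarith
  have hL := one_le_log_of_three_le (show 3 ≤ T by linarith)
  set L := Real.log T with hLdef
  have hTL : 1 ≤ T * L := by nlinarith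
  have hsTL : √T ≤ √(T * L) := Real.sqrt_le_sqrt (by nlinarith)
  have hsTL1 : 1 ≤ √(T * L) := Real.one_le_sqrt.mpr hTL
  have hdiff : DifferentiableOn ℂ riemannZeta {s | 0 < s.im} := fun s hs =>
    (differentiableAt_riemannZeta (ne_one_of_im_ne_zero (ne_of_gt hs))).differentiableWithinAt
  have hhalf : ∫ t in (T / 2 - T / 4)..(3 * T + T / 4), ‖riemannZeta ((1 / 2 : ℝ) + t * I)‖ ^ 2 ≤
      (√C1 * √(T * L)) ^ 2 := by
    rw [mul_pow, Real.sq_sqrt hC1.le, Real.sq_sqrt (by linarith)]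
    refine le_trans ?_ hT1
    refine intervalIntegral.integral_mono_interval (by linarith) (by linarith) (by linarith)
      (Eventually.of_forall fun t => by positivity) ?_
    refine ContinuousOn.intervalIntegrable ?_
    rw [uIcc_of_le (by linarith)]
    exact (continuousOn_line_riemannZeta _ (by linarith)).norm.pow 2
  have hconst : ∀ (x K : ℝ) (a b : ℝ), 0 < a → a ≤ b →
      (∀ t ∈ Icc a b, ‖riemannZeta (x + t * I)‖ ≤ K) →
      ∫ t in a..b, ‖riemannZeta (x + t * I)‖ ^ 2 ≤ (b - a) * K ^ 2 := by
    intro x K a b ha hab hK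
    calc _ ≤ ∫ t in a..b, K ^ 2 := by
          refine intervalIntegral.integral_mono_on hab ?_ intervalIntegrable_const fun t ht => ?_
          · refine ContinuousOn.intervalIntegrable ?_
            rw [uIcc_of_le hab]
            exact (continuousOn_line_riemannZeta _ ha).norm.pow 2
          · have := hK t ht
            gcongr
      _ = _ := by simp
  have hQ' : ∀ x : ℝ, -(1 / 2) ≤ x → x ≤ 3 / 2 → ∀ t ∈ Icc (T / 2 - T / 4) (3 * T + T / 4),
      ‖riemannZeta (x + t * I)‖ ≤ CQ * Real.exp (10 * T) := by
    intro x hx1 hx2 t ht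
    have ht0 : 0 ≤ t := by linarith [ht.1]
    have him : (x + t * I : ℂ).im = t := by simp
    have hre : (x + t * I : ℂ).re = x := by simp
    have := hQ (x + t * I) (by rw [hre]; exact hx1) (by rw [hre]; exact hx2)
      (by rw [him, abs_of_nonneg ht0]; linarith [ht.1])
    refine this.trans ?_
    rw [him, abs_of_nonneg ht0]
    have : 2 * t ≤ 10 * T := by linarith [ht.2]
    gcongr
  have hcrude := crude_three_lines_bound hCQ hTQ
  have hconv : ∀ P : ℝ, (Real.exp 1 * (D * √(T * L) * P)) ^ 2 =
      (Real.exp 1 * D) ^ 2 * (T * L) * P ^ 2 := by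
    intro P
    have : √(T * L) ^ 2 = T * L := Real.sq_sqrt (by linarith)
    calc _ = (Real.exp 1 * D) ^ 2 * √(T * L) ^ 2 * P ^ 2 := by ring
      _ = _ := by rw [this]
  rcases le_or_gt σ (1 / 2) with hσ2 | hσ2
  · rw [max_eq_left (by linarith)]
    have hP1 : 1 ≤ T ^ (1 / 2 - σ) := Real.one_le_rpow (by linarith) (by linarith)
    have key := integral_norm_sq_le_of_three_lines (f := riemannZeta) (α := -1 / 2) (β := 1 / 2)
      (σ := σ) (a := T / 2) (b := 3 * T) (H := T / 4) (κ := L)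
      (A := 8 * C2 * (T * √T)) (B := √C1 * √(T * L)) (Q := CQ * Real.exp (10 * T))
      (W := D * √(T * L) * T ^ (1 / 2 - σ)) hdiff (by linarith) hσ2 (by linarith) (by linarith)
      (by linarith) (by positivity) (by positivity) (by positivity) ?_ hhalf ?_ ?_ ?_ ?_
    · refine key.trans (le_of_eq ?_)
      rw [← hconv]
      norm_num
    · refine (hconst (-1 / 2) (4 * C2 * T) _ _ (by linarith) (by linarith) ?_).trans ?_
      · intro t ht
        have ht0 : 0 < t := by linarith [ht.1]
        have h2' : (((-1 / 2 : ℝ) : ℂ) + t * I : ℂ) = 1 - ((3 / 2 : ℂ) + (-t : ℝ) * I) := by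
          push_cast; ring
        rw [h2', riemannZeta_one_sub_eq_feFactor_mul (by simpa using ht0.ne'), norm_mul,
          norm_feFactor_three_half _ (neg_ne_zero.mpr ht0.ne')]
        have h4 : ‖(1 / 2 + (-t : ℝ) * I : ℂ)‖ ≤ 1 / 2 + t := by
          refine (norm_add_le _ _).trans ?_
          rw [norm_mul, Complex.norm_I, Complex.norm_real, Real.norm_eq_abs, abs_neg,
            abs_of_nonneg ht0.le]
          norm_num
        have h5 : ‖(1 / 2 + (-t : ℝ) * I : ℂ)‖ / (2 * π) ≤ 4 * T := by
          rw [div_le_iff₀ (by positivity)]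
          nlinarith [Real.pi_gt_three, ht.2]
        have h6 := h2 ((3 / 2 : ℂ) + (-t : ℝ) * I) (by simp)
        calc _ ≤ 4 * T * C2 := by gcongr
          _ = _ := by ring
      · have h3 : (8 * C2 * (T * √T)) ^ 2 = 64 * C2 ^ 2 * T ^ 2 * T := by
          have : √T ^ 2 = T := Real.sq_sqrt hT0.le
          calc _ = 64 * C2 ^ 2 * T ^ 2 * √T ^ 2 := by ring
            _ = _ := by rw [this]
        rw [h3]
        have : 0 ≤ C2 ^ 2 * T ^ 2 * T := by positivity
        nlinarith
    · intro x hx t ht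
      exact hQ' x (by linarith [hx.1]) (by linarith [hx.2]) t ht
    · have h3 : T * Real.exp (L * (-1 / 2 - σ)) = T ^ (1 / 2 - σ) := by
        rw [exp_mul_log_eq_rpow hT0]
        nth_rw 1 [← Real.rpow_one T]
        rw [← Real.rpow_add hT0]
        congr 1
        ring
      calc _ = 8 * C2 * √T * (T * Real.exp (L * (-1 / 2 - σ))) := by ring
        _ ≤ _ := by
          rw [h3]
          gcongr
    · rw [exp_mul_log_eq_rpow hT0]
      gcongr
    · have h3 : |L| * (1 / 2 - -1 / 2) = L := by
        rw [abs_of_nonneg (by linarith)]; ring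
      rw [h3]
      refine hcrude.trans ?_
      calc (1 : ℝ) = 1 * 1 * 1 := by norm_num
        _ ≤ _ := by gcongr
  · rw [max_eq_right (by linarith), Real.rpow_zero]
    rcases le_or_gt σ (3 / 2) with hσ3 | hσ3
    · have key := integral_norm_sq_le_of_three_lines (f := riemannZeta) (α := 1 / 2) (β := 3 / 2)
        (σ := σ) (a := T / 2) (b := 3 * T) (H := T / 4) (κ := 0)
        (A := √C1 * √(T * L)) (B := 8 * C2 * √T) (Q := CQ * Real.exp (10 * T))
        (W := D * √(T * L) * 1) hdiff (by linarith) hσ3 (by linarith) (by linarith)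
        (by linarith) (by positivity) (by positivity) (by positivity) hhalf ?_ ?_ ?_ ?_ ?_
      · refine key.trans (le_of_eq ?_)
        rw [← hconv]
        norm_num
      · refine (hconst (3 / 2) C2 _ _ (by linarith) (by linarith) ?_).trans ?_
        · intro t ht
          exact h2 _ (by simp)
        · rw [mul_pow, Real.sq_sqrt hT0.le]
          have : 0 ≤ C2 ^ 2 * T := by positivity
          nlinarith
      · intro x hx t ht
        exact hQ' x (by linarith [hx.1]) (by linarith [hx.2]) t ht
      · simp only [zero_mul, Real.exp_zero, mul_one]
        gcongr
      · simp only [zero_mul, Real.exp_zero, mul_one]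
        gcongr
      · refine le_trans ?_ (hcrude.trans ?_)
        · gcongr
          rw [abs_zero, zero_mul]
          linarith
        · calc (1 : ℝ) = 1 * 1 * 1 := by norm_num
            _ ≤ _ := by gcongr
    · refine (hconst σ C2 _ _ (by linarith) (by linarith) ?_).trans ?_
      · intro t ht
        exact h2 _ (by simpa using hσ3.le)
      · have h3 : (8 * C2) ^ 2 ≤ D ^ 2 := by gcongr
        have h4 : 1 ≤ Real.exp 1 := Real.one_le_exp (by norm_num)
        have h5 : D ^ 2 ≤ (Real.exp 1 * D) ^ 2 := by
          gcongr
          exact le_mul_of_one_le_left (by linarith) h4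
        calc (3 * T - T / 2) * C2 ^ 2 ≤ (8 * C2) ^ 2 * T := by
              have : 0 ≤ C2 ^ 2 * T := by positivity
              nlinarith
          _ ≤ (Real.exp 1 * D) ^ 2 * (T * L) := by
              exact mul_le_mul (h3.trans h5) (by nlinarith) hT0.le (by positivity)
          _ = _ := by ring

/-- Area mean value property on a disc. -/
theorem setIntegral_ball_eq_of_differentiableAt {g : ℂ → ℂ} {z : ℂ} {r : ℝ} (hr : 0 < r)
    (hg : ∀ w ∈ Metric.closedBall z r, DifferentiableAt ℂ g w) :
    ∫ w in Metric.ball z r, g w = (π * r ^ 2 : ℝ) • g z := by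
  have hcirc : ∀ ρ ∈ Icc 0 r, ∀ θ : ℝ,
      z + Complex.polarCoord.symm (ρ, θ) ∈ Metric.closedBall z r := by
    intro ρ hρ θ
    rw [Metric.mem_closedBall, dist_eq_norm, add_sub_cancel_left, Complex.norm_polarCoord_symm,
      abs_of_nonneg hρ.1]
    exact hρ.2
  have hcont : ContinuousOn (fun p : ℝ × ℝ => p.1 • g (z + Complex.polarCoord.symm p))
      (Icc 0 r ×ˢ Icc (-π) π) := by
    refine continuousOn_fst.smul ?_
    have hsymm : Continuous fun p : ℝ × ℝ => z + Complex.polarCoord.symm p := by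
      simp only [Complex.polarCoord_symm_apply]
      fun_prop
    intro p hp
    have := (hg _ (hcirc p.1 hp.1 p.2)).continuousAt
    exact (ContinuousAt.comp (g := g) (f := fun p : ℝ × ℝ => z + Complex.polarCoord.symm p)
      (x := p) this hsymm.continuousAt).continuousWithinAt
  have hInt : IntegrableOn (fun p : ℝ × ℝ => p.1 • g (z + Complex.polarCoord.symm p))
      (Ioo 0 r ×ˢ Ioo (-π) π) :=
    (hcont.integrableOn_compact (isCompact_Icc.prod isCompact_Icc)).mono_set
      (prod_mono Ioo_subset_Icc_self Ioo_subset_Icc_self)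
  have h1 : ∫ w in Metric.ball z r, g w
      = ∫ w, (Metric.ball (0 : ℂ) r).indicator (fun w => g (z + w)) w := by
    rw [← integral_indicator Metric.isOpen_ball.measurableSet,
      ← integral_add_left_eq_self _ z]
    congr 1
    ext w
    simp [indicator]
  rw [h1, ← Complex.integral_comp_polarCoord_symm, polarCoord_target]
  have h2 : ∫ p in Ioi 0 ×ˢ Ioo (-π) π, p.1 • (Metric.ball (0 : ℂ) r).indicator
        (fun w => g (z + w)) (Complex.polarCoord.symm p)
      = ∫ p in Ioo 0 r ×ˢ Ioo (-π) π, p.1 • g (z + Complex.polarCoord.symm p) := by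
    rw [← integral_indicator (measurableSet_Ioi.prod measurableSet_Ioo),
      ← integral_indicator (measurableSet_Ioo.prod measurableSet_Ioo)]
    congr 1
    ext p
    simp only [indicator, Metric.mem_ball, dist_zero_right, Complex.norm_polarCoord_symm, mem_prod,
      mem_Ioi, mem_Ioo]
    by_cases hp : 0 < p.1
    · rw [abs_of_pos hp]
      by_cases hp2 : p.1 < r <;> simp [hp, hp2]
    · simp [hp]
  have h3 : ∀ ρ ∈ Ioo 0 r, ∫ θ in Ioo (-π) π, ρ • g (z + Complex.polarCoord.symm (ρ, θ))
      = ρ • ((2 * π) • g z) := by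
    intro ρ hρ
    rw [integral_smul]
    congr 1
    have hav : circleAverage g z ρ = g z := by
      refine circleAverage_of_differentiable_on_off_countable countable_empty ?_ ?_
      · intro w hw
        refine (hg w (Metric.closedBall_subset_closedBall ?_ hw)).continuousAt.continuousWithinAt
        rw [abs_of_pos hρ.1]; exact hρ.2.le
      · intro w hw
        refine hg w (Metric.closedBall_subset_closedBall ?_ (Metric.ball_subset_closedBall hw.1))
        rw [abs_of_pos hρ.1]; exact hρ.2.le
    rw [circleAverage_eq_integral_add (-π)] at hav
    rw [← hav, smul_smul, mul_inv_cancel₀ (by positivity), one_smul,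
      intervalIntegral.integral_comp_add_right (fun θ => g (circleMap z ρ θ)),
      ← integral_Ioc_eq_integral_Ioo, ← intervalIntegral.integral_of_le (by linarith [pi_pos])]
    have e1 : (0 : ℝ) + -π = -π := by ring
    have e2 : 2 * π + -π = π := by ring
    rw [e1, e2]
    refine intervalIntegral.integral_congr fun θ _ => ?_
    simp only [Complex.polarCoord_symm_apply, circleMap, Complex.exp_mul_I, Complex.ofReal_cos,
      Complex.ofReal_sin]
  rw [h2, Measure.volume_eq_prod, setIntegral_prod _ hInt, setIntegral_congr_fun measurableSet_Ioo h3,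
    ← integral_Ioc_eq_integral_Ioo, ← intervalIntegral.integral_of_le hr.le,
    intervalIntegral.integral_smul_const, integral_id, smul_smul]
  congr 1
  ring

/-- The value of a holomorphic function at the centre of a disc is controlled by the second
moment over the circumscribed square. -/
theorem norm_sq_le_integral_square {f : ℂ → ℂ} {z : ℂ} {r : ℝ} (hr : 0 < r)
    (hf : ∀ w : ℂ, w.re ∈ Icc (z.re - r) (z.re + r) → w.im ∈ Icc (z.im - r) (z.im + r) →
      DifferentiableAt ℂ f w) :
    π * r ^ 2 * ‖f z‖ ^ 2 ≤ ∫ x in (z.re - r)..(z.re + r), ∫ y in (z.im - r)..(z.im + r),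
      ‖f (x + y * I)‖ ^ 2 := by
  have hbox : ∀ w ∈ Metric.closedBall z r,
      w.re ∈ Icc (z.re - r) (z.re + r) ∧ w.im ∈ Icc (z.im - r) (z.im + r) := by
    intro w hw
    rw [Metric.mem_closedBall, dist_eq_norm] at hw
    have h1 := abs_le.1 ((Complex.abs_re_le_norm (w - z)).trans hw)
    have h2 := abs_le.1 ((Complex.abs_im_le_norm (w - z)).trans hw)
    simp only [Complex.sub_re, Complex.sub_im] at h1 h2
    exact ⟨⟨by linarith, by linarith⟩, ⟨by linarith, by linarith⟩⟩
  have hmv := setIntegral_ball_eq_of_differentiableAt (g := fun w => f w ^ 2) hr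
    (fun w hw => (hf w (hbox w hw).1 (hbox w hw).2).pow 2)
  set R : Set ℂ := Icc (z.re - r) (z.re + r) ×ℂ Icc (z.im - r) (z.im + r) with hR
  have hRmeas : MeasurableSet R :=
    (measurableSet_Icc.preimage Complex.measurable_re).inter
      (measurableSet_Icc.preimage Complex.measurable_im)
  have hRc : IsCompact R := isCompact_Icc.reProdIm isCompact_Icc
  have hcont : ContinuousOn (fun w => ‖f w‖ ^ 2) R := fun w hw =>
    ((hf w hw.1 hw.2).continuousAt.norm.pow 2).continuousWithinAt
  have hi : IntegrableOn (fun w => ‖f w‖ ^ 2) R := hcont.integrableOn_compact hRc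
  have h1 : π * r ^ 2 * ‖f z‖ ^ 2 ≤ ∫ w in R, ‖f w‖ ^ 2 := by
    calc π * r ^ 2 * ‖f z‖ ^ 2 = ‖∫ w in Metric.ball z r, f w ^ 2‖ := by
          rw [hmv, norm_smul, norm_pow, Real.norm_of_nonneg (by positivity)]
      _ ≤ ∫ w in Metric.ball z r, ‖f w ^ 2‖ := norm_integral_le_integral_norm _
      _ = ∫ w in Metric.ball z r, ‖f w‖ ^ 2 := by simp only [norm_pow]
      _ ≤ ∫ w in R, ‖f w‖ ^ 2 :=
          setIntegral_mono_set hi (Eventually.of_forall fun w => by positivity)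
            (Eventually.of_forall fun w hw => hbox w (Metric.ball_subset_closedBall hw))
  refine h1.trans (le_of_eq ?_)
  have hp : R = measurableEquivRealProd ⁻¹'
      (Icc (z.re - r) (z.re + r) ×ˢ Icc (z.im - r) (z.im + r)) := rfl
  have hcomp : (fun w => ‖f w‖ ^ 2) = fun w => (fun p : ℝ × ℝ => ‖f (p.1 + p.2 * I)‖ ^ 2)
      (measurableEquivRealProd w) := by
    ext w
    simp [Complex.re_add_im]
  rw [hp] at hi ⊢
  rw [hcomp] at hi
  have hi' := (volume_preserving_equiv_real_prod.integrableOn_comp_preimage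
    (f := fun p : ℝ × ℝ => ‖f (p.1 + p.2 * I)‖ ^ 2)
    measurableEquivRealProd.measurableEmbedding).1 hi
  rw [hcomp, volume_preserving_equiv_real_prod.setIntegral_preimage_emb
    measurableEquivRealProd.measurableEmbedding (fun p : ℝ × ℝ => ‖f (p.1 + p.2 * I)‖ ^ 2)]
  rw [Measure.volume_eq_prod] at hi' ⊢
  rw [setIntegral_prod _ hi', intervalIntegral.integral_of_le (by linarith),
    integral_Icc_eq_integral_Ioc]
  refine setIntegral_congr_fun measurableSet_Ioc fun x _ => ?_
  simp only
  rw [intervalIntegral.integral_of_le (by linarith), integral_Icc_eq_integral_Ioc]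

/-- Chebyshev's inequality for sliding box averages. -/
theorem measure_sliding_integral_ge_le {k : ℝ → ℝ → ℝ} (hk : Continuous (Function.uncurry k))
    (hk0 : ∀ x y, 0 ≤ k x y) {a b x₀ x₁ Y K c : ℝ} (hab : a ≤ b) (hx : x₀ ≤ x₁) (hY : 0 ≤ Y)
    (hc : 0 < c) (hK : ∀ x ∈ Icc x₀ x₁, ∫ y in (a - Y)..(b + Y), k x y ≤ K) :
    MeasurableSet {t | t ∈ Icc a b ∧ c ≤ ∫ x in x₀..x₁, ∫ y in (t - Y)..(t + Y), k x y} ∧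
    volume.real {t | t ∈ Icc a b ∧ c ≤ ∫ x in x₀..x₁, ∫ y in (t - Y)..(t + Y), k x y}
      ≤ 2 * Y * (x₁ - x₀) * K / c := by
  have hkx : ∀ x, Continuous (k x) := fun x => hk.comp (by fun_prop : Continuous fun y => (x, y))
  have hinner : ∀ x t, ∫ y in (t - Y)..(t + Y), k x y = ∫ u in (-Y)..Y, k x (t + u) := by
    intro x t
    rw [intervalIntegral.integral_comp_add_left (fun y => k x y)]
    rfl
  have hH : Continuous fun p : ℝ × ℝ => ∫ u in (-Y)..Y, k p.1 (p.2 + u) :=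
    intervalIntegral.continuous_parametric_intervalIntegral_of_continuous'
      (f := fun (p : ℝ × ℝ) u => k p.1 (p.2 + u))
      (hk.comp (by fun_prop : Continuous fun q : (ℝ × ℝ) × ℝ => (q.1.1, q.1.2 + q.2))) _ _
  have hG : Continuous fun t => ∫ x in x₀..x₁, ∫ u in (-Y)..Y, k x (t + u) :=
    intervalIntegral.continuous_parametric_intervalIntegral_of_continuous'
      (f := fun t x => ∫ u in (-Y)..Y, k x (t + u))
      (hH.comp (by fun_prop : Continuous fun q : ℝ × ℝ => (q.2, q.1))) _ _
  simp only [hinner]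
  set G := fun t => ∫ x in x₀..x₁, ∫ u in (-Y)..Y, k x (t + u) with hGdef
  have hG0 : ∀ t, 0 ≤ G t := fun t => intervalIntegral.integral_nonneg hx fun x _ =>
    intervalIntegral.integral_nonneg (by linarith) fun u _ => hk0 _ _
  have hIc : ∀ {F : ℝ × ℝ → ℝ} (_ : Continuous F) (a b c d : ℝ),
      IntegrableOn F (uIoc a b ×ˢ uIoc c d) := by
    intro F hF a b c d
    exact (hF.continuousOn.integrableOn_compact (isCompact_uIcc.prod isCompact_uIcc)).mono_set
      (prod_mono uIoc_subset_uIcc uIoc_subset_uIcc)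
  have hbound : ∫ t in a..b, G t ≤ 2 * Y * (x₁ - x₀) * K := by
    have h1 : ∫ t in a..b, G t = ∫ x in x₀..x₁, ∫ t in a..b, ∫ u in (-Y)..Y, k x (t + u) := by
      refine intervalIntegral_intervalIntegral_swap ?_
      exact hIc (F := Function.uncurry fun t x => ∫ u in (-Y)..Y, k x (t + u))
        (hH.comp (by fun_prop : Continuous fun q : ℝ × ℝ => (q.2, q.1))) _ _ _ _
    have h2 : ∀ x ∈ Icc x₀ x₁, ∫ t in a..b, ∫ u in (-Y)..Y, k x (t + u) ≤ 2 * Y * K := by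
      intro x hxm
      have h3 : ∫ t in a..b, ∫ u in (-Y)..Y, k x (t + u)
          = ∫ u in (-Y)..Y, ∫ t in a..b, k x (t + u) := by
        refine intervalIntegral_intervalIntegral_swap ?_
        exact hIc (F := Function.uncurry fun t u => k x (t + u))
          ((hkx x).comp (by fun_prop : Continuous fun q : ℝ × ℝ => q.1 + q.2)) _ _ _ _
      rw [h3]
      have h4 : ∀ u ∈ Icc (-Y) Y, ∫ t in a..b, k x (t + u) ≤ K := by
        intro u hu
        rw [intervalIntegral.integral_comp_add_right (fun y => k x y)]
        refine le_trans ?_ (hK x hxm)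
        exact intervalIntegral.integral_mono_interval (by linarith [hu.1]) (by linarith)
          (by linarith [hu.2]) (Eventually.of_forall fun y => hk0 x y)
          ((hkx x).intervalIntegrable _ _)
      calc ∫ u in (-Y)..Y, ∫ t in a..b, k x (t + u) ≤ ∫ u in (-Y)..Y, K := by
            refine intervalIntegral.integral_mono_on (by linarith) ?_ (by simp) h4
            exact (intervalIntegral.continuous_parametric_intervalIntegral_of_continuous'
              (f := fun u t => k x (t + u))
              ((hkx x).comp (by fun_prop : Continuous fun q : ℝ × ℝ => q.2 + q.1)) _
              _).intervalIntegrable _ _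
        _ = 2 * Y * K := by
            rw [intervalIntegral.integral_const, smul_eq_mul]; ring
    rw [h1]
    calc ∫ x in x₀..x₁, ∫ t in a..b, ∫ u in (-Y)..Y, k x (t + u) ≤ ∫ x in x₀..x₁, 2 * Y * K := by
          refine intervalIntegral.integral_mono_on hx ?_ (by simp) h2
          exact (intervalIntegral.continuous_parametric_intervalIntegral_of_continuous'
            (f := fun x t => ∫ u in (-Y)..Y, k x (t + u)) hH _ _).intervalIntegrable _ _
      _ = _ := by rw [intervalIntegral.integral_const, smul_eq_mul]; ring
  have hmeas : MeasurableSet {t | t ∈ Icc a b ∧ c ≤ G t} :=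
    measurableSet_Icc.inter (isClosed_le continuous_const hG).measurableSet
  refine ⟨hmeas, ?_⟩
  rw [le_div_iff₀ hc]
  have hGi : IntegrableOn G (Icc a b) := hG.continuousOn.integrableOn_compact isCompact_Icc
  have hch := mul_meas_ge_le_integral_of_nonneg (μ := volume.restrict (Icc a b)) (f := G)
    (Eventually.of_forall hG0) hGi c
  have heq : (volume.restrict (Icc a b)).real {t | c ≤ G t} = volume.real {t | t ∈ Icc a b ∧ c ≤ G t} := by
    rw [measureReal_restrict_apply (isClosed_le continuous_const hG).measurableSet]
    congr 1
    ext t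
    exact and_comm
  rw [heq, integral_Icc_eq_integral_Ioc, ← intervalIntegral.integral_of_le hab] at hch
  linarith

/-- A holomorphic function with bounded second moments on vertical lines is small on tall boxes
around all points outside a small set. -/
theorem exists_exceptional_set_of_integral_norm_sq_le {f : ℂ → ℂ} {T Y r x₀ x₁ K V : ℝ}
    (hf : ∀ w : ℂ, 0 < w.im → DifferentiableAt ℂ f w) (hr : 0 < r) (hY : 0 ≤ Y) (hx : x₀ ≤ x₁)
    (hV : 0 < V) (hT : 1 ≤ T - Y - r)
    (hK : ∀ x ∈ Icc (x₀ - r) (x₁ + r),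
      ∫ t in (T - Y - r)..(2 * T + Y + r), ‖f (x + t * I)‖ ^ 2 ≤ K) :
    ∃ E ⊆ Icc T (2 * T), MeasurableSet E ∧
      volume.real E ≤ 2 * (Y + r) * (x₁ - x₀ + 2 * r) * K / (π * r ^ 2 * V ^ 2) ∧
      ∀ t ∈ Icc T (2 * T) \ E, ∀ s : ℂ, s.re ∈ Icc x₀ x₁ → |s.im - t| ≤ Y → ‖f s‖ ≤ V := by
  set k : ℝ → ℝ → ℝ := fun x y => ‖f (x + (max y 1 : ℝ) * I)‖ ^ 2 with hk
  have hkc : Continuous (Function.uncurry k) := by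
    rw [continuous_iff_continuousAt]
    intro p
    have h1 : ContinuousAt f (p.1 + (max p.2 1 : ℝ) * I) := by
      refine (hf _ ?_).continuousAt
      simp
    have h2 : Continuous fun p : ℝ × ℝ => ((p.1 : ℂ) + (max p.2 1 : ℝ) * I) := by fun_prop
    exact (ContinuousAt.comp (g := f) (f := fun p : ℝ × ℝ => ((p.1 : ℂ) + (max p.2 1 : ℝ) * I))
      (x := p) h1 h2.continuousAt).norm.pow 2
  have hkf : ∀ x y, 1 ≤ y → k x y = ‖f (x + y * I)‖ ^ 2 := by
    intro x y hy
    simp only [hk, max_eq_left hy]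
  have hkx : ∀ x, Continuous (k x) := fun x => hkc.comp (by fun_prop : Continuous fun y => (x, y))
  have hk0 : ∀ x y, 0 ≤ k x y := fun x y => by positivity
  have hTY : T ≤ 2 * T := by linarith
  obtain ⟨hm, hv⟩ := measure_sliding_integral_ge_le hkc hk0 (a := T) (b := 2 * T) (x₀ := x₀ - r)
    (x₁ := x₁ + r) (Y := Y + r) (K := K) (c := π * r ^ 2 * V ^ 2) hTY (by linarith) (by linarith)
    (by positivity) (by
      intro x hx'
      refine le_trans (le_of_eq ?_) (hK x hx')
      have e1 : T - (Y + r) = T - Y - r := by ring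
      have e2 : 2 * T + (Y + r) = 2 * T + Y + r := by ring
      rw [e1, e2]
      refine intervalIntegral.integral_congr fun y hy => hkf x y ?_
      rw [uIcc_of_le (by linarith)] at hy
      linarith [hy.1])
  refine ⟨_, fun t ht => ht.1, hm, hv.trans (le_of_eq (by ring_nf)), ?_⟩
  intro t ht s hs1 hs2
  have hlt := lt_of_not_ge fun h => ht.2 ⟨ht.1, h⟩
  have hst := abs_le.1 hs2
  have htT := ht.1.1
  have hsq := norm_sq_le_integral_square (f := f) (z := s) hr
    (fun w _ hw => hf w (by linarith [hw.1]))
  have hstep : (∫ x in (s.re - r)..(s.re + r), ∫ y in (s.im - r)..(s.im + r),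
      ‖f (x + y * I)‖ ^ 2) ≤ ∫ x in (x₀ - r)..(x₁ + r), ∫ y in (t - (Y + r))..(t + (Y + r)), k x y := by
    have hHc : Continuous fun x => ∫ y in (t - (Y + r))..(t + (Y + r)), k x y :=
      intervalIntegral.continuous_parametric_intervalIntegral_of_continuous' hkc _ _
    have hHc' : Continuous fun x => ∫ y in (s.im - r)..(s.im + r), k x y :=
      intervalIntegral.continuous_parametric_intervalIntegral_of_continuous' hkc _ _
    calc (∫ x in (s.re - r)..(s.re + r), ∫ y in (s.im - r)..(s.im + r), ‖f (x + y * I)‖ ^ 2)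
        = ∫ x in (s.re - r)..(s.re + r), ∫ y in (s.im - r)..(s.im + r), k x y := by
          refine intervalIntegral.integral_congr fun x _ => ?_
          refine intervalIntegral.integral_congr fun y hy => (hkf x y ?_).symm
          rw [uIcc_of_le (by linarith)] at hy
          linarith [hy.1]
      _ ≤ ∫ x in (s.re - r)..(s.re + r), ∫ y in (t - (Y + r))..(t + (Y + r)), k x y := by
          refine intervalIntegral.integral_mono_on (by linarith) (hHc'.intervalIntegrable _ _)
            (hHc.intervalIntegrable _ _) fun x _ => ?_
          exact intervalIntegral.integral_mono_interval (by linarith) (by linarith)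
            (by linarith) (Eventually.of_forall fun y => hk0 x y) ((hkx x).intervalIntegrable _ _)
      _ ≤ _ := by
          exact intervalIntegral.integral_mono_interval (by linarith [hs1.1]) (by linarith)
            (by linarith [hs1.2]) (Eventually.of_forall fun x =>
              intervalIntegral.integral_nonneg (by linarith) fun y _ => hk0 x y)
            (hHc.intervalIntegrable _ _)
  have hpr : 0 < π * r ^ 2 := by positivity
  have : ‖f s‖ ^ 2 ≤ V ^ 2 := le_of_mul_le_mul_left (hsq.trans (hstep.trans hlt.le)) hpr
  exact (pow_le_pow_iff_left₀ (norm_nonneg _) hV.le two_ne_zero).1 this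

/-- Pointwise three lines estimate in a tall box. -/
theorem norm_le_half_of_box {g : ℂ → ℂ} {t Y B δ q lam : ℝ} (hY : Y < t) (hY0 : 0 ≤ Y)
    (hg : ∀ w : ℂ, 0 < w.im → DifferentiableAt ℂ g w) (hq : 1 ≤ q) (hB0 : 0 ≤ B) (hδ0 : 0 ≤ δ)
    (hlam : 0 ≤ lam)
    (hB : ∀ s : ℂ, s.re ∈ Icc (1 / 2) 3 → |s.im - t| ≤ Y → ‖g s‖ ≤ B)
    (hδ : ∀ s : ℂ, s.re = 3 → |s.im - t| ≤ Y → ‖g s‖ ≤ δ)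
    (h1 : Real.exp 7 * B * q ^ (-lam) ≤ 1 / 2)
    (h2 : Real.exp 7 * δ * q ^ (5 / 2 : ℝ) ≤ 1 / 2)
    (h3 : Real.exp (7 - Y ^ 2) * B * q ^ (5 / 2 : ℝ) ≤ 1 / 2)
    {σ : ℝ} (hσ : σ ∈ Icc (1 / 2 + lam) 3) : ‖g (σ + t * I)‖ ≤ 1 / 2 := by
  set s₁ : ℂ := σ + t * I with hs₁
  have hre : s₁.re = σ := by simp [hs₁]
  have him : s₁.im = t := by simp [hs₁]
  have hq0 : 0 < q := by linarith
  set h : ℂ → ℂ := fun s => g s * Complex.exp (Real.log q * (s - s₁) + (s - s₁) ^ 2) with hh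
  have hnorm : ∀ s : ℂ, ‖h s‖ = ‖g s‖ * (q ^ (s.re - σ) *
      Real.exp ((s.re - σ) ^ 2 - (s.im - t) ^ 2)) := by
    intro s
    rw [hh, norm_mul, Complex.norm_exp, Real.rpow_def_of_pos hq0, ← Real.exp_add]
    congr 2
    simp [pow_two, hre, him]
  have h0 : h s₁ = g s₁ := by simp [hh]
  have hσ1 := hσ.1
  have hσ2 := hσ.2
  have hexp : ∀ x y : ℝ, x ∈ Icc (1 / 2 : ℝ) 3 →
      Real.exp ((x - σ) ^ 2 - (y - t) ^ 2) ≤ Real.exp 7 := by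
    intro x y hx
    refine Real.exp_le_exp.2 ?_
    nlinarith [hx.1, hx.2, sq_nonneg (y - t)]
  have hqle : ∀ x : ℝ, x ∈ Icc (1 / 2 : ℝ) 3 → q ^ (x - σ) ≤ q ^ (5 / 2 : ℝ) := fun x hx =>
    Real.rpow_le_rpow_of_exponent_le hq (by linarith [hx.2])
  have hhoriz : ∀ x y : ℝ, x ∈ Icc (1 / 2 : ℝ) 3 → |y - t| = Y → ‖h (x + y * I)‖ ≤ 1 / 2 := by
    intro x y hx hy
    rw [hnorm]
    simp only [Complex.add_re, Complex.ofReal_re, Complex.mul_re, Complex.I_re, mul_zero,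
      Complex.ofReal_im, Complex.I_im, mul_one, sub_self, add_zero, Complex.add_im,
      Complex.mul_im, zero_add]
    have hb := hB (x + y * I) (by simpa using hx) (by simpa using hy.le)
    have he : Real.exp ((x - σ) ^ 2 - (y - t) ^ 2) ≤ Real.exp (7 - Y ^ 2) := by
      refine Real.exp_le_exp.2 ?_
      rw [← sq_abs (y - t), hy]
      nlinarith [hx.1, hx.2]
    calc ‖g (x + y * I)‖ * (q ^ (x - σ) * Real.exp ((x - σ) ^ 2 - (y - t) ^ 2))
        ≤ B * (q ^ (5 / 2 : ℝ) * Real.exp (7 - Y ^ 2)) := by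
          exact mul_le_mul hb (mul_le_mul (hqle x hx) he (Real.exp_pos _).le (by positivity))
            (by positivity) hB0
      _ = Real.exp (7 - Y ^ 2) * B * q ^ (5 / 2 : ℝ) := by ring
      _ ≤ 1 / 2 := h3
  rw [← h0]
  refine norm_le_of_rectangle_boundary (f := h) (α := (1 / 2 : ℝ)) (β := (3 : ℝ)) (c := t - Y)
    (d := t + Y) ?_ ?_ ?_ ?_ ?_ (by rw [hre]; exact ⟨by linarith, hσ2⟩)
    (by rw [him]; exact ⟨by linarith, by linarith⟩)
  · intro z _ hz
    have h1 := hg z (by linarith [hz.1])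
    have h2 : DifferentiableAt ℂ
      (fun s : ℂ => Complex.exp (Real.log q * (s - s₁) + (s - s₁) ^ 2)) z := by fun_prop
    exact h1.mul h2
  · intro y hy
    have hy' : |y - t| ≤ Y := abs_le.2 ⟨by linarith [hy.1], by linarith [hy.2]⟩
    have hm : (1 / 2 : ℝ) ∈ Icc (1 / 2 : ℝ) 3 := by norm_num
    rw [hnorm]
    have e1 : (((1 / 2 : ℝ) : ℂ) + y * I).re = 1 / 2 := by simp
    have e2 : (((1 / 2 : ℝ) : ℂ) + y * I).im = y := by simp
    have hb := hB (((1 / 2 : ℝ) : ℂ) + y * I) (by rw [e1]; exact hm) (by rw [e2]; exact hy')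
    rw [e1, e2]
    have hqq : q ^ (1 / 2 - σ) ≤ q ^ (-lam) :=
      Real.rpow_le_rpow_of_exponent_le hq (by linarith)
    calc _ ≤ B * (q ^ (-lam) * Real.exp 7) :=
          mul_le_mul hb (mul_le_mul hqq (hexp _ _ hm) (Real.exp_pos _).le (by positivity))
            (by positivity) hB0
      _ = Real.exp 7 * B * q ^ (-lam) := by ring
      _ ≤ 1 / 2 := h1
  · intro y hy
    have hy' : |y - t| ≤ Y := abs_le.2 ⟨by linarith [hy.1], by linarith [hy.2]⟩
    have hm : (3 : ℝ) ∈ Icc (1 / 2 : ℝ) 3 := by norm_num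
    rw [hnorm]
    have e1 : (((3 : ℝ) : ℂ) + y * I).re = 3 := by simp
    have e2 : (((3 : ℝ) : ℂ) + y * I).im = y := by simp
    have hb := hδ (((3 : ℝ) : ℂ) + y * I) e1 (by rw [e2]; exact hy')
    rw [e1, e2]
    calc _ ≤ δ * (q ^ (5 / 2 : ℝ) * Real.exp 7) :=
          mul_le_mul hb (mul_le_mul (hqle _ hm) (hexp _ _ hm) (Real.exp_pos _).le (by positivity))
            (by positivity) hδ0
      _ = Real.exp 7 * δ * q ^ (5 / 2 : ℝ) := by ring
      _ ≤ 1 / 2 := h2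
  · exact fun x hx => hhoriz x (t - Y) hx (by rw [sub_sub_cancel_left, abs_neg, abs_of_nonneg hY0])
  · exact fun x hx => hhoriz x (t + Y) hx (by rw [add_sub_cancel_left, abs_of_nonneg hY0])

lemma eventually_le_log (c : ℝ) : ∀ᶠ T : ℝ in atTop, c ≤ Real.log T :=
  Real.tendsto_log_atTop.eventually_ge_atTop c

lemma eventually_le_log_log (c : ℝ) : ∀ᶠ T : ℝ in atTop, c ≤ Real.log (Real.log T) :=
  Real.tendsto_log_atTop.eventually (eventually_le_log c)

lemma eventually_log_le {c : ℝ} (hc : 0 < c) : ∀ᶠ T : ℝ in atTop, Real.log T ≤ c * T := by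
  filter_upwards [Real.isLittleO_log_id_atTop.bound hc, eventually_ge_atTop 1] with T hT h1
  rw [Real.norm_of_nonneg (Real.log_nonneg h1), id, Real.norm_of_nonneg (by linarith)] at hT
  exact hT

lemma eventually_log_log_le {c : ℝ} (hc : 0 < c) :
    ∀ᶠ T : ℝ in atTop, Real.log (Real.log T) ≤ c * Real.log T :=
  Real.tendsto_log_atTop.eventually (eventually_log_le hc)

/-- Off a small set, `ζ` is at most a power of `log T` near and to the right of the critical
line. -/
theorem eventually_exists_exceptional_set_riemannZeta {C₁ : ℝ} (hC₁ : 0 ≤ C₁) :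
    ∀ᶠ T : ℝ in atTop, ∃ E ⊆ Icc T (2 * T), MeasurableSet E ∧
      volume.real E ≤ T / Real.log T ^ 6 ∧ ∀ t ∈ Icc T (2 * T) \ E, ∀ s : ℂ,
        s.re ∈ Icc (1 / 2 - C₁ * Real.log (Real.log T) / Real.log T) 3 →
        |s.im - t| ≤ Real.log T → ‖riemannZeta s‖ ≤ Real.log T ^ (8 + 2 * C₁) := by
  obtain ⟨C, T₀, hC, hT₀, hZ⟩ := exists_integral_norm_riemannZeta_sq_le
  filter_upwards [eventually_ge_atTop T₀, eventually_le_log 4, eventually_le_log_log 1,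
    eventually_log_le (c := 1 / 4) (by norm_num),
    eventually_log_log_le (c := 1 / (4 * (C₁ + 1))) (by positivity),
    eventually_le_log (16 * (C * Real.exp 2))] with T hTT hL4 hl1 hLT hlL hLC
  set L := Real.log T with hL
  set l := Real.log L with hl
  have hT0 : 0 < T := by linarith
  have hL0 : 0 < L := by linarith
  have hlp : 0 < l := by linarith
  have hA0 : 0 ≤ C₁ * l / L := by positivity
  have hA : C₁ * l / L ≤ 1 / 4 := by
    rw [div_le_iff₀ hL0]
    have h1 : (C₁ + 1) * l ≤ 1 / 4 * L := by
      calc (C₁ + 1) * l ≤ (C₁ + 1) * (1 / (4 * (C₁ + 1)) * L) := by gcongr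
        _ = 1 / 4 * L := by field_simp
    linarith
  have hr : 1 / L ≤ 1 / 4 := one_div_le_one_div_of_le (by norm_num) hL4
  have hr0 : 0 < 1 / L := by positivity
  set K := C * Real.exp 2 * (T * L) * L ^ (2 * C₁) with hK
  have hKle : ∀ x ∈ Icc (1 / 2 - C₁ * l / L - 1 / L) (3 + 1 / L),
      ∫ t in (T - L - 1 / L)..(2 * T + L + 1 / L), ‖riemannZeta (x + t * I)‖ ^ 2 ≤ K := by
    intro x hx
    have h1 := hZ T hTT x (by linarith [hx.1])
    have hInt : IntervalIntegrable (fun t : ℝ => ‖riemannZeta (x + t * I)‖ ^ 2) volume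
        (T / 2) (3 * T) :=
      ((continuousOn_line_riemannZeta x (by linarith : 0 < T / 2)).norm.pow 2).intervalIntegrable_of_Icc
        (by linarith)
    refine (intervalIntegral.integral_mono_interval (by linarith) (by linarith) (by linarith)
      (Eventually.of_forall fun t => by positivity) hInt).trans (h1.trans ?_)
    have h2 : T ^ (max (1 / 2 - x) 0) ≤ Real.exp 1 * L ^ C₁ := by
      rw [Real.rpow_def_of_pos hT0, Real.rpow_def_of_pos hL0, ← Real.exp_add]
      refine Real.exp_le_exp.2 ?_
      have h3 : max (1 / 2 - x) 0 ≤ C₁ * l / L + 1 / L := max_le (by linarith [hx.1]) (by linarith)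
      calc L * max (1 / 2 - x) 0 ≤ L * (C₁ * l / L + 1 / L) := by gcongr
        _ = 1 + l * C₁ := by field_simp; ring
    calc C * (T * L) * (T ^ (max (1 / 2 - x) 0)) ^ 2
        ≤ C * (T * L) * (Real.exp 1 * L ^ C₁) ^ 2 := by gcongr
      _ = K := by
        rw [hK, mul_pow, ← Real.exp_nat_mul, ← Real.rpow_natCast (L ^ C₁), ← Real.rpow_mul hL0.le]
        push_cast
        ring_nf
  obtain ⟨E, hE1, hE2, hE3, hE4⟩ := exists_exceptional_set_of_integral_norm_sq_le
    (f := riemannZeta) (T := T) (Y := L) (r := 1 / L) (x₀ := 1 / 2 - C₁ * l / L) (x₁ := 3) (K := K)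
    (V := L ^ (8 + 2 * C₁))
    (fun w hw => differentiableAt_riemannZeta (ne_one_of_im_ne_zero hw.ne')) hr0 hL0.le
    (by linarith) (by positivity) (by linarith) hKle
  refine ⟨E, hE1, hE2, hE3.trans ?_, hE4⟩
  have hV : (L ^ (8 + 2 * C₁)) ^ 2 = L ^ 16 * L ^ (2 * C₁) * L ^ (2 * C₁) := by
    rw [← Real.rpow_natCast, ← Real.rpow_mul hL0.le, ← Real.rpow_natCast, ← Real.rpow_add hL0,
      ← Real.rpow_add hL0]
    congr 1
    push_cast
    ring
  have hLC1 : 1 ≤ L ^ (2 * C₁) := Real.one_le_rpow (by linarith) (by positivity)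
  rw [hV, hK, div_le_div_iff₀ (by positivity) (by positivity)]
  have hb1 : 2 * (L + 1 / L) * (3 - (1 / 2 - C₁ * l / L) + 2 * (1 / L)) ≤ 16 * L := by
    nlinarith
  have hπ := Real.pi_gt_three
  have hb2 : 16 * (C * Real.exp 2) ≤ L ^ 6 := hLC.trans (by
    calc L = L ^ 1 := (pow_one L).symm
      _ ≤ L ^ 6 := pow_le_pow_right₀ (by linarith) (by norm_num))
  calc 2 * (L + 1 / L) * (3 - (1 / 2 - C₁ * l / L) + 2 * (1 / L)) *
        (C * Real.exp 2 * (T * L) * L ^ (2 * C₁)) * L ^ 6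
      ≤ 16 * L * (C * Real.exp 2 * (T * L) * L ^ (2 * C₁)) * L ^ 6 := by gcongr
    _ = 16 * (C * Real.exp 2) * (T * L ^ 8 * L ^ (2 * C₁)) := by ring
    _ ≤ L ^ 6 * (T * L ^ 8 * L ^ (2 * C₁)) := by gcongr
    _ = T * (1 * L ^ 14 * L ^ (2 * C₁) * 1) := by ring
    _ ≤ T * (π * L ^ 14 * L ^ (2 * C₁) * L ^ (2 * C₁)) := by gcongr; linarith
    _ = T * (π * (1 / L) ^ 2 * (L ^ 16 * L ^ (2 * C₁) * L ^ (2 * C₁))) := by field_simp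

/-- Off a small set, a short Dirichlet polynomial is small near and to the right of the critical
line. -/
theorem exists_exceptional_set_dpoly {s : Finset ℕ} (hs : ∀ n ∈ s, n ≠ 0) (c : ℕ → ℂ)
    {N T W V : ℝ} (hN : ∀ n ∈ s, (n : ℝ) ≤ N) (hN1 : 1 ≤ N) (hNT : 8 * N * (1 + Real.log N) ≤ T)
    (hW : ∑ n ∈ s, ‖c n‖ ^ 2 / n ≤ W) (hV : 0 < V) (hL4 : 4 ≤ Real.log T)
    (hLT : Real.log T ≤ 1 / 4 * T) :
    ∃ E ⊆ Icc T (2 * T), MeasurableSet E ∧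
      volume.real E ≤ 16 * Real.exp 2 * T * Real.log T ^ 3 * W / V ^ 2 ∧
      ∀ t ∈ Icc T (2 * T) \ E, ∀ w : ℂ, w.re ∈ Icc (1 / 2) 3 → |w.im - t| ≤ Real.log T →
        ‖dpoly s c w‖ ≤ V := by
  set L := Real.log T with hL
  have hL0 : 0 < L := by linarith
  have hT0 : 0 < T := by linarith
  have hr : 1 / L ≤ 1 / 4 := one_div_le_one_div_of_le (by norm_num) hL4
  have hr0 : 0 < 1 / L := by positivity
  have hW0 : 0 ≤ W := le_trans (Finset.sum_nonneg fun n _ => by positivity) hW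
  have hNle : N ≤ T := by nlinarith [Real.log_nonneg hN1]
  have hlogN : Real.log N ≤ L := Real.log_le_log (by linarith) hNle
  set K := 3 * T * (Real.exp 2 * W) with hK
  have hKle : ∀ x ∈ Icc (1 / 2 - 1 / L) (3 + 1 / L),
      ∫ t in (T - L - 1 / L)..(2 * T + L + 1 / L), ‖dpoly s c (x + t * I)‖ ^ 2 ≤ K := by
    intro x hx
    refine (integral_norm_sq_dpoly_le hs c x (by linarith) hN hN1).trans ?_
    have h1 : ∑ n ∈ s, ‖c n‖ ^ 2 * (n : ℝ) ^ (-2 * x) ≤ Real.exp 2 * W := by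
      calc ∑ n ∈ s, ‖c n‖ ^ 2 * (n : ℝ) ^ (-2 * x)
          ≤ ∑ n ∈ s, Real.exp 2 * (‖c n‖ ^ 2 / n) := by
            refine Finset.sum_le_sum fun n hn => ?_
            have hn0 : (1 : ℝ) ≤ n := by exact_mod_cast Nat.one_le_iff_ne_zero.2 (hs n hn)
            have hlogn0 : 0 ≤ Real.log n := Real.log_nonneg hn0
            have hlogn : Real.log n ≤ L :=
              Real.log_le_log (by linarith) ((hN n hn).trans hNle)
            have h2 : (n : ℝ) ^ (-2 * x) ≤ Real.exp 2 / n := by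
              have h3 : Real.exp 2 / n = Real.exp (2 - Real.log n) := by
                rw [Real.exp_sub, Real.exp_log (by linarith)]
              rw [h3, Real.rpow_def_of_pos (by linarith)]
              refine Real.exp_le_exp.2 ?_
              have h4 : Real.log n * (1 / 2 - x) ≤ 1 := by
                calc Real.log n * (1 / 2 - x) ≤ Real.log n * (1 / L) := by
                      gcongr; linarith [hx.1]
                  _ ≤ L * (1 / L) := by gcongr
                  _ = 1 := by field_simp
              linarith
            calc ‖c n‖ ^ 2 * (n : ℝ) ^ (-2 * x) ≤ ‖c n‖ ^ 2 * (Real.exp 2 / n) := by gcongr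
              _ = _ := by ring
        _ = Real.exp 2 * ∑ n ∈ s, ‖c n‖ ^ 2 / n := by rw [Finset.mul_sum]
        _ ≤ _ := by gcongr
    calc _ ≤ (3 * T) * (Real.exp 2 * W) := by
          refine mul_le_mul (by linarith) h1 (Finset.sum_nonneg fun n _ => by positivity)
            (by positivity)
      _ = K := rfl
  obtain ⟨E, hE1, hE2, hE3, hE4⟩ := exists_exceptional_set_of_integral_norm_sq_le
    (f := dpoly s c) (T := T) (Y := L) (r := 1 / L) (x₀ := 1 / 2) (x₁ := 3) (K := K) (V := V)
    (fun w _ => (dpoly_differentiable hs c) w) hr0 hL0.le (by norm_num) hV (by linarith) hKle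
  refine ⟨E, hE1, hE2, hE3.trans ?_, hE4⟩
  have hb1 : 2 * (L + 1 / L) * (3 - 1 / 2 + 2 * (1 / L)) ≤ 16 * L := by nlinarith
  rw [div_le_div_iff₀ (by positivity) (by positivity)]
  calc 2 * (L + 1 / L) * (3 - 1 / 2 + 2 * (1 / L)) * K * V ^ 2 ≤ 16 * L * K * V ^ 2 := by
        have : 0 ≤ K := by positivity
        gcongr
    _ = 16 * Real.exp 2 * T * L * W * (3 * V ^ 2) := by rw [hK]; ring
    _ ≤ 16 * Real.exp 2 * T * L * W * (π * V ^ 2) := by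
        gcongr
        exact Real.pi_gt_three.le
    _ = _ := by field_simp

/-- The three lines estimate with bounds that are powers of a logarithm. -/
theorem norm_le_half_of_log_bounds {g : ℂ → ℂ} {t L X b lam : ℝ} (ht : L < t)
    (hg : ∀ w : ℂ, 0 < w.im → DifferentiableAt ℂ g w) (hb : 0 ≤ b) (hlam : 0 ≤ lam)
    (hB : ∀ s : ℂ, s.re ∈ Icc (1 / 2) 3 → |s.im - t| ≤ L → ‖g s‖ ≤ L ^ b)
    (hδ : ∀ s : ℂ, s.re = 3 → |s.im - t| ≤ L → ‖g s‖ ≤ L ^ b / X ^ 2)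
    (hXL : L ^ (b + 1) ≤ X) (hXT : X ≤ Real.exp L) (hLe : 2 * Real.exp 7 ≤ L) (hLb : b + 20 ≤ L)
    (hlamX : (b + 1) * Real.log L ≤ lam * (2 / 5 * Real.log X))
    {σ : ℝ} (hσ : σ ∈ Icc (1 / 2 + lam) 3) : ‖g (σ + t * I)‖ ≤ 1 / 2 := by
  have hL1 : 1 ≤ L := by linarith
  have hL0 : 0 < L := by linarith
  have hX1 : 1 ≤ X := (Real.one_le_rpow hL1 (by linarith)).trans hXL
  have hX0 : 0 < X := by linarith
  have hLb1 : L ^ (b + 1) = L ^ b * L := by rw [Real.rpow_add hL0, Real.rpow_one]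
  have hX52 : (X ^ (2 / 5 : ℝ)) ^ (5 / 2 : ℝ) = X := by
    rw [← Real.rpow_mul hX0.le]; norm_num
  refine norm_le_half_of_box (q := X ^ (2 / 5 : ℝ)) (B := L ^ b) (δ := L ^ b / X ^ 2) ht hL0.le hg
    (Real.one_le_rpow hX1 (by norm_num)) (by positivity) (by positivity) hlam hB hδ ?_ ?_ ?_ hσ
  · have h1 : (X ^ (2 / 5 : ℝ)) ^ (-lam) ≤ (L ^ (b + 1))⁻¹ := by
      rw [← Real.rpow_mul hX0.le, ← Real.rpow_neg hL0.le, Real.rpow_def_of_pos hX0,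
        Real.rpow_def_of_pos hL0]
      exact Real.exp_le_exp.2 (by linarith)
    calc Real.exp 7 * L ^ b * (X ^ (2 / 5 : ℝ)) ^ (-lam)
        ≤ Real.exp 7 * L ^ b * (L ^ (b + 1))⁻¹ := by gcongr
      _ = Real.exp 7 / L := by rw [hLb1]; field_simp
      _ ≤ 1 / 2 := by rw [div_le_iff₀ hL0]; linarith
  · rw [hX52]
    calc Real.exp 7 * (L ^ b / X ^ 2) * X = Real.exp 7 * L ^ b / X := by field_simp
      _ ≤ Real.exp 7 * L ^ b / (L ^ (b + 1)) := by gcongr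
      _ = Real.exp 7 / L := by rw [hLb1]; field_simp
      _ ≤ 1 / 2 := by rw [div_le_iff₀ hL0]; linarith
  · rw [hX52]
    have hlog : Real.log L ≤ L := (Real.log_le_sub_one_of_pos hL0).trans (by linarith)
    have h1 : L ^ b ≤ Real.exp (L * b) := by
      rw [Real.rpow_def_of_pos hL0]
      exact Real.exp_le_exp.2 (by gcongr)
    calc Real.exp (7 - L ^ 2) * L ^ b * X
        ≤ Real.exp (7 - L ^ 2) * Real.exp (L * b) * Real.exp L := by gcongr
      _ = Real.exp (7 - L ^ 2 + L * b + L) := by rw [Real.exp_add, Real.exp_add]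
      _ ≤ Real.exp (-1) := by
          refine Real.exp_le_exp.2 ?_
          nlinarith
      _ ≤ 1 / 2 := by
          have := Real.exp_neg_one_lt_d9
          linarith

lemma tsum_rpow_neg_three_tail_le {M : ℕ} (hM : 1 ≤ M) :
    ∑' n : ℕ, ((n + (M + 1) : ℕ) : ℝ) ^ (-3 : ℝ) ≤ 1 / (M : ℝ) ^ 2 := by
  refine Real.tsum_le_of_sum_range_le (fun n => by positivity) fun k => ?_
  refine le_trans (le_of_eq ?_) (sum_Ioc_rpow_neg_three_le hM (k + M))
  refine Finset.sum_bij (fun n _ => n + (M + 1)) ?_ ?_ ?_ ?_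
  · intro n hn
    simp only [Finset.mem_range, Finset.mem_Ioc] at hn ⊢
    omega
  · intro a _ b _ h
    omega
  · intro n hn
    simp only [Finset.mem_range, Finset.mem_Ioc] at hn ⊢
    exact ⟨n - (M + 1), by omega, by omega⟩
  · intro n _
    rfl

/-- The coefficients of the Möbius mollifier. -/
def moebiusCoeff (n : ℕ) : ℂ := ((ArithmeticFunction.moebius n : ℤ) : ℂ)

lemma norm_moebiusCoeff_le (n : ℕ) : ‖moebiusCoeff n‖ ≤ 1 := by
  rw [moebiusCoeff, Complex.norm_intCast]
  exact_mod_cast ArithmeticFunction.abs_moebius_le_one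

lemma riemannZeta_mul_tsum_moebiusCoeff {w : ℂ} (hw : 1 < w.re) :
    riemannZeta w * ∑' n : ℕ, moebiusCoeff n * (n : ℂ) ^ (-w) = 1 := by
  have h := LSeries_one_mul_Lseries_moebius hw
  rw [LSeries_one_eq_riemannZeta hw] at h
  rw [← h]
  congr 1
  refine tsum_congr fun n => ?_
  rcases eq_or_ne n 0 with rfl | hn
  · simp [moebiusCoeff]
  · rw [LSeries.term_of_ne_zero hn, Complex.cpow_neg, moebiusCoeff, div_eq_mul_inv]

lemma exists_norm_riemannZeta_mul_moebius_sub_one_le :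
    ∃ C, 0 < C ∧ ∀ N : ℕ, 1 ≤ N → ∀ w : ℂ, w.re = 3 →
      ‖riemannZeta w * dpoly (Finset.Icc 1 N) moebiusCoeff w - 1‖ ≤ C / (N : ℝ) ^ 2 := by
  obtain ⟨C, hC, h⟩ := exists_norm_riemannZeta_le_of_three_half_le
  refine ⟨C, hC, fun N hN w hw => ?_⟩
  have hw1 : 1 < w.re := by rw [hw]; norm_num
  rw [← riemannZeta_mul_tsum_moebiusCoeff hw1, ← mul_sub, norm_mul, norm_sub_rev]
  have h1 := norm_tsum_sub_dpoly_le norm_moebiusCoeff_le hw1 N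
  rw [hw] at h1
  calc _ ≤ C * (1 / (N : ℝ) ^ 2) := by
        gcongr
        · exact h w (by rw [hw]; norm_num)
        · exact h1.trans (tsum_rpow_neg_three_tail_le hN)
    _ = _ := by ring

lemma eventually_log_rpow_le {a c : ℝ} (hc : 0 < c) :
    ∀ᶠ T : ℝ in atTop, Real.log T ^ a ≤ T ^ c := by
  filter_upwards [(isLittleO_log_rpow_rpow_atTop a hc).bound one_pos, eventually_ge_atTop 1]
    with T hT h1
  rw [one_mul, Real.norm_of_nonneg (Real.rpow_nonneg (Real.log_nonneg h1) _),
    Real.norm_of_nonneg (by positivity)] at hT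
  exact hT

lemma floor_rpow_quarter_facts {T : ℝ} (hT : 256 ≤ T) :
    T ^ (1 / 8 : ℝ) ≤ ⌊T ^ (1 / 4 : ℝ)⌋₊ ∧ (⌊T ^ (1 / 4 : ℝ)⌋₊ : ℝ) ≤ T ^ (1 / 4 : ℝ) ∧
      8 * (⌊T ^ (1 / 4 : ℝ)⌋₊ : ℝ) * (1 + Real.log ⌊T ^ (1 / 4 : ℝ)⌋₊) ≤ T := by
  have hT0 : 0 < T := by linarith
  set x := T ^ (1 / 8 : ℝ) with hx
  have hx2 : T ^ (1 / 4 : ℝ) = x ^ 2 := by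
    rw [hx, ← Real.rpow_natCast, ← Real.rpow_mul hT0.le]; norm_num
  have hx8 : T = x ^ 8 := by
    rw [hx, ← Real.rpow_natCast, ← Real.rpow_mul hT0.le]; norm_num
  have hx0 : 0 < x := by positivity
  have hx1 : 2 ≤ x := by
    have h : (2 : ℝ) ^ 8 ≤ x ^ 8 := by rw [← hx8]; norm_num; exact hT
    exact (pow_le_pow_iff_left₀ (by norm_num) hx0.le (by norm_num)).1 h
  rw [hx2]
  have h1 : (⌊x ^ 2⌋₊ : ℝ) ≤ x ^ 2 := Nat.floor_le (by positivity)
  have h2 : x ^ 2 < ⌊x ^ 2⌋₊ + 1 := Nat.lt_floor_add_one _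
  have h3 : x ≤ ⌊x ^ 2⌋₊ := by nlinarith
  refine ⟨h3, h1, ?_⟩
  have h4 : Real.log ⌊x ^ 2⌋₊ ≤ ⌊x ^ 2⌋₊ - 1 := Real.log_le_sub_one_of_pos (by linarith)
  have h5 : (4 : ℝ) ≤ x ^ 2 := by nlinarith
  have h6 : (16 : ℝ) ≤ x ^ 4 := by nlinarith
  set n := (⌊x ^ 2⌋₊ : ℝ) with hn
  have hn0 : 0 ≤ n := by positivity
  calc 8 * n * (1 + Real.log n) ≤ 8 * n * n := by gcongr; linarith
    _ ≤ 8 * x ^ 2 * x ^ 2 := by gcongr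
    _ ≤ x ^ 4 * x ^ 4 := by nlinarith
    _ = T := by rw [hx8]; ring

/-- Off a small set, `ζ` has both upper and lower bounds that are powers of `log T`. -/
theorem eventually_exists_exceptional_set_riemannZeta_lower :
    ∀ᶠ T : ℝ in atTop, ∃ E ⊆ Icc T (2 * T), MeasurableSet E ∧
      volume.real E ≤ 2 * (T / Real.log T ^ 6) ∧ ∀ t ∈ Icc T (2 * T) \ E,
        (∀ s : ℂ, s.re ∈ Icc (1 / 2) 3 → |s.im - t| ≤ Real.log T →
          ‖riemannZeta s‖ ≤ Real.log T ^ 8) ∧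
        ∀ σ ∈ Icc (1 / 2 + 320 * Real.log (Real.log T) / Real.log T) 3,
          1 / Real.log T ^ 7 ≤ ‖riemannZeta (σ + t * I)‖ := by
  obtain ⟨C, hC, hδ⟩ := exists_norm_riemannZeta_mul_moebius_sub_one_le
  filter_upwards [eventually_exists_exceptional_set_riemannZeta le_rfl, eventually_le_log 35,
    eventually_le_log (2 * Real.exp 7), eventually_le_log (16 * Real.exp 2), eventually_le_log C,
    eventually_log_le (c := 1 / 4) (by norm_num), eventually_ge_atTop 256,
    eventually_log_rpow_le (a := 16) (c := 1 / 8) (by norm_num), eventually_le_log_log 1]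
    with T hE hL35 hLe hLe2 hLC hLT hT256 hL16 hl1
  obtain ⟨E₁, hE₁s, hE₁m, hE₁v, hE₁⟩ := hE
  set L := Real.log T with hL
  have hT0 : 0 < T := by linarith
  have hL0 : 0 < L := by linarith
  obtain ⟨hN1, hN2, hN3⟩ := floor_rpow_quarter_facts hT256
  set N := ⌊T ^ (1 / 4 : ℝ)⌋₊ with hN
  have hT8 : 1 ≤ T ^ (1 / 8 : ℝ) := Real.one_le_rpow (by linarith) (by norm_num)
  have hNge : (1 : ℝ) ≤ N := by linarith
  have hNge' : 1 ≤ N := by exact_mod_cast hNge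
  have hlogN : L / 8 ≤ Real.log N := by
    have := Real.log_le_log (by linarith) hN1
    rw [Real.log_rpow hT0] at this
    linarith
  have hNT : (N : ℝ) ≤ T := by
    refine hN2.trans ?_
    calc T ^ (1 / 4 : ℝ) ≤ T ^ (1 : ℝ) :=
          Real.rpow_le_rpow_of_exponent_le (by linarith) (by norm_num)
      _ = T := Real.rpow_one T
  have hlogN' : 1 + Real.log N ≤ L := by
    have := Real.log_le_log (by linarith) hN2
    rw [Real.log_rpow hT0] at this
    linarith
  have hW : ∑ n ∈ Finset.Icc 1 N, ‖moebiusCoeff n‖ ^ 2 / n ≤ L := by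
    refine le_trans (Finset.sum_le_sum fun n _ => ?_) ((sum_inv_Icc_le N).trans hlogN')
    have := norm_moebiusCoeff_le n
    gcongr
    exact pow_le_one₀ (norm_nonneg _) this
  obtain ⟨E₂, hE₂s, hE₂m, hE₂v, hE₂⟩ := exists_exceptional_set_dpoly
    (fun n hn => ne_zero_of_mem_Icc_one hn) moebiusCoeff
    (fun n hn => by exact_mod_cast (Finset.mem_Icc.1 hn).2) hNge hN3 hW
    (V := L ^ 6) (by positivity) (by linarith) hLT
  refine ⟨E₁ ∪ E₂, union_subset hE₁s hE₂s, hE₁m.union hE₂m, ?_, ?_⟩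
  · have h2 : volume.real E₂ ≤ T / L ^ 6 := by
      refine hE₂v.trans ?_
      rw [div_le_div_iff₀ (by positivity) (by positivity)]
      have : 16 * Real.exp 2 * 1 ≤ L * L := by gcongr; linarith
      calc 16 * Real.exp 2 * T * L ^ 3 * L * L ^ 6 = (16 * Real.exp 2 * 1) * (T * L ^ 10) := by ring
        _ ≤ L * L * (T * L ^ 10) := by gcongr
        _ = T * (L ^ 6) ^ 2 := by ring
    linarith [measureReal_union_le (μ := volume) E₁ E₂]
  · intro t ht
    have ht1 : t ∈ Icc T (2 * T) \ E₁ := ⟨ht.1, fun h => ht.2 (Or.inl h)⟩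
    have ht2 : t ∈ Icc T (2 * T) \ E₂ := ⟨ht.1, fun h => ht.2 (Or.inr h)⟩
    have hz : ∀ s : ℂ, s.re ∈ Icc (1 / 2) 3 → |s.im - t| ≤ L → ‖riemannZeta s‖ ≤ L ^ 8 := by
      intro s hs1 hs2
      have h := hE₁ t ht1 s (by simpa using hs1) hs2
      rw [mul_zero, add_zero] at h
      exact_mod_cast h
    refine ⟨hz, fun σ hσ => ?_⟩
    have hM := hE₂ t ht2
    set M := dpoly (Finset.Icc 1 N) moebiusCoeff with hMdef
    have hlam0 : 0 ≤ 320 * Real.log L / L := by positivity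
    have key : ‖riemannZeta (σ + t * I) * M (σ + t * I) - 1‖ ≤ 1 / 2 := by
      refine norm_le_half_of_log_bounds (g := fun s => riemannZeta s * M s - 1) (L := L) (X := N)
        (b := 15) (lam := 320 * Real.log L / L) (by linarith [ht.1.1]) ?_ (by norm_num) hlam0
        ?_ ?_ ?_ ?_ hLe (by linarith) ?_ hσ
      · intro w hw
        exact ((differentiableAt_riemannZeta (ne_one_of_im_ne_zero hw.ne')).mul
          (dpoly_differentiable (fun n hn => ne_zero_of_mem_Icc_one hn) _ w)).sub_const _
      · intro s hs1 hs2
        calc ‖riemannZeta s * M s - 1‖ ≤ ‖riemannZeta s * M s‖ + ‖(1 : ℂ)‖ := norm_sub_le _ _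
          _ ≤ L ^ 8 * L ^ 6 + L ^ 14 := by
              rw [norm_mul, norm_one]
              gcongr
              · exact hz s hs1 hs2
              · exact hM s hs1 hs2
              · exact one_le_pow₀ (by linarith)
          _ = 2 * L ^ 14 := by ring
          _ ≤ L * L ^ 14 := by gcongr; linarith
          _ = L ^ (15 : ℝ) := by norm_cast; ring
      · intro s hs1 _
        refine (hδ N hNge' s hs1).trans ?_
        gcongr
        refine hLC.trans ?_
        calc L = L ^ (1 : ℝ) := (Real.rpow_one L).symm
          _ ≤ L ^ (15 : ℝ) := Real.rpow_le_rpow_of_exponent_le (by linarith) (by norm_num)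
      · refine le_trans ?_ hN1
        refine le_trans (le_of_eq ?_) hL16
        norm_num
      · rw [hL, Real.exp_log hT0]
        exact hNT
      · have hlpos : 0 < Real.log L := by linarith
        calc (15 + 1) * Real.log L = 320 * Real.log L / L * (2 / 5 * (L / 8)) := by field_simp; norm_num
          _ ≤ _ := by gcongr
    have hMle := hM (σ + t * I) (by
      simp only [Complex.add_re, Complex.ofReal_re, Complex.mul_re, Complex.I_re, mul_zero,
        Complex.ofReal_im, Complex.I_im, mul_one, sub_self, add_zero]
      exact ⟨by linarith [hσ.1], hσ.2⟩) (by simpa using hL0.le)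
    have h1 : 1 / 2 ≤ ‖riemannZeta (σ + t * I)‖ * ‖M (σ + t * I)‖ := by
      rw [← norm_mul]
      have h3 : ‖(1 : ℂ)‖ ≤ ‖riemannZeta (σ + t * I) * M (σ + t * I)‖ +
          ‖riemannZeta (σ + t * I) * M (σ + t * I) - 1‖ := by
        have := norm_sub_le (riemannZeta (σ + t * I) * M (σ + t * I))
          (riemannZeta (σ + t * I) * M (σ + t * I) - 1)
        simpa using this
      rw [norm_one] at h3
      linarith
    have h2 : 1 / 2 ≤ ‖riemannZeta (σ + t * I)‖ * L ^ 6 :=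
      h1.trans (by gcongr)
    rw [div_le_iff₀ (by positivity)]
    calc (1 : ℝ) ≤ 2 * (‖riemannZeta (σ + t * I)‖ * L ^ 6) := by linarith
      _ ≤ L * (‖riemannZeta (σ + t * I)‖ * L ^ 6) := by gcongr; linarith
      _ = _ := by ring

/-- Jensen's bound for the number of zeros, counted without multiplicity. -/
theorem card_zeros_le_of_analyticOnNhd {g : ℂ → ℂ} {c : ℂ} {r R M : ℝ} (hr : 0 < r) (hrR : r < R)
    (hM : 1 ≤ M) (hg : AnalyticOnNhd ℂ g (Metric.closedBall c R)) (hgc : g c ≠ 0)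
    (hb : ∀ z ∈ Metric.closedBall c R, ‖g z‖ ≤ M) (Z : Finset ℂ)
    (hZ : ∀ z ∈ Z, z ∈ Metric.closedBall c r ∧ g z = 0) :
    (Z.card : ℝ) ≤ Real.log (M / ‖g c‖) / Real.log (R / r) := by
  have hR : 0 < R := hr.trans hrR
  have h := AnalyticOnNhd.sum_divisor_le (c := c) (r := r) (R := R) (M := M) (f := g)
    (by rwa [abs_of_pos hr]) (by rwa [abs_of_pos hr, abs_of_pos hR]) hM
    (by rwa [abs_of_pos hR]) hgc (fun z hz => hb z (by
      rw [abs_of_pos hR] at hz; exact Metric.sphere_subset_closedBall hz))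
  rw [abs_of_pos hr] at h
  refine le_trans ?_ h
  have hgr : AnalyticOnNhd ℂ g (Metric.closedBall c r) :=
    hg.mono (Metric.closedBall_subset_closedBall hrR.le)
  have hfin := (MeromorphicOn.divisor g (Metric.closedBall c r)).finiteSupport
    (isCompact_closedBall c r)
  have hnn := MeromorphicOn.AnalyticOnNhd.divisor_nonneg hgr
  have hone : ∀ z ∈ Z, 1 ≤ MeromorphicOn.divisor g (Metric.closedBall c r) z := by
    intro z hz
    obtain ⟨hz1, hz2⟩ := hZ z hz
    rw [MeromorphicOn.AnalyticOnNhd.divisor_apply hgr hz1]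
    have hc : analyticOrderAt g c ≠ ⊤ := by
      rw [(hgr c (Metric.mem_closedBall_self hr.le)).analyticOrderAt_eq_zero.2 hgc]
      simp
    have htop : analyticOrderAt g z ≠ ⊤ :=
      hgr.analyticOrderAt_ne_top_of_isPreconnected (convex_closedBall c r).isPreconnected
        (Metric.mem_closedBall_self hr.le) hz1 hc
    have h0 : analyticOrderAt g z ≠ 0 := (hgr z hz1).analyticOrderAt_ne_zero.2 hz2
    obtain ⟨n, hn⟩ := ENat.ne_top_iff_exists.1 htop
    rw [← hn] at h0 ⊢
    have : n ≠ 0 := by rintro rfl; simp at h0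
    simp
    omega
  have hsum : (Z.card : ℤ) ≤ ∑ᶠ u, MeromorphicOn.divisor g (Metric.closedBall c r) u := by
    rw [finsum_eq_sum_of_support_subset (s := hfin.toFinset ∪ Z) _ (by
      intro u hu; simp [hu])]
    calc (Z.card : ℤ) = ∑ z ∈ Z, 1 := by simp
      _ ≤ ∑ z ∈ Z, MeromorphicOn.divisor g (Metric.closedBall c r) z := Finset.sum_le_sum hone
      _ ≤ _ := Finset.sum_le_sum_of_subset_of_nonneg Finset.subset_union_right
          fun z _ _ => hnn z
  exact_mod_cast hsum

lemma AnalyticAt.conj_comp_conj {h : ℂ → ℂ} {z : ℂ} (hh : AnalyticAt ℂ h ((starRingEnd ℂ) z)) :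
    AnalyticAt ℂ (fun w => (starRingEnd ℂ) (h ((starRingEnd ℂ) w))) z := by
  rw [Complex.analyticAt_iff_eventually_differentiableAt] at hh ⊢
  have := (Complex.continuous_conj.tendsto z).eventually hh
  filter_upwards [this] with w hw
  have := hw.conj_conj
  simp only [Complex.conj_conj] at this
  exact this

/-- Backlund's bound for the variation of the argument along a horizontal segment. -/
theorem abs_im_sub_im_le_of_analyticOnNhd {f : ℂ → ℂ} {θ : ℝ → ℂ} {c t r R M : ℝ} (hr : 0 < r)
    (hrR : r < R) (hM : 1 ≤ M) (hf : AnalyticOnNhd ℂ f (Metric.closedBall (c + t * I) R))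
    (hb : ∀ z ∈ Metric.closedBall (c + t * I : ℂ) R, ‖f z‖ ≤ M)
    (hθ : ContinuousOn θ (Icc (c - r) c))
    (hexp : ∀ x ∈ Icc (c - r) c, Complex.exp (θ x) = f (x + t * I)) {x : ℝ}
    (hx : x ∈ Icc (c - r) c) :
    |(θ x).im - (θ c).im| ≤ π * (Real.log (M / ‖f (c + t * I)‖) / Real.log (R / r) + 1) := by
  set α := (θ c).im with hα
  set h : ℂ → ℂ := fun z => Complex.exp (-(α * I)) * f (z + t * I) with hh
  set g : ℂ → ℂ := fun z => (1 / 2 : ℂ) * (h z + (starRingEnd ℂ) (h ((starRingEnd ℂ) z))) with hg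
  have hnexp : ‖Complex.exp (-(α * I))‖ = 1 := by
    rw [← neg_mul, ← Complex.ofReal_neg, Complex.norm_exp_ofReal_mul_I]
  have hcc : c ∈ Icc (c - r) c := ⟨by linarith, le_rfl⟩
  have hmem : ∀ z ∈ Metric.closedBall (c : ℂ) R, z + t * I ∈ Metric.closedBall (c + t * I : ℂ) R := by
    intro z hz
    simpa using hz
  have hmemc : ∀ z ∈ Metric.closedBall (c : ℂ) R,
      (starRingEnd ℂ) z ∈ Metric.closedBall (c : ℂ) R := by
    intro z hz
    rw [Metric.mem_closedBall, dist_eq_norm] at hz ⊢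
    rwa [← Complex.conj_ofReal c, ← map_sub, Complex.norm_conj]
  have hha : ∀ z ∈ Metric.closedBall (c : ℂ) R, AnalyticAt ℂ h z := by
    intro z hz
    have h1 := hf _ (hmem z hz)
    exact analyticAt_const.mul
      (AnalyticAt.comp (g := f) (f := fun z : ℂ => z + t * I) h1 (by fun_prop))
  have hga : AnalyticOnNhd ℂ g (Metric.closedBall (c : ℂ) R) := fun z hz =>
    analyticAt_const.mul ((hha z hz).add (hha _ (hmemc z hz)).conj_comp_conj)
  have hhb : ∀ z ∈ Metric.closedBall (c : ℂ) R, ‖h z‖ ≤ M := by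
    intro z hz
    rw [hh, norm_mul, hnexp, one_mul]
    exact hb _ (hmem z hz)
  have hgb : ∀ z ∈ Metric.closedBall (c : ℂ) R, ‖g z‖ ≤ M := by
    intro z hz
    have h1 := hhb z hz
    have h2 := hhb _ (hmemc z hz)
    calc ‖g z‖ = 1 / 2 * ‖h z + (starRingEnd ℂ) (h ((starRingEnd ℂ) z))‖ := by
          rw [hg, norm_mul]; norm_num
      _ ≤ 1 / 2 * (‖h z‖ + ‖(starRingEnd ℂ) (h ((starRingEnd ℂ) z))‖) := by
          gcongr; exact norm_add_le _ _
      _ ≤ M := by rw [Complex.norm_conj]; linarith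
  have hgx : ∀ y ∈ Icc (c - r) c,
      g y = ((‖f (y + t * I)‖ * Real.cos ((θ y).im - α) : ℝ) : ℂ) := by
    intro y hy
    have h1 : h y = Complex.exp (θ y - α * I) := by
      rw [hh]
      simp only
      rw [← hexp y hy, ← Complex.exp_add]
      congr 1
      ring
    have h2 : g y = ((h y).re : ℂ) := by
      rw [hg]
      simp only
      rw [Complex.conj_ofReal, Complex.add_conj]
      push_cast
      ring
    rw [h2, h1, Complex.exp_re, ← hexp y hy, Complex.norm_exp]
    simp
  have hfc : f (c + t * I) ≠ 0 := by rw [← hexp c hcc]; exact Complex.exp_ne_zero _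
  have hgc : g c = (‖f (c + t * I)‖ : ℂ) := by
    rw [hgx c hcc, ← hα]
    simp
  have hgc0 : g c ≠ 0 := by rw [hgc]; simpa using hfc
  set A := |(θ x).im - α| with hA
  set n := ⌊A / π + 1 / 2⌋₊ with hn
  have hπ := Real.pi_pos
  have hphi : ContinuousOn (fun y => |(θ y).im - α|) (Icc x c) :=
    ((Complex.continuous_im.comp_continuousOn hθ).sub continuousOn_const).abs.mono
      (Icc_subset_Icc_left hx.1)
  have hex : ∀ k : ℕ, k < n → ∃ y ∈ Icc x c, |(θ y).im - α| = (k + 1 / 2) * π := by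
    intro k hk
    have h1 : ((k + 1 : ℕ) : ℝ) ≤ A / π + 1 / 2 :=
      (Nat.cast_le.2 (Nat.succ_le_of_lt hk)).trans (Nat.floor_le (by positivity))
    push_cast at h1
    have h2 : (k + 1 / 2 : ℝ) * π ≤ A := by
      rw [← le_div_iff₀ hπ]; linarith
    have h3 := intermediate_value_Icc' hx.2 hphi
    obtain ⟨y, hy, hy2⟩ := h3 ⟨by rw [← hα]; simp; positivity, h2⟩
    exact ⟨y, hy, hy2⟩
  choose! y hy1 hy2 using hex
  have hinj : Set.InjOn (fun k => (y k : ℂ)) (Finset.range n) := by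
    intro j hj k hk hjk
    have hj' := Finset.mem_range.1 (Finset.mem_coe.1 hj)
    have hk' := Finset.mem_range.1 (Finset.mem_coe.1 hk)
    have h1 : y j = y k := Complex.ofReal_injective hjk
    have h2 := hy2 j hj'
    rw [h1, hy2 k hk'] at h2
    have h3 := mul_right_cancel₀ hπ.ne' h2
    have h4 : (k : ℝ) = j := by linarith
    exact_mod_cast h4.symm
  have hcard := card_zeros_le_of_analyticOnNhd hr hrR hM hga hgc0 hgb
    ((Finset.range n).image fun k => (y k : ℂ)) (by
      intro z hz
      obtain ⟨k, hk, rfl⟩ := Finset.mem_image.1 hz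
      have hk' := Finset.mem_range.1 hk
      have hyk := hy1 k hk'
      refine ⟨?_, ?_⟩
      · rw [Metric.mem_closedBall, dist_eq_norm, ← Complex.ofReal_sub, Complex.norm_real,
          Real.norm_eq_abs, abs_le]
        constructor <;> linarith [hyk.1, hyk.2, hx.1]
      · rw [hgx _ ⟨hx.1.trans hyk.1, hyk.2⟩, ← Real.cos_abs, hy2 k hk']
        have : Real.cos ((k + 1 / 2) * π) = 0 := by
          rw [Real.cos_eq_zero_iff]
          exact ⟨k, by push_cast; ring⟩
        rw [this]; simp)
  rw [Finset.card_image_of_injOn hinj, Finset.card_range, hgc, Complex.norm_real,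
    Real.norm_of_nonneg (norm_nonneg _)] at hcard
  have hlt : A / π + 1 / 2 < n + 1 := Nat.lt_floor_add_one _
  have h1 : A / π ≤ Real.log (M / ‖f (c + t * I)‖) / Real.log (R / r) + 1 := by linarith
  rw [div_le_iff₀ hπ] at h1
  linarith

lemma eventually_tsum_nat_rpow_le :
    ∀ᶠ T : ℝ in atTop, ∑' n : ℕ, 1 / (n : ℝ) ^ (1 + 1 / Real.log T) ≤ 2 * Real.log T := by
  have h1 : Tendsto (fun T : ℝ => 1 + 1 / Real.log T) atTop (nhdsWithin 1 (Ioi 1)) := by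
    refine tendsto_nhdsWithin_iff.2 ⟨?_, ?_⟩
    · have := (tendsto_inv_atTop_zero.comp Real.tendsto_log_atTop).const_add 1
      simpa [Function.comp_def] using this
    · filter_upwards [eventually_le_log 1] with T hT
      have : 0 < 1 / Real.log T := by positivity
      exact lt_add_of_pos_right _ this
  have h2 := (tendsto_sub_mul_tsum_nat_rpow.comp h1).eventually_le_const (by norm_num : (1 : ℝ) < 2)
  filter_upwards [h2, eventually_le_log 1] with T hT hL
  simp only [Function.comp_apply, add_sub_cancel_left] at hT
  rwa [one_div_mul_eq_div, div_le_iff₀ (by linarith)] at hT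

/-- An upper bound of Mertens type for the sum of the reciprocals of the primes. -/
lemma eventually_sum_primesBelow_inv_le :
    ∀ᶠ T : ℝ in atTop, ∀ N : ℕ, (N : ℝ) ≤ T →
      ∑ p ∈ N.primesBelow, 1 / (p : ℝ) ≤ 6 * Real.log (Real.log T) := by
  filter_upwards [eventually_tsum_nat_rpow_le, eventually_le_log 1, eventually_le_log_log 7,
    eventually_ge_atTop 1] with T hT hL hl hT1 N hN
  set s := 1 + 1 / Real.log T with hs
  have hL0 : 0 < 1 / Real.log T := by positivity
  have hs1 : 1 < s := by linarith
  let f : ℕ →*₀ ℝ :=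
    { toFun := fun n => ((n : ℝ) ^ s)⁻¹
      map_zero' := by simp [Real.zero_rpow (show s ≠ 0 by linarith)]
      map_one' := by simp
      map_mul' := fun m n => by
        simp only [Nat.cast_mul]
        rw [Real.mul_rpow (by positivity) (by positivity), mul_inv] }
  have hf : ∀ n : ℕ, f n = ((n : ℝ) ^ s)⁻¹ := fun n => rfl
  have hf0 : ∀ n, 0 ≤ f n := fun n => by rw [hf]; positivity
  have hsum : Summable f := (Real.summable_nat_rpow_inv.2 hs1)
  have hsumn : Summable fun n => ‖f n‖ := hsum.norm
  have hprod := EulerProduct.prod_primesBelow_geometric_eq_tsum_smoothNumbers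
    (f := (f : ℕ →* ℝ)) hsum N
  have hle : ∏ p ∈ N.primesBelow, (1 - f p)⁻¹ ≤ 2 * Real.log T := by
    refine le_trans (le_of_eq hprod) ?_
    refine le_trans (Summable.tsum_subtype_le f _ hf0 hsum) ?_
    refine le_trans (le_of_eq (tsum_congr fun n => ?_)) hT
    rw [hf, one_div]
  have hlt : ∀ p ∈ N.primesBelow, 0 < 1 - f p := by
    intro p hp
    have hp2 := (Nat.prime_of_mem_primesBelow hp).two_le
    rw [hf, sub_pos]
    refine inv_lt_one_of_one_lt₀ (Real.one_lt_rpow ?_ (by linarith))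
    exact_mod_cast (by omega : 1 < p)
  have hlog : ∑ p ∈ N.primesBelow, f p ≤ Real.log (2 * Real.log T) := by
    refine le_trans ?_ (Real.log_le_log (Finset.prod_pos fun p hp => inv_pos.2 (hlt p hp)) hle)
    rw [Real.log_prod fun p hp => (inv_pos.2 (hlt p hp)).ne']
    refine Finset.sum_le_sum fun p hp => ?_
    rw [Real.log_inv]
    linarith [Real.log_le_sub_one_of_pos (hlt p hp)]
  have hterm : ∀ p ∈ N.primesBelow, 1 / (p : ℝ) ≤ Real.exp 1 * f p := by
    intro p hp
    have hp0 : (0 : ℝ) < p := by exact_mod_cast (Nat.prime_of_mem_primesBelow hp).pos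
    have hpN : (p : ℝ) ≤ T := le_trans (by exact_mod_cast (Nat.lt_of_mem_primesBelow hp).le) hN
    have h1 : (p : ℝ) ^ (1 / Real.log T) ≤ Real.exp 1 := by
      rw [Real.rpow_def_of_pos hp0, Real.exp_le_exp, mul_one_div]
      exact div_le_one_of_le₀ (Real.log_le_log hp0 hpN) (by linarith)
    rw [hf, hs, Real.rpow_add hp0, Real.rpow_one, mul_inv, ← div_eq_mul_inv, mul_div_assoc',
      le_div_iff₀ (by positivity), one_div, mul_comm]
    exact mul_le_mul_of_nonneg_right h1 (by positivity)
  have he : Real.exp 1 ≤ 3 := by linarith [Real.exp_one_lt_d9]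
  have hl2 : Real.log 2 ≤ 1 := by linarith [Real.log_two_lt_d9]
  calc ∑ p ∈ N.primesBelow, 1 / (p : ℝ) ≤ ∑ p ∈ N.primesBelow, Real.exp 1 * f p :=
        Finset.sum_le_sum hterm
    _ = Real.exp 1 * ∑ p ∈ N.primesBelow, f p := (Finset.mul_sum _ _ _).symm
    _ ≤ 3 * (Real.log 2 + Real.log (Real.log T)) := by
        refine mul_le_mul he ?_ (Finset.sum_nonneg fun p _ => hf0 p) (by norm_num)
        rwa [← Real.log_mul (by norm_num) (by linarith)]
    _ ≤ _ := by linarith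

/-- The powers of a Dirichlet polynomial supported on primes, with the size of its coefficients. -/
lemma exists_dpoly_eq_pow {A : Finset ℕ} {N : ℕ} (hA : ∀ p ∈ A, p.Prime) (hN : ∀ p ∈ A, p ≤ N)
    (k : ℕ) : ∃ (s : Finset ℕ) (c : ℕ → ℂ),
      (∀ n ∈ s, n ≠ 0 ∧ ArithmeticFunction.cardFactors n = k ∧ n ≤ N ^ k) ∧
      (∀ n ∈ s, ‖c n‖ ≤ k.factorial) ∧
      ∑ n ∈ s, ‖c n‖ / n ≤ (∑ p ∈ A, 1 / (p : ℝ)) ^ k ∧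
      ∀ w, dpoly s c w = dpoly A (fun _ => 1) w ^ k := by
  induction k with
  | zero =>
    refine ⟨{1}, fun _ => 1, ?_, ?_, ?_, ?_⟩ <;> simp [dpoly]
  | succ k ih =>
    obtain ⟨s, c, h1, h2, h3, h4⟩ := ih
    refine ⟨Finset.image₂ (· * ·) A s, dconv A s (fun _ => 1) c, ?_, ?_, ?_, ?_⟩
    · intro n hn
      obtain ⟨p, hp, m, hm, rfl⟩ := Finset.mem_image₂.1 hn
      obtain ⟨hm0, hmk, hmN⟩ := h1 m hm
      refine ⟨mul_ne_zero (hA p hp).ne_zero hm0, ?_, ?_⟩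
      · rw [ArithmeticFunction.cardFactors_mul (hA p hp).ne_zero hm0, hmk,
          ArithmeticFunction.cardFactors_apply_prime (hA p hp), add_comm]
      · rw [pow_succ']
        exact Nat.mul_le_mul (hN p hp) hmN
    · intro n hn
      have hn' : n ≠ 0 ∧ ArithmeticFunction.cardFactors n = k + 1 := by
        obtain ⟨p, hp, m, hm, rfl⟩ := Finset.mem_image₂.1 hn
        obtain ⟨hm0, hmk, hmN⟩ := h1 m hm
        refine ⟨mul_ne_zero (hA p hp).ne_zero hm0, ?_⟩
        rw [ArithmeticFunction.cardFactors_mul (hA p hp).ne_zero hm0, hmk,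
          ArithmeticFunction.cardFactors_apply_prime (hA p hp), add_comm]
      have hcard : ((A ×ˢ s).filter fun p : ℕ × ℕ => p.1 * p.2 = n).card ≤ k + 1 := by
        rw [← hn'.2, ArithmeticFunction.cardFactors_apply]
        refine le_trans ?_ (List.toFinset_card_le _)
        refine Finset.card_le_card_of_injOn Prod.fst ?_ ?_
        · intro x hx
          simp only [Finset.coe_filter, Finset.mem_product] at hx
          have hx2 : x.1 * x.2 = n := hx.2
          simp only [Finset.mem_coe, List.mem_toFinset]
          rw [Nat.mem_primeFactorsList hn'.1]
          exact ⟨hA _ hx.1.1, Dvd.intro _ hx2⟩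
        · intro x hx y hy hxy
          simp only [Finset.coe_filter, Finset.mem_product] at hx hy
          have hx2 : x.1 * x.2 = n := hx.2
          have hy2 : y.1 * y.2 = n := hy.2
          refine Prod.ext hxy ?_
          have : x.1 * x.2 = x.1 * y.2 := by rw [hx2, hxy, hy2]
          exact Nat.eq_of_mul_eq_mul_left (hA _ hx.1.1).pos this
      calc ‖dconv A s (fun _ => 1) c n‖
          ≤ ∑ p ∈ A ×ˢ s with p.1 * p.2 = n, (k.factorial : ℝ) := by
            refine (norm_sum_le _ _).trans (Finset.sum_le_sum fun x hx => ?_)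
            simp only [Finset.mem_filter, Finset.mem_product] at hx
            rw [one_mul]
            exact h2 _ hx.1.2
        _ ≤ (k + 1 : ℕ) * (k.factorial : ℝ) := by
            rw [Finset.sum_const, nsmul_eq_mul]
            gcongr
        _ = _ := by rw [Nat.factorial_succ]; push_cast; ring
    · have hmaps : ∀ x ∈ A ×ˢ s, x.1 * x.2 ∈ Finset.image₂ (· * ·) A s := fun x hx =>
        Finset.mem_image₂_of_mem (Finset.mem_product.1 hx).1 (Finset.mem_product.1 hx).2
      calc ∑ n ∈ Finset.image₂ (· * ·) A s, ‖dconv A s (fun _ => 1) c n‖ / n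
          ≤ ∑ n ∈ Finset.image₂ (· * ·) A s, ∑ x ∈ A ×ˢ s with x.1 * x.2 = n,
              1 / (x.1 : ℝ) * (‖c x.2‖ / x.2) := by
            refine Finset.sum_le_sum fun n _ => ?_
            rw [dconv]
            refine le_trans (div_le_div_of_nonneg_right (norm_sum_le _ _) (by positivity)) ?_
            rw [Finset.sum_div]
            refine Finset.sum_le_sum fun x hx => le_of_eq ?_
            rw [← (Finset.mem_filter.1 hx).2, one_mul]
            push_cast
            rw [div_mul_div_comm, one_mul]
        _ = ∑ x ∈ A ×ˢ s, 1 / (x.1 : ℝ) * (‖c x.2‖ / x.2) :=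
            Finset.sum_fiberwise_of_maps_to hmaps _
        _ = (∑ p ∈ A, 1 / (p : ℝ)) * ∑ n ∈ s, ‖c n‖ / n := by
            rw [Finset.sum_mul_sum, Finset.sum_product]
        _ ≤ _ := by
            rw [pow_succ']
            gcongr
    · intro w
      rw [← dpoly_mul, h4, pow_succ']

/-- The logarithm of the finite Euler product `∏_{p ≤ N} (1 - p ^ (-s))`. -/
def eulerLog (N : ℕ) (s : ℂ) : ℂ :=
  ∑ p ∈ (N + 1).primesBelow, Complex.log (1 - (p : ℂ) ^ (-s))

lemma norm_prime_cpow_neg_lt {p : ℕ} (hp : p.Prime) {s : ℂ} (hs : 1 / 2 ≤ s.re) :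
    ‖(p : ℂ) ^ (-s)‖ ≤ 3 / 4 ∧ ‖(p : ℂ) ^ (-s)‖ ^ 2 ≤ 1 / (p : ℝ) := by
  have hp2 : (2 : ℝ) ≤ p := by exact_mod_cast hp.two_le
  have h2 : ‖(p : ℂ) ^ (-s)‖ ^ 2 ≤ 1 / (p : ℝ) := by
    rw [norm_natCast_cpow_neg hp.ne_zero, ← Real.rpow_natCast, ← Real.rpow_mul (by linarith),
      one_div, ← Real.rpow_neg_one]
    refine Real.rpow_le_rpow_of_exponent_le (by linarith) ?_
    push_cast
    linarith
  refine ⟨?_, h2⟩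
  have h3 : 1 / (p : ℝ) ≤ 1 / 2 := one_div_le_one_div_of_le (by norm_num) hp2
  nlinarith [norm_nonneg ((p : ℂ) ^ (-s))]

lemma one_sub_prime_cpow_neg_mem_slitPlane {p : ℕ} (hp : p.Prime) {s : ℂ} (hs : 1 / 2 ≤ s.re) :
    1 - (p : ℂ) ^ (-s) ∈ slitPlane := by
  have h := (norm_prime_cpow_neg_lt hp hs).1
  rw [sub_eq_add_neg]
  exact Complex.mem_slitPlane_of_norm_lt_one (by rw [norm_neg]; linarith)

lemma norm_eulerLog_le (N : ℕ) {s : ℂ} (hs : 1 / 2 ≤ s.re) :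
    ‖eulerLog N s‖ ≤ ‖dpoly (N + 1).primesBelow (fun _ => 1) s‖ +
      2 * ∑ p ∈ (N + 1).primesBelow, 1 / (p : ℝ) := by
  have h1 : ‖eulerLog N s + dpoly (N + 1).primesBelow (fun _ => 1) s‖ ≤
      2 * ∑ p ∈ (N + 1).primesBelow, 1 / (p : ℝ) := by
    rw [eulerLog, dpoly, ← Finset.sum_add_distrib, Finset.mul_sum]
    refine (norm_sum_le _ _).trans (Finset.sum_le_sum fun p hp => ?_)
    obtain ⟨h1, h2⟩ := norm_prime_cpow_neg_lt (Nat.prime_of_mem_primesBelow hp) hs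
    set z := (p : ℂ) ^ (-s)
    have h3 := Complex.norm_log_one_add_sub_self_le (z := -z) (by rw [norm_neg]; linarith)
    rw [norm_neg, ← sub_eq_add_neg, sub_neg_eq_add] at h3
    rw [one_mul]
    refine h3.trans ?_
    have h4 : (1 - ‖z‖)⁻¹ ≤ 4 := by
      rw [inv_le_comm₀ (by linarith) (by norm_num)]
      linarith
    calc ‖z‖ ^ 2 * (1 - ‖z‖)⁻¹ / 2 ≤ 1 / (p : ℝ) * 4 / 2 := by
          have : 0 ≤ (1 - ‖z‖)⁻¹ := inv_nonneg.2 (by linarith)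
          gcongr
      _ = _ := by ring
  have h2 := norm_sub_le (eulerLog N s + dpoly (N + 1).primesBelow (fun _ => 1) s)
    (dpoly (N + 1).primesBelow (fun _ => 1) s)
  rw [add_sub_cancel_right] at h2
  linarith

lemma exp_eulerLog (N : ℕ) {s : ℂ} (hs : 1 / 2 ≤ s.re) :
    Complex.exp (eulerLog N s) = ∏ p ∈ (N + 1).primesBelow, (1 - (p : ℂ) ^ (-s)) := by
  rw [eulerLog, Complex.exp_sum]
  refine Finset.prod_congr rfl fun p hp => Complex.exp_log ?_
  exact Complex.slitPlane_ne_zero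
    (one_sub_prime_cpow_neg_mem_slitPlane (Nat.prime_of_mem_primesBelow hp) hs)

lemma continuousOn_eulerLog (N : ℕ) (t : ℝ) :
    ContinuousOn (fun σ : ℝ => eulerLog N (σ + t * I)) (Icc (1 / 2) 3) := by
  refine continuousOn_finsetSum _ fun p hp => ?_
  have hpp := Nat.prime_of_mem_primesBelow hp
  refine ContinuousOn.clog ?_ fun σ hσ =>
    one_sub_prime_cpow_neg_mem_slitPlane hpp (by simpa using hσ.1)
  refine Continuous.continuousOn (continuous_const.sub ?_)
  refine Continuous.const_cpow (by fun_prop) (Or.inl ?_)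
  exact_mod_cast hpp.ne_zero

lemma norm_riemannZeta_mul_eulerProduct_sub_one_le {N : ℕ} (hN : 1 ≤ N) {s : ℂ} (hs : s.re = 3) :
    ‖riemannZeta s * ∏ p ∈ (N + 1).primesBelow, (1 - (p : ℂ) ^ (-s)) - 1‖ ≤
      ‖∏ p ∈ (N + 1).primesBelow, (1 - (p : ℂ) ^ (-s))‖ * (1 / (N : ℝ) ^ 2) := by
  classical
  have hs1 : 1 < s.re := by rw [hs]; norm_num
  have hs2 : 1 / 2 ≤ s.re := by rw [hs]; norm_num
  set F := ∏ p ∈ (N + 1).primesBelow, (1 - (p : ℂ) ^ (-s)) with hF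
  have hF0 : F ≠ 0 := by rw [hF, ← exp_eulerLog N hs2]; exact Complex.exp_ne_zero _
  have hprod := EulerProduct.prod_primesBelow_geometric_eq_tsum_smoothNumbers
    (f := (riemannZetaSummandHom (ne_zero_of_one_lt_re hs1) : ℕ →* ℂ))
    (summable_riemannZetaSummand hs1).of_norm (N + 1)
  have hFinv : F⁻¹ = ∑' n : (N + 1).smoothNumbers, ((n : ℕ) : ℂ) ^ (-s) := by
    rw [hF, ← Finset.prod_inv_distrib]
    exact hprod
  let d : ℕ → ℂ := fun n => if n ∈ (N + 1).smoothNumbers then 1 else 0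
  have hd : ∀ n, ‖d n‖ ≤ 1 := fun n => by
    simp only [d]; split_ifs <;> simp
  have hd' : ∀ n, ‖1 - d n‖ ≤ 1 := fun n => by
    simp only [d]; split_ifs <;> simp
  have hFinv2 : F⁻¹ = ∑' n : ℕ, d n * (n : ℂ) ^ (-s) := by
    rw [hFinv, tsum_subtype ((N + 1).smoothNumbers) (fun n : ℕ => (n : ℂ) ^ (-s))]
    refine tsum_congr fun n => ?_
    simp only [Set.indicator_apply, d]
    split_ifs <;> simp
  have hdiff : riemannZeta s - F⁻¹ = ∑' n : ℕ, (1 - d n) * (n : ℂ) ^ (-s) := by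
    rw [hFinv2, riemannZeta_eq_tsum_cpow_neg hs1,
      ← (summable_mul_natCast_cpow_neg (fun n => by simp) hs1).tsum_sub
        (summable_mul_natCast_cpow_neg hd hs1)]
    refine tsum_congr fun n => ?_
    rw [Pi.one_apply]
    ring
  have hzero : dpoly (Finset.Icc 1 N) (fun n => 1 - d n) s = 0 := by
    refine Finset.sum_eq_zero fun n hn => ?_
    have hn' := Finset.mem_Icc.1 hn
    have : n ∈ (N + 1).smoothNumbers :=
      Nat.mem_smoothNumbers_of_lt (by omega) (by omega)
    simp [d, this]
  have hnorm := norm_tsum_sub_dpoly_le hd' hs1 N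
  rw [hzero, sub_zero, ← hdiff, hs] at hnorm
  have heq : riemannZeta s * F - 1 = F * (riemannZeta s - F⁻¹) := by
    rw [mul_sub, mul_inv_cancel₀ hF0, mul_comm]
  rw [heq, norm_mul]
  gcongr
  exact hnorm.trans (tsum_rpow_neg_three_tail_le hN)

lemma eventually_log_log_sq_le {c : ℝ} (hc : 0 < c) :
    ∀ᶠ T : ℝ in atTop, Real.log (Real.log T) ^ 2 ≤ c * Real.log T := by
  have h : ∀ᶠ x : ℝ in atTop, Real.log x ^ 2 ≤ c * x := by
    filter_upwards [(Real.isLittleO_pow_log_id_atTop (n := 2)).bound hc, eventually_ge_atTop 0]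
      with x hx h0
    simpa [abs_of_nonneg h0] using hx
  exact Real.tendsto_log_atTop.eventually h

lemma floor_rpow_inv_facts {T : ℝ} {k : ℕ} (hT : 256 ≤ T) (hk : 1 ≤ k)
    (hkT : 8 * k ≤ Real.log T) :
    1 ≤ ⌊T ^ (1 / (4 * k) : ℝ)⌋₊ ∧ ⌊T ^ (1 / (4 * k) : ℝ)⌋₊ ^ k ≤ ⌊T ^ (1 / 4 : ℝ)⌋₊ ∧
      Real.log T / (8 * k) ≤ Real.log ⌊T ^ (1 / (4 * k) : ℝ)⌋₊ := by
  have hT0 : 0 < T := by linarith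
  have hk0 : (0 : ℝ) < k := by exact_mod_cast hk
  set x := T ^ (1 / (8 * k) : ℝ) with hx
  have hx0 : 0 < x := by positivity
  have hxx : T ^ (1 / (4 * k) : ℝ) = x ^ 2 := by
    rw [hx, ← Real.rpow_natCast, ← Real.rpow_mul hT0.le]
    congr 1
    push_cast
    field_simp
    norm_num
  have hlogx : Real.log x = Real.log T / (8 * k) := by
    rw [hx, Real.log_rpow hT0]
    ring
  have hx2 : 2 ≤ x := by
    have h1 : 1 ≤ Real.log x := by rwa [hlogx, one_le_div (by positivity)]
    have h2 := Real.exp_le_exp.2 h1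
    rw [Real.exp_log hx0] at h2
    linarith [Real.exp_one_gt_d9]
  rw [hxx]
  have h1 : (⌊x ^ 2⌋₊ : ℝ) ≤ x ^ 2 := Nat.floor_le (by positivity)
  have h2 : x ^ 2 < ⌊x ^ 2⌋₊ + 1 := Nat.lt_floor_add_one _
  have h3 : x ≤ ⌊x ^ 2⌋₊ := by nlinarith
  refine ⟨?_, ?_, ?_⟩
  · have : (1 : ℝ) ≤ ⌊x ^ 2⌋₊ := by linarith
    exact_mod_cast this
  · refine Nat.le_floor ?_
    push_cast
    calc (⌊x ^ 2⌋₊ : ℝ) ^ k ≤ (x ^ 2) ^ k := by gcongr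
      _ = T ^ (1 / 4 : ℝ) := by
        rw [← hxx, ← Real.rpow_natCast, ← Real.rpow_mul hT0.le]
        congr 1
        field_simp
  · rw [← hlogx]
    exact Real.log_le_log hx0 h3

/-- Off a small set, the Dirichlet polynomial `∑_{p ≤ N} p ^ (-s)` with `N` a suitable power of `T`
is `O(log log T)`. -/
lemma eventually_exists_exceptional_set_primes :
    ∀ᶠ T : ℝ in atTop, ∃ N : ℕ, 1 ≤ N ∧ (N + 1 : ℝ) ≤ T ∧
      Real.log T / (16 * Real.log (Real.log T)) ≤ Real.log N ∧
      ∃ E ⊆ Icc T (2 * T), MeasurableSet E ∧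
        volume.real E ≤ T / Real.log T ^ 6 ∧ ∀ t ∈ Icc T (2 * T) \ E,
          ∀ s : ℂ, s.re ∈ Icc (1 / 2) 3 → |s.im - t| ≤ Real.log T →
            ‖dpoly (N + 1).primesBelow (fun _ => 1) s‖ ≤
              4 * Real.exp 5 * Real.log (Real.log T) := by
  filter_upwards [eventually_sum_primesBelow_inv_le, eventually_ge_atTop 256,
    eventually_le_log_log 1, eventually_log_log_le (c := 1 / 16) (by norm_num),
    eventually_le_log (16 * Real.exp 2), eventually_log_le (c := 1 / 4) (by norm_num)]
    with T hprime hT hl hlL hLe hLT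
  set L := Real.log T with hL
  set l := Real.log L with hldef
  have hT0 : 0 < T := by linarith
  have hL0 : 0 < L := by linarith
  obtain ⟨k, hkdef⟩ : ∃ k, k = ⌈l⌉₊ := ⟨_, rfl⟩
  have hlk : l ≤ k := by rw [hkdef]; exact Nat.le_ceil l
  have hk2 : (k : ℝ) ≤ 2 * l := by
    have := Nat.ceil_lt_add_one (show 0 ≤ l by linarith)
    rw [hkdef]
    linarith
  have hk1 : 1 ≤ k := by
    have : (1 : ℝ) ≤ k := hl.trans hlk
    exact_mod_cast this
  have hk0 : (0 : ℝ) < k := by exact_mod_cast hk1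
  obtain ⟨hN1, hNk, hNlog⟩ := floor_rpow_inv_facts hT hk1 (by linarith)
  obtain ⟨-, -, hQ⟩ := floor_rpow_quarter_facts hT
  set N := ⌊T ^ (1 / (4 * k) : ℝ)⌋₊ with hN
  set Q := ⌊T ^ (1 / 4 : ℝ)⌋₊ with hQdef
  have hNQ : N ≤ Q := (Nat.le_self_pow (by omega) N).trans hNk
  have hQ1 : (1 : ℝ) ≤ Q := by exact_mod_cast hN1.trans hNQ
  have hNT : (N + 1 : ℝ) ≤ T := by
    have h1 : (N : ℝ) ≤ Q := by exact_mod_cast hNQ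
    have h2 := Real.log_nonneg hQ1
    nlinarith
  refine ⟨N, hN1, hNT, ?_, ?_⟩
  · refine le_trans ?_ hNlog
    exact div_le_div_of_nonneg_left hL0.le (by positivity) (by linarith)
  obtain ⟨s, c, hs, hc, hsum, hpow⟩ := exists_dpoly_eq_pow (A := (N + 1).primesBelow) (N := N)
    (fun p hp => Nat.prime_of_mem_primesBelow hp)
    (fun p hp => Nat.lt_succ_iff.1 (Nat.lt_of_mem_primesBelow hp)) k
  have hP := hprime (N + 1) (by push_cast; exact hNT)
  have hW : ∑ n ∈ s, ‖c n‖ ^ 2 / n ≤ (12 * l ^ 2) ^ k := by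
    calc ∑ n ∈ s, ‖c n‖ ^ 2 / n ≤ ∑ n ∈ s, (k.factorial : ℝ) * (‖c n‖ / n) := by
          refine Finset.sum_le_sum fun n hn => ?_
          rw [sq, mul_div_assoc]
          gcongr
          exact hc n hn
      _ = (k.factorial : ℝ) * ∑ n ∈ s, ‖c n‖ / n := (Finset.mul_sum _ _ _).symm
      _ ≤ (k : ℝ) ^ k * (∑ p ∈ (N + 1).primesBelow, 1 / (p : ℝ)) ^ k := by
          gcongr
          exact_mod_cast Nat.factorial_le_pow k
      _ ≤ (2 * l) ^ k * (6 * l) ^ k := by gcongr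
      _ = _ := by rw [← mul_pow]; congr 1; ring
  obtain ⟨E, hEs, hEm, hEv, hE⟩ := exists_exceptional_set_dpoly (fun n hn => (hs n hn).1) c
    (N := Q) (fun n hn => by exact_mod_cast (hs n hn).2.2.trans hNk) hQ1 hQ hW
    (V := (4 * Real.exp 5 * l) ^ k) (by positivity) (by linarith [Real.add_one_le_exp 2]) hLT
  refine ⟨E, hEs, hEm, hEv.trans ?_, ?_⟩
  · have hV : ((4 * Real.exp 5 * l) ^ k) ^ 2 = (12 * l ^ 2) ^ k * (4 / 3 * Real.exp 10) ^ k := by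
      rw [← mul_pow, ← pow_mul, mul_comm k 2, pow_mul]
      congr 1
      rw [show (10 : ℝ) = 5 + 5 by norm_num, Real.exp_add]
      ring
    have hge : L ^ 10 ≤ (4 / 3 * Real.exp 10) ^ k := by
      calc L ^ 10 = Real.exp (10 * l) := by
            rw [show (10 : ℝ) * l = ((10 : ℕ) : ℝ) * l by norm_num, Real.exp_nat_mul, hldef,
              Real.exp_log hL0]
        _ ≤ Real.exp (k * 10) := by rw [Real.exp_le_exp]; linarith
        _ = Real.exp 10 ^ k := Real.exp_nat_mul 10 k
        _ ≤ _ := by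
            gcongr
            linarith [Real.exp_pos 10]
    rw [hV, div_le_div_iff₀ (by positivity) (by positivity)]
    calc 16 * Real.exp 2 * T * L ^ 3 * (12 * l ^ 2) ^ k * L ^ 6
        = 16 * Real.exp 2 * (T * ((12 * l ^ 2) ^ k * L ^ 9)) := by ring
      _ ≤ L * (T * ((12 * l ^ 2) ^ k * L ^ 9)) := by gcongr
      _ = T * ((12 * l ^ 2) ^ k * L ^ 10) := by ring
      _ ≤ T * ((12 * l ^ 2) ^ k * (4 / 3 * Real.exp 10) ^ k) := by gcongr
  · intro t ht w hw1 hw2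
    have h := hE t ht w hw1 hw2
    rw [hpow, norm_pow] at h
    exact (pow_le_pow_iff_left₀ (norm_nonneg _) (by positivity) (by omega)).1 h

/-- Off a small set, `ζ` is well approximated to the right of the critical line by the exponential
of a function of size `O(log log T)`. -/
theorem eventually_exists_exceptional_set_riemannZeta_euler :
    ∃ B D : ℝ, 0 < B ∧ 0 < D ∧ ∀ᶠ T : ℝ in atTop, ∃ E ⊆ Icc T (2 * T), MeasurableSet E ∧
      volume.real E ≤ 3 * (T / Real.log T ^ 6) ∧ ∀ t ∈ Icc T (2 * T) \ E,
        (∀ s : ℂ, s.re ∈ Icc (1 / 2) 3 → |s.im - t| ≤ Real.log T →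
          ‖riemannZeta s‖ ≤ Real.log T ^ 8) ∧
        (∀ σ ∈ Icc (1 / 2 + 320 * Real.log (Real.log T) / Real.log T) 3,
          1 / Real.log T ^ 7 ≤ ‖riemannZeta (σ + t * I)‖) ∧
        ∃ G : ℝ → ℂ, ContinuousOn G (Icc (1 / 2) 3) ∧
          (∀ σ ∈ Icc (1 / 2 : ℝ) 3, ‖G σ‖ ≤ B * Real.log (Real.log T)) ∧
          ∀ σ ∈ Icc (1 / 2 + D * Real.log (Real.log T) ^ 2 / Real.log T : ℝ) 3,
            ‖riemannZeta (σ + t * I) * Complex.exp (G σ) - 1‖ ≤ 1 / 2 := by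
  set B := 4 * Real.exp 5 + 12 with hB
  have hB0 : 0 < B := by positivity
  refine ⟨B, 40 * (B + 10), hB0, by positivity, ?_⟩
  filter_upwards [eventually_exists_exceptional_set_riemannZeta_lower,
    eventually_exists_exceptional_set_primes, eventually_sum_primesBelow_inv_le,
    eventually_le_log_log 1, eventually_le_log (2 * Real.exp 7), eventually_le_log (B + 29),
    eventually_log_log_sq_le (c := 1 / (16 * (B + 10))) (by positivity), eventually_ge_atTop 256,
    eventually_log_le (c := 1 / 4) (by norm_num)]
    with T h₁ h₂ hprime hl hLe hLB hl2 hT hLT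
  obtain ⟨E₁, hE₁s, hE₁m, hE₁v, hE₁⟩ := h₁
  obtain ⟨N, hN1, hNT, hNlog, E₂, hE₂s, hE₂m, hE₂v, hE₂⟩ := h₂
  set L := Real.log T with hL
  set l := Real.log L with hldef
  have hT0 : 0 < T := by linarith
  have hL0 : 0 < L := by linarith
  have hL1 : 1 ≤ L := by linarith
  have hl0 : 0 < l := by linarith
  have hNpos : (0 : ℝ) < N := by exact_mod_cast hN1
  refine ⟨E₁ ∪ E₂, union_subset hE₁s hE₂s, hE₁m.union hE₂m, ?_, ?_⟩
  · linarith [measureReal_union_le (μ := volume) E₁ E₂]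
  intro t ht
  obtain ⟨hz, hlow⟩ := hE₁ t ⟨ht.1, fun h => ht.2 (Or.inl h)⟩
  have hP := hE₂ t ⟨ht.1, fun h => ht.2 (Or.inr h)⟩
  have hG : ∀ s : ℂ, s.re ∈ Icc (1 / 2) 3 → |s.im - t| ≤ L → ‖eulerLog N s‖ ≤ B * l := by
    intro s hs1 hs2
    have h1 := hprime (N + 1) (by push_cast; exact hNT)
    refine (norm_eulerLog_le N hs1.1).trans ?_
    rw [hB]
    linarith [hP s hs1 hs2]
  have hF : ∀ s : ℂ, s.re ∈ Icc (1 / 2) 3 → |s.im - t| ≤ L →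
      ‖∏ p ∈ (N + 1).primesBelow, (1 - (p : ℂ) ^ (-s))‖ ≤ L ^ B := by
    intro s hs1 hs2
    rw [← exp_eulerLog N hs1.1, Complex.norm_exp, Real.rpow_def_of_pos hL0, Real.exp_le_exp,
      mul_comm]
    exact (Complex.re_le_norm _).trans (hG s hs1 hs2)
  have hmem : ∀ σ : ℝ, ((σ : ℂ) + t * I).re = σ := fun σ => by simp
  have him : ∀ σ : ℝ, |((σ : ℂ) + t * I).im - t| ≤ L := fun σ => by simpa using hL0.le
  refine ⟨hz, hlow, fun σ => eulerLog N (σ + t * I), continuousOn_eulerLog N t, ?_, ?_⟩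
  · intro σ hσ
    exact hG _ (by rwa [hmem]) (him σ)
  · intro σ hσ
    have hlam : 0 ≤ 40 * (B + 10) * l ^ 2 / L := by positivity
    rw [exp_eulerLog N (by rw [hmem]; linarith [hσ.1])]
    refine norm_le_half_of_log_bounds
      (g := fun s => riemannZeta s * ∏ p ∈ (N + 1).primesBelow, (1 - (p : ℂ) ^ (-s)) - 1)
      (L := L) (X := N) (b := B + 9) (lam := 40 * (B + 10) * l ^ 2 / L) (by linarith [ht.1.1]) ?_
      (by linarith) hlam ?_ ?_ ?_ ?_ hLe (by linarith) ?_ hσ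
    · intro w hw
      refine ((differentiableAt_riemannZeta (ne_one_of_im_ne_zero hw.ne')).mul ?_).sub_const _
      refine DifferentiableAt.fun_finsetProd fun p hp => (differentiableAt_const _).sub ?_
      refine DifferentiableAt.const_cpow differentiableAt_id.neg (Or.inl ?_)
      exact_mod_cast (Nat.prime_of_mem_primesBelow hp).ne_zero
    · intro s hs1 hs2
      have h1 : (1 : ℝ) ≤ L ^ (B + 8) := Real.one_le_rpow hL1 (by linarith)
      calc _ ≤ ‖riemannZeta s * ∏ p ∈ (N + 1).primesBelow, (1 - (p : ℂ) ^ (-s))‖ + ‖(1 : ℂ)‖ :=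
            norm_sub_le _ _
        _ ≤ L ^ 8 * L ^ B + L ^ (B + 8) := by
            rw [norm_mul, norm_one]
            exact add_le_add (mul_le_mul (hz s hs1 hs2) (hF s hs1 hs2) (norm_nonneg _)
              (by positivity)) h1
        _ = 2 * L ^ (B + 8) := by
            have h8 : L ^ (B + 8) = L ^ B * L ^ 8 := by
              rw [Real.rpow_add hL0 B 8]
              norm_cast
            rw [h8]
            ring
        _ ≤ L * L ^ (B + 8) := by
            gcongr
            linarith
        _ = L ^ (B + 9) := by
            rw [show B + 9 = B + 8 + 1 by ring, Real.rpow_add_one hL0.ne']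
            ring
    · intro s hs1 hs2
      refine (norm_riemannZeta_mul_eulerProduct_sub_one_le hN1 hs1).trans ?_
      rw [mul_one_div]
      refine div_le_div_of_nonneg_right ?_ (by positivity)
      refine (hF s ⟨by rw [hs1]; norm_num, hs1.le⟩ hs2).trans ?_
      exact Real.rpow_le_rpow_of_exponent_le hL1 (by linarith)
    · rw [Real.rpow_def_of_pos hL0, ← Real.le_log_iff_exp_le hNpos]
      refine le_trans ?_ hNlog
      rw [le_div_iff₀ (by positivity)]
      rw [one_div_mul_eq_div, le_div_iff₀ (by positivity)] at hl2
      rw [← hldef]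
      linarith
    · rw [hL, Real.exp_log hT0]
      linarith
    · calc (B + 9 + 1) * l = 40 * (B + 10) * l ^ 2 / L * (2 / 5 * (L / (16 * l))) := by
            field_simp
            ring
        _ ≤ _ := by gcongr

lemma sub_eq_sub_of_exp_eq_exp {s : Set ℝ} (hs : IsPreconnected s) {f g : ℝ → ℂ}
    (hf : ContinuousOn f s) (hg : ContinuousOn g s)
    (h : ∀ x ∈ s, Complex.exp (f x) = Complex.exp (g x)) {x y : ℝ} (hx : x ∈ s) (hy : y ∈ s) :
    f x - g x = f y - g y := by
  have hd : IsDiscrete (range ((↑) : ℤ → ℝ)) :=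
    Int.isClosedEmbedding_coe_real.toIsEmbedding.isDiscrete_range
  have hpi : (π : ℂ) ≠ 0 := by exact_mod_cast Real.pi_ne_zero
  have hform : ∀ x ∈ s, ∃ n : ℤ, f x - g x = n * (2 * π * I) := fun x hx => by
    obtain ⟨n, hn⟩ := Complex.exp_eq_exp_iff_exists_int.1 (h x hx)
    exact ⟨n, by rw [hn]; ring⟩
  have him : ∀ n : ℤ, ((n : ℂ) * (2 * π * I)).im / (2 * π) = n := fun n => by
    have : (n : ℂ) * (2 * π * I) = ((n * (2 * π) : ℝ) : ℂ) * I := by push_cast; ring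
    rw [this]
    simp only [Complex.mul_im, Complex.ofReal_re, Complex.I_im, Complex.ofReal_im, Complex.I_re,
      mul_one, mul_zero, add_zero]
    field_simp
  have hc : ContinuousOn (fun x => (f x - g x).im / (2 * π)) s :=
    (Complex.continuous_im.comp_continuousOn (hf.sub hg)).div_const _
  have hmaps : MapsTo (fun x => (f x - g x).im / (2 * π)) s (range ((↑) : ℤ → ℝ)) := fun x hx => by
    obtain ⟨n, hn⟩ := hform x hx
    exact ⟨n, by simp only [hn, him]⟩
  have heq := hs.constant_of_mapsTo hd hc hmaps hx hy
  obtain ⟨n, hn⟩ := hform x hx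
  obtain ⟨m, hm⟩ := hform y hy
  simp only [hn, hm, him] at heq
  rw [hn, hm]
  have : n = m := by exact_mod_cast heq
  rw [this]

lemma norm_riemannZeta_two_sub_one_lt {s : ℂ} (hs : s.re = 2) : ‖riemannZeta s - 1‖ < 1 := by
  have hs1 : 1 < s.re := by rw [hs]; norm_num
  have h1 := norm_tsum_sub_dpoly_le (c := 1) (fun n => by simp) hs1 1
  rw [← riemannZeta_eq_tsum_cpow_neg hs1, hs] at h1
  have h2 : dpoly (Finset.Icc 1 1) 1 s = 1 := by simp [dpoly]
  rw [h2] at h1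
  refine h1.trans_lt ?_
  have h3 := (hasSum_zeta_two.summable.sum_add_tsum_nat_add 2)
  rw [hasSum_zeta_two.tsum_eq] at h3
  have h4 : ∑' n : ℕ, ((n + (1 + 1) : ℕ) : ℝ) ^ (-2 : ℝ) =
      ∑' n : ℕ, 1 / ((n + 2 : ℕ) : ℝ) ^ 2 := by
    refine tsum_congr fun n => ?_
    rw [Real.rpow_neg (by positivity), one_div]
    norm_cast
  rw [h4]
  have h5 : ∑ i ∈ Finset.range 2, 1 / (i : ℝ) ^ 2 = 1 := by simp [Finset.sum_range_succ]
  rw [h5] at h3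
  have : π ^ 2 < 12 := by nlinarith [Real.pi_lt_d2, Real.pi_pos]
  linarith

/-- The argument of `ζ` along the horizontal segment from `2 + it` to `1/2 + it`. -/
lemma IsS.exists_arg {S : ℝ → ℝ} (hS : IsS S) {t : ℝ} (ht : 0 < t)
    (hz : ∀ σ : ℝ, 1 / 2 ≤ σ → σ ≤ 2 → riemannZeta (σ + t * I) ≠ 0) :
    ∃ φ : ℝ → ℂ, ContinuousOn φ (Icc (1 / 2) 2) ∧
      (∀ σ ∈ Icc (1 / 2 : ℝ) 2, Complex.exp (φ σ) = riemannZeta (σ + t * I)) ∧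
      |(φ 2).im| ≤ π / 2 ∧ S t = (φ (1 / 2)).im / π := by
  obtain ⟨θ, hθc, hθ0, hθ1, hθ2, hSt⟩ := hS.1 t ht hz
  have hre : ∀ u : ℝ, ((2 : ℂ) + u * t * I).re = 2 := fun u => by simp
  have hslit : ∀ u : ℝ, riemannZeta (2 + u * t * I) ∈ slitPlane := fun u => by
    have := norm_riemannZeta_two_sub_one_lt (hre u)
    have h := Complex.mem_slitPlane_of_norm_lt_one this
    rwa [add_sub_cancel] at h
  have hlogc : ContinuousOn (fun u : ℝ => Complex.log (riemannZeta (2 + u * t * I))) (Icc 0 1) := by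
    refine ContinuousOn.clog ?_ fun u _ => hslit u
    intro u _
    refine (ContinuousAt.comp (g := riemannZeta) (f := fun u : ℝ => (2 : ℂ) + u * t * I) (x := u)
      (differentiableAt_riemannZeta ?_).continuousAt (by fun_prop)).continuousWithinAt
    intro h
    have := congrArg Complex.re h
    rw [hre] at this
    norm_num at this
  have heq := sub_eq_sub_of_exp_eq_exp isPreconnected_Icc
    (hθc.mono (Icc_subset_Icc_right (by norm_num))) hlogc
    (fun u hu => by rw [hθ1 u hu, Complex.exp_log (Complex.slitPlane_ne_zero (hslit u))])
    (x := 1) (y := 0) ⟨zero_le_one, le_rfl⟩ ⟨le_rfl, zero_le_one⟩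
  rw [hθ0] at heq
  simp only [Complex.ofReal_zero, zero_mul, add_zero, sub_self] at heq
  have hθ1' : |(θ 1).im| ≤ π / 2 := by
    rw [sub_eq_zero.1 heq, Complex.log_im, Complex.abs_arg_le_pi_div_two_iff]
    have h1 := norm_riemannZeta_two_sub_one_lt (hre 1)
    have h2 := (Complex.abs_re_le_norm _).trans_lt h1
    rw [Complex.sub_re, Complex.one_re] at h2
    linarith [(abs_lt.1 h2).1]
  refine ⟨fun σ => θ (1 + (2 - σ) * (2 / 3)), ?_, ?_, ?_, ?_⟩
  · refine hθc.comp (by fun_prop) fun σ hσ => ⟨?_, ?_⟩ <;> linarith [hσ.1, hσ.2]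
  · intro σ hσ
    rw [hθ2 _ ⟨by linarith [hσ.2], by linarith [hσ.1]⟩]
    congr 1
    push_cast
    ring
  · norm_num
    exact hθ1'
  · rw [hSt]
    norm_num

lemma abs_im_arg_sub_le {φ : ℝ → ℂ} {t c r L a : ℝ} (hφc : ContinuousOn φ (Icc (1 / 2) 2))
    (hφ : ∀ σ ∈ Icc (1 / 2 : ℝ) 2, Complex.exp (φ σ) = riemannZeta (σ + t * I)) (hr : 0 < r)
    (hc : 1 / 2 ≤ c - r) (hc2 : c ≤ 2) (hrt : 2 * r < t) (ha : 0 ≤ a) (hL : 1 ≤ L)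
    (hl : 1 ≤ Real.log L)
    (hb : ∀ z : ℂ, z.re ∈ Icc (c - 2 * r) (c + 2 * r) → |z.im - t| ≤ 2 * r →
      ‖riemannZeta z‖ ≤ L ^ a) (hlow : 1 / L ^ 7 ≤ ‖riemannZeta (c + t * I)‖) :
    |(φ (c - r)).im - (φ c).im| ≤ (5 * a + 39) * Real.log L := by
  have hL0 : 0 < L := by linarith
  have hball : ∀ z ∈ Metric.closedBall (c + t * I : ℂ) (2 * r),
      |z.re - c| ≤ 2 * r ∧ |z.im - t| ≤ 2 * r := by
    intro z hz
    rw [mem_closedBall_iff_norm] at hz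
    have h1 := (Complex.abs_re_le_norm _).trans hz
    have h2 := (Complex.abs_im_le_norm _).trans hz
    simp only [Complex.sub_re, Complex.add_re, Complex.ofReal_re, Complex.mul_re, Complex.I_re,
      mul_zero, Complex.ofReal_im, Complex.I_im, mul_one, sub_self, add_zero, Complex.sub_im,
      Complex.add_im, Complex.mul_im, zero_add] at h1 h2
    exact ⟨h1, h2⟩
  have hsub : Icc (c - r) c ⊆ Icc (1 / 2) 2 := Icc_subset_Icc hc hc2
  have key := abs_im_sub_im_le_of_analyticOnNhd (f := riemannZeta) (θ := φ) (c := c) (t := t)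
    (r := r) (R := 2 * r) (M := L ^ a) hr (by linarith) (Real.one_le_rpow hL ha)
    (fun z hz => analyticOn_riemannZeta z
      (ne_one_of_im_ne_zero (by linarith [(abs_le.1 (hball z hz).2).1] : 0 < z.im).ne'))
    (fun z hz => by
      obtain ⟨h1, h2⟩ := hball z hz
      exact hb z ⟨by linarith [(abs_le.1 h1).1], by linarith [(abs_le.1 h1).2]⟩ h2)
    (hφc.mono hsub) (fun x hx => hφ x (hsub hx)) (x := c - r) ⟨le_rfl, by linarith⟩
  refine key.trans ?_
  have hlow0 : 0 < ‖riemannZeta (c + t * I)‖ := lt_of_lt_of_le (by positivity) hlow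
  have hlog : Real.log (L ^ a / ‖riemannZeta (c + t * I)‖) ≤ (a + 7) * Real.log L := by
    rw [Real.log_div (by positivity) hlow0.ne', Real.log_rpow hL0]
    have h1 := Real.log_le_log (by positivity) hlow
    rw [one_div, Real.log_inv, Real.log_pow] at h1
    push_cast at h1
    linarith
  rw [mul_div_assoc, div_self hr.ne', mul_one]
  have h2 := Real.log_two_gt_d9
  have hpi := Real.pi_lt_d2
  have h2' : π / Real.log 2 ≤ 5 := by
    rw [div_le_iff₀ (by linarith)]
    linarith
  calc π * (Real.log (L ^ a / ‖riemannZeta (c + t * I)‖) / Real.log 2 + 1)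
      ≤ π * ((a + 7) * Real.log L / Real.log 2 + 1) := by
        have := Real.pi_pos
        gcongr
    _ = π / Real.log 2 * ((a + 7) * Real.log L) + π := by ring
    _ ≤ 5 * ((a + 7) * Real.log L) + 4 * Real.log L :=
        add_le_add (mul_le_mul_of_nonneg_right h2' (by positivity)) (by linarith)
    _ = _ := by ring

lemma abs_im_arg_dyadic_le {φ : ℝ → ℂ} {t L lam : ℝ} (hφc : ContinuousOn φ (Icc (1 / 2) 2))
    (hφ : ∀ σ ∈ Icc (1 / 2 : ℝ) 2, Complex.exp (φ σ) = riemannZeta (σ + t * I)) (hlam : 0 < lam)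
    (hL : 1 ≤ L) (hl : 1 ≤ Real.log L) (ht : 2 ≤ t)
    (hb : ∀ s : ℂ, s.re ∈ Icc (1 / 2) 3 → |s.im - t| ≤ L → ‖riemannZeta s‖ ≤ L ^ 8)
    (hlow : ∀ σ ∈ Icc (1 / 2 + lam) 3, 1 / L ^ 7 ≤ ‖riemannZeta (σ + t * I)‖) (J : ℕ)
    (hJ : 2 ^ J * lam ≤ 1) :
    |(φ (1 / 2 + lam)).im| ≤ |(φ (1 / 2 + 2 ^ J * lam)).im| + J * (79 * Real.log L) := by
  induction J with
  | zero => simp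
  | succ J ih =>
    rw [pow_succ] at hJ ⊢
    have hp : (1 : ℝ) ≤ 2 ^ J := one_le_pow₀ (by norm_num)
    set μ := 2 ^ J * lam with hμ
    have hμ0 : 0 < μ := by positivity
    have hμlam : lam ≤ μ := le_mul_of_one_le_left hlam.le hp
    rw [show (2 : ℝ) ^ J * 2 * lam = 2 * μ by rw [hμ]; ring] at hJ ⊢
    have h1 := ih (by linarith)
    have h2 := abs_im_arg_sub_le (c := 1 / 2 + 2 * μ) (r := μ) (a := 8) hφc hφ hμ0 (by linarith)
      (by linarith) (by linarith) (by norm_num) hL hl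
      (fun z hz1 hz2 => by
        refine (hb z ⟨by linarith [hz1.1], by linarith [hz1.2]⟩ (by linarith)).trans (le_of_eq ?_)
        norm_cast)
      (by exact_mod_cast hlow (1 / 2 + 2 * μ) ⟨by linarith, by linarith⟩)
    rw [show 1 / 2 + 2 * μ - μ = 1 / 2 + μ by ring] at h2
    have h3 := abs_sub_abs_le_abs_sub (φ (1 / 2 + μ)).im (φ (1 / 2 + 2 * μ)).im
    push_cast
    linarith

lemma abs_im_arg_le_of_exp_approx {φ G : ℝ → ℂ} {t b σ : ℝ}
    (hφc : ContinuousOn φ (Icc (1 / 2) 2))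
    (hφ : ∀ σ ∈ Icc (1 / 2 : ℝ) 2, Complex.exp (φ σ) = riemannZeta (σ + t * I))
    (hφ2 : |(φ 2).im| ≤ π / 2) (hGc : ContinuousOn G (Icc (1 / 2) 3))
    (hG : ∀ σ ∈ Icc (1 / 2 : ℝ) 3, ‖G σ‖ ≤ b) (hσ : σ ∈ Icc (1 / 2) 2)
    (happ : ∀ x ∈ Icc σ 3, ‖riemannZeta (x + t * I) * Complex.exp (G x) - 1‖ ≤ 1 / 2) :
    |(φ σ).im| ≤ 3 * (π / 2) + 2 * b := by
  have hsub : Icc σ 2 ⊆ Icc (1 / 2) 2 := Icc_subset_Icc_left hσ.1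
  have hsub3 : Icc σ 2 ⊆ Icc σ 3 := Icc_subset_Icc_right (by norm_num)
  have hsub3' : Icc σ 2 ⊆ Icc (1 / 2) 3 := Icc_subset_Icc hσ.1 (by norm_num)
  have hfc : ContinuousOn (fun x => φ x + G x) (Icc σ 2) := (hφc.mono hsub).add (hGc.mono hsub3')
  have hexp : ∀ x ∈ Icc σ 2, Complex.exp (φ x + G x) =
      riemannZeta (x + t * I) * Complex.exp (G x) := fun x hx => by
    rw [Complex.exp_add, hφ x (hsub hx)]
  have hnear : ∀ x ∈ Icc σ 2, ‖Complex.exp (φ x + G x) - 1‖ ≤ 1 / 2 := fun x hx => by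
    rw [hexp x hx]
    exact happ x (hsub3 hx)
  have hslit : ∀ x ∈ Icc σ 2, Complex.exp (φ x + G x) ∈ slitPlane := fun x hx => by
    have h := Complex.mem_slitPlane_of_norm_lt_one ((hnear x hx).trans_lt (by norm_num))
    rwa [add_sub_cancel] at h
  have hlogc : ContinuousOn (fun x => Complex.log (Complex.exp (φ x + G x))) (Icc σ 2) :=
    ContinuousOn.clog (Complex.continuous_exp.comp_continuousOn hfc) hslit
  have hlog : ∀ x ∈ Icc σ 2, |(Complex.log (Complex.exp (φ x + G x))).im| ≤ π / 2 :=
    fun x hx => by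
      rw [Complex.log_im, Complex.abs_arg_le_pi_div_two_iff]
      have h2 := (Complex.abs_re_le_norm _).trans (hnear x hx)
      rw [Complex.sub_re, Complex.one_re] at h2
      linarith [(abs_le.1 h2).1]
  have h2mem : (2 : ℝ) ∈ Icc σ 2 := ⟨hσ.2, le_rfl⟩
  have hσmem : σ ∈ Icc σ 2 := ⟨le_rfl, hσ.2⟩
  have heq := congrArg Complex.im (sub_eq_sub_of_exp_eq_exp isPreconnected_Icc hfc hlogc
    (fun x _ => (Complex.exp_log (Complex.exp_ne_zero _)).symm) hσmem h2mem)
  simp only [Complex.sub_im, Complex.add_im] at heq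
  have h1 := abs_le.1 (hlog σ hσmem)
  have h2 := abs_le.1 (hlog 2 h2mem)
  have h3 := abs_le.1 ((Complex.abs_im_le_norm _).trans (hG σ (hsub3' hσmem)))
  have h4 := abs_le.1 ((Complex.abs_im_le_norm _).trans (hG 2 (hsub3' h2mem)))
  have h5 := abs_le.1 hφ2
  rw [abs_le]
  constructor <;> linarith [h1.1, h1.2, h2.1, h2.2, h3.1, h3.2, h4.1, h4.2, h5.1, h5.2]

lemma eventually_mul_le_two_pow_floor_sqrt {D : ℝ} (hD : 0 < D) :
    ∀ᶠ l : ℝ in atTop, D * l ≤ 2 ^ ⌊√l⌋₊ := by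
  have h1 : ∀ᶠ n : ℕ in atTop, D * ((n : ℝ) + 1) ^ 2 ≤ 2 ^ n := by
    filter_upwards [(isLittleO_pow_const_const_pow_of_one_lt (R := ℝ) 2
      (by norm_num : (1 : ℝ) < 2)).bound (show 0 < 1 / (4 * D) by positivity),
      eventually_ge_atTop 1] with n hn hn1
    rw [Real.norm_of_nonneg (by positivity), Real.norm_of_nonneg (by positivity),
      one_div_mul_eq_div, le_div_iff₀ (by positivity)] at hn
    have hn1' : (1 : ℝ) ≤ n := by exact_mod_cast hn1
    calc D * ((n : ℝ) + 1) ^ 2 ≤ D * (n + n) ^ 2 := by gcongr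
      _ = n ^ 2 * (4 * D) := by ring
      _ ≤ _ := hn
  have h2 : Tendsto (fun l : ℝ => ⌊√l⌋₊) atTop atTop :=
    tendsto_nat_floor_atTop.comp Real.tendsto_sqrt_atTop
  filter_upwards [h2.eventually h1, eventually_ge_atTop 0] with l hl h0
  refine le_trans ?_ hl
  gcongr
  calc l = √l ^ 2 := (Real.sq_sqrt h0).symm
    _ ≤ _ := by
      gcongr
      exact (Nat.lt_floor_add_one _).le

/-- Off a small set, `S(t) = O((log log T) ^ (3 / 2))` on `[T, 2T]`. -/
theorem exists_exceptional_set_abs_S_le :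
    ∃ C : ℝ, 0 < C ∧ ∀ᶠ T : ℝ in atTop, ∃ E ⊆ Icc T (2 * T), MeasurableSet E ∧
      volume.real E ≤ T / Real.log T ^ 5 ∧ ∀ S : ℝ → ℝ, IsS S → ∀ t ∈ Icc T (2 * T) \ E,
        (∀ σ : ℝ, 1 / 2 ≤ σ → σ ≤ 2 → riemannZeta (σ + t * I) ≠ 0) →
        |S t| ≤ C * (Real.log (Real.log T) * √(Real.log (Real.log T))) := by
  obtain ⟨B, D, hB, hD, hE⟩ := eventually_exists_exceptional_set_riemannZeta_euler
  refine ⟨2 * B + 3500, by positivity, ?_⟩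
  filter_upwards [hE, eventually_exists_exceptional_set_riemannZeta (C₁ := 320) (by norm_num),
    (Real.tendsto_log_atTop.comp Real.tendsto_log_atTop).eventually
      (eventually_mul_le_two_pow_floor_sqrt hD), eventually_le_log_log 4,
    eventually_log_log_sq_le (c := 1 / 320 ^ 2) (by norm_num),
    eventually_log_log_le (c := 1 / 1000) (by norm_num), eventually_le_log 4,
    eventually_ge_atTop 4] with T h₁ h₂ hJ1 hl4 hl2 hlL hL4 hT4
  obtain ⟨E₁, hE₁s, hE₁m, hE₁v, hE₁⟩ := h₁
  obtain ⟨E₂, hE₂s, hE₂m, hE₂v, hE₂⟩ := h₂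
  simp only [Function.comp_apply] at hJ1
  set L := Real.log T with hL
  set l := Real.log L with hldef
  have hL0 : 0 < L := by linarith
  have hl0 : 0 < l := by linarith
  refine ⟨E₁ ∪ E₂, union_subset hE₁s hE₂s, hE₁m.union hE₂m, ?_, ?_⟩
  · have h : volume.real (E₁ ∪ E₂) ≤ 4 * (T / L ^ 6) := by
      linarith [measureReal_union_le (μ := volume) E₁ E₂]
    refine h.trans ?_
    rw [mul_div_assoc', div_le_div_iff₀ (by positivity) (by positivity)]
    calc 4 * T * L ^ 5 ≤ L * T * L ^ 5 := by gcongr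
      _ = T * L ^ 6 := by ring
  intro S hS t ht hnz
  obtain ⟨hz, hlow, G, hGc, hG, happ⟩ := hE₁ t ⟨ht.1, fun h => ht.2 (Or.inl h)⟩
  have hz2 := hE₂ t ⟨ht.1, fun h => ht.2 (Or.inr h)⟩
  have htT : T ≤ t := ht.1.1
  obtain ⟨φ, hφc, hφ, hφ2, hSt⟩ := hS.exists_arg (by linarith) hnz
  obtain ⟨lam, hlam⟩ : ∃ lam, lam = 320 * l / L := ⟨_, rfl⟩
  have hlam0 : 0 < lam := by rw [hlam]; positivity
  have hlam1 : lam ≤ 1 / 2 := by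
    rw [hlam, div_le_iff₀ hL0]
    linarith
  rw [← hlam] at hlow hz2
  set J := ⌊√l⌋₊ with hJ
  have hJle : (J : ℝ) ≤ √l := Nat.floor_le (Real.sqrt_nonneg l)
  have hsl : √l ^ 2 = l := Real.sq_sqrt hl0.le
  have hsl2 : 2 ≤ √l := Real.le_sqrt_of_sq_le (by linarith)
  have hJ2 : (2 : ℝ) ^ J * lam ≤ 1 := by
    have h1 : ((2 : ℝ) ^ J) ^ 2 ≤ L := by
      calc ((2 : ℝ) ^ J) ^ 2 ≤ (Real.exp 1 ^ J) ^ 2 := by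
            gcongr
            linarith [Real.exp_one_gt_d9]
        _ = Real.exp (2 * J) := by
            rw [← Real.exp_nat_mul, ← Real.exp_nat_mul]
            push_cast
            ring_nf
        _ ≤ Real.exp l := by
            rw [Real.exp_le_exp]
            nlinarith
        _ = L := Real.exp_log hL0
    have h2 : (320 * l) ^ 2 ≤ L := by linarith
    rw [hlam, mul_div_assoc', div_le_one hL0]
    nlinarith [sq_nonneg ((2 : ℝ) ^ J - 320 * l)]
  have hσ : 1 / 2 + D * l ^ 2 / L ≤ 1 / 2 + 2 ^ J * lam := by
    rw [hlam, mul_div_assoc']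
    refine add_le_add le_rfl (div_le_div_of_nonneg_right ?_ hL0.le)
    calc D * l ^ 2 = D * l * l := by ring
      _ ≤ 2 ^ J * l := by gcongr
      _ ≤ 2 ^ J * (320 * l) := by gcongr; linarith
  have hp : 0 < (2 : ℝ) ^ J * lam := by positivity
  have s1 := abs_im_arg_le_of_exp_approx hφc hφ hφ2 hGc hG (σ := 1 / 2 + 2 ^ J * lam)
    ⟨by linarith, by linarith⟩ fun x hx => happ x ⟨hσ.trans hx.1, hx.2⟩
  have s2 := abs_im_arg_dyadic_le hφc hφ hlam0 (by linarith : 1 ≤ L) (by linarith) (by linarith)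
    hz hlow J hJ2
  have s3 := abs_im_arg_sub_le (c := 1 / 2 + lam) (r := lam) (a := 8 + 2 * 320) (L := L) hφc hφ
    hlam0 (by linarith) (by linarith) (by linarith) (by norm_num) (by linarith) (by linarith)
    (fun z hz1 hzi => hz2 z ⟨by linarith [hz1.1], by linarith [hz1.2]⟩ (by linarith))
    (by exact_mod_cast hlow (1 / 2 + lam) ⟨le_rfl, by linarith⟩)
  rw [add_sub_cancel_right] at s3
  have s4 := abs_sub_abs_le_abs_sub (φ (1 / 2)).im (φ (1 / 2 + lam)).im
  have hpi := Real.pi_lt_d2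
  have hpi3 := Real.pi_gt_three
  have hJl : (J : ℝ) * (79 * l) ≤ 79 * (l * √l) := by
    calc (J : ℝ) * (79 * l) ≤ √l * (79 * l) := by gcongr
      _ = _ := by ring
  have hls : l * 2 ≤ l * √l := by gcongr
  have hBl : B * (l * 2) ≤ B * (l * √l) := by gcongr
  rw [← hldef] at s2 s3
  have hBl0 : 0 < B * l := by positivity
  have htot : |(φ (1 / 2)).im| ≤ (2 * B + 3500) * (l * √l) := by
    linarith
  rw [hSt, abs_div, abs_of_pos Real.pi_pos]
  exact (div_le_self (abs_nonneg _) (by linarith)).trans htot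

lemma exists_norm_riemannZeta_le_of_large_im :
    ∃ C T₀ : ℝ, 0 < C ∧ ∀ s : ℂ, s.re ∈ Icc (1 / 4) 3 → T₀ ≤ s.im →
      ‖riemannZeta s‖ ≤ C * s.im ^ 2 := by
  obtain ⟨C, T₀, hC, hT₀, h⟩ := exists_integral_norm_riemannZeta_sq_le
  refine ⟨8 * C + 1, T₀, by positivity, fun s hs ht => ?_⟩
  set t := s.im with htdef
  have ht3 : 3 ≤ t := hT₀.trans ht
  have ht0 : 0 < t := by linarith
  have hr : (0 : ℝ) < 1 / 8 := by norm_num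
  have h1 := norm_sq_le_integral_square (f := riemannZeta) (z := s) hr fun w _ hw =>
    differentiableAt_riemannZeta
      (ne_one_of_im_ne_zero (by linarith [hw.1] : 0 < w.im).ne')
  have hinner : ∀ x ∈ uIoc (s.re - 1 / 8) (s.re + 1 / 8),
      ‖∫ y in (s.im - 1 / 8)..(s.im + 1 / 8), ‖riemannZeta (x + y * I)‖ ^ 2‖ ≤ C * t ^ 3 := by
    intro x hx
    rw [uIoc_of_le (by linarith)] at hx
    have hx0 : 1 / 8 ≤ x := by linarith [hx.1, hs.1]
    rw [Real.norm_of_nonneg (intervalIntegral.integral_nonneg (by linarith)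
      fun y _ => by positivity)]
    have hmono : ∫ y in (s.im - 1 / 8)..(s.im + 1 / 8), ‖riemannZeta (x + y * I)‖ ^ 2 ≤
        ∫ y in (t / 2)..(3 * t), ‖riemannZeta (x + y * I)‖ ^ 2 := by
      refine intervalIntegral.integral_mono_interval (by linarith) (by linarith) (by linarith)
        (Eventually.of_forall fun y => by positivity) ?_
      refine ContinuousOn.intervalIntegrable ?_
      rw [uIcc_of_le (by linarith)]
      exact (continuousOn_line_riemannZeta x (by linarith)).norm.pow 2
    refine hmono.trans ((h t ht x (by linarith)).trans ?_)
    have hpow : (t ^ (max (1 / 2 - x) 0)) ^ 2 ≤ t := by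
      rw [← Real.rpow_natCast, ← Real.rpow_mul ht0.le]
      calc t ^ (max (1 / 2 - x) 0 * ((2 : ℕ) : ℝ)) ≤ t ^ (1 : ℝ) := by
            refine Real.rpow_le_rpow_of_exponent_le (by linarith) ?_
            have : max (1 / 2 - x) 0 ≤ 1 / 2 := max_le (by linarith) (by norm_num)
            push_cast
            linarith
        _ = t := Real.rpow_one t
    have hlog : Real.log t ≤ t := (Real.log_le_sub_one_of_pos ht0).trans (by linarith)
    calc C * (t * Real.log t) * (t ^ (max (1 / 2 - x) 0)) ^ 2 ≤ C * (t * t) * t := by gcongr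
      _ = C * t ^ 3 := by ring
  have h2 := intervalIntegral.norm_integral_le_of_norm_le_const hinner
  have h3 := h1.trans ((le_abs_self _).trans h2)
  rw [show s.re + 1 / 8 - (s.re - 1 / 8) = 1 / 4 by ring,
    abs_of_pos (by norm_num : (0 : ℝ) < 1 / 4)] at h3
  have h4 : ‖riemannZeta s‖ ^ 2 ≤ 8 * C * t ^ 3 := by
    have := Real.pi_gt_three
    have hn : 0 ≤ ‖riemannZeta s‖ ^ 2 := by positivity
    nlinarith
  refine (pow_le_pow_iff_left₀ (norm_nonneg _) (by positivity) two_ne_zero).1 ?_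
  calc ‖riemannZeta s‖ ^ 2 ≤ 8 * C * t ^ 3 := h4
    _ ≤ (8 * C + 1) ^ 2 * t ^ 4 := by
        gcongr
        · nlinarith
        · linarith
        · norm_num
    _ = _ := by ring

/-- A crude polynomial bound for `ζ` to the right of the line `Re s = 1/4`. -/
lemma exists_norm_riemannZeta_le_sq :
    ∃ C : ℝ, 1 ≤ C ∧ ∀ s : ℂ, s.re ∈ Icc (1 / 4) 3 → 1 / 10 ≤ s.im →
      ‖riemannZeta s‖ ≤ C * (s.im + 1) ^ 2 := by
  obtain ⟨C₁, T₀, hC₁, h₁⟩ := exists_norm_riemannZeta_le_of_large_im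
  have hK : IsCompact (Icc (1 / 4 : ℝ) 3 ×ℂ Icc (1 / 10 : ℝ) T₀) :=
    isCompact_Icc.reProdIm isCompact_Icc
  have hcont : ContinuousOn riemannZeta (Icc (1 / 4 : ℝ) 3 ×ℂ Icc (1 / 10 : ℝ) T₀) := fun s hs =>
    (differentiableAt_riemannZeta (ne_one_of_im_ne_zero
      (by linarith [(Complex.mem_reProdIm.1 hs).2.1] : 0 < s.im).ne')).continuousAt
      |>.continuousWithinAt
  obtain ⟨C₂, h₂⟩ := hK.exists_bound_of_continuousOn hcont
  refine ⟨max 1 (max C₁ C₂), le_max_left _ _, fun s hs him => ?_⟩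
  set M := max 1 (max C₁ C₂)
  have hM1 : C₁ ≤ M := (le_max_left _ _).trans (le_max_right _ _)
  have hM2 : C₂ ≤ M := (le_max_right _ _).trans (le_max_right _ _)
  have hM0 : 1 ≤ M := le_max_left _ _
  rcases le_total T₀ s.im with hT | hT
  · calc ‖riemannZeta s‖ ≤ C₁ * s.im ^ 2 := h₁ s hs hT
      _ ≤ M * (s.im + 1) ^ 2 := by gcongr; linarith
  · calc ‖riemannZeta s‖ ≤ C₂ := h₂ s (Complex.mem_reProdIm.2 ⟨hs, him, hT⟩)
      _ ≤ M := hM2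
      _ ≤ M * (s.im + 1) ^ 2 :=
          le_mul_of_one_le_right (by linarith) (one_le_pow₀ (by linarith))

lemma exists_le_norm_riemannZeta :
    ∃ c : ℝ, 0 < c ∧ ∀ s : ℂ, 5 / 4 ≤ s.re → c ≤ ‖riemannZeta s‖ := by
  have hsum : Summable fun n : ℕ => (n : ℝ) ^ (-(5 / 4 : ℝ)) :=
    Real.summable_nat_rpow.mpr (by norm_num)
  set A := ∑' n : ℕ, (n : ℝ) ^ (-(5 / 4 : ℝ)) with hA
  have hA0 : 0 ≤ A := tsum_nonneg fun n => by positivity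
  refine ⟨1 / (A + 1), by positivity, fun s hs => ?_⟩
  have hs1 : 1 < s.re := by linarith
  have h1 := riemannZeta_mul_tsum_moebiusCoeff hs1
  have h2 : ‖∑' n : ℕ, moebiusCoeff n * (n : ℂ) ^ (-s)‖ ≤ A := by
    refine tsum_of_norm_bounded hsum.hasSum fun n => ?_
    rcases Nat.eq_zero_or_pos n with rfl | hn
    · have : moebiusCoeff 0 = 0 := by simp [moebiusCoeff]
      rw [this, zero_mul, norm_zero]
      positivity
    · rw [norm_mul, norm_natCast_cpow_neg hn.ne']
      calc ‖moebiusCoeff n‖ * (n : ℝ) ^ (-s.re) ≤ 1 * (n : ℝ) ^ (-(5 / 4 : ℝ)) := by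
            refine mul_le_mul (norm_moebiusCoeff_le n) ?_ (by positivity) zero_le_one
            exact Real.rpow_le_rpow_of_exponent_le (by exact_mod_cast hn) (by linarith)
        _ = _ := one_mul _
  have h3 := congrArg norm h1
  rw [norm_mul, norm_one] at h3
  rw [div_le_iff₀ (by positivity), ← h3]
  gcongr
  linarith

/-- The classical bound `S(t) = O(log t)`. -/
theorem exists_abs_S_le_log :
    ∃ C : ℝ, 0 < C ∧ ∀ S : ℝ → ℝ, IsS S → ∀ t : ℝ, 1 ≤ t →
      (∀ σ : ℝ, 1 / 2 ≤ σ → σ ≤ 2 → riemannZeta (σ + t * I) ≠ 0) →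
      |S t| ≤ C * Real.log (t + 2) := by
  obtain ⟨C, hC, hup⟩ := exists_norm_riemannZeta_le_sq
  obtain ⟨c₀, hc₀, hlow⟩ := exists_le_norm_riemannZeta
  have hlog65 : 0 < Real.log (6 / 5) := Real.log_pos (by norm_num)
  set A := π * ((|Real.log (C / c₀)| + 2) / Real.log (6 / 5) + 1) with hA
  have hA0 : 0 < A := by positivity
  refine ⟨2 + 2 * A, by positivity, fun S hS t ht hnz => ?_⟩
  obtain ⟨φ, hφc, hφ, hφ2, hSt⟩ := hS.exists_arg (by linarith) hnz
  have hl1 : 1 ≤ Real.log (t + 2) := one_le_log_of_three_le (by linarith)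
  have step : ∀ c : ℝ, c ∈ Icc (5 / 4) 2 →
      |(φ (c - 3 / 4)).im - (φ c).im| ≤ A * Real.log (t + 2) := by
    intro c hc
    have hball : ∀ z ∈ Metric.closedBall (c + t * I : ℂ) (9 / 10),
        |z.re - c| ≤ 9 / 10 ∧ |z.im - t| ≤ 9 / 10 := by
      intro z hz
      rw [mem_closedBall_iff_norm] at hz
      have h1 := (Complex.abs_re_le_norm _).trans hz
      have h2 := (Complex.abs_im_le_norm _).trans hz
      simp only [Complex.sub_re, Complex.add_re, Complex.ofReal_re, Complex.mul_re, Complex.I_re,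
        mul_zero, Complex.ofReal_im, Complex.I_im, mul_one, sub_self, add_zero, Complex.sub_im,
        Complex.add_im, Complex.mul_im, zero_add] at h1 h2
      exact ⟨h1, h2⟩
    have hsub : Icc (c - 3 / 4) c ⊆ Icc (1 / 2) 2 :=
      Icc_subset_Icc (by linarith [hc.1]) hc.2
    have hM1 : 1 ≤ C * (t + 2) ^ 2 := by nlinarith
    have key := abs_im_sub_im_le_of_analyticOnNhd (f := riemannZeta) (θ := φ) (c := c) (t := t)
      (r := 3 / 4) (R := 9 / 10) (M := C * (t + 2) ^ 2) (by norm_num) (by norm_num) hM1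
      (fun z hz => analyticOn_riemannZeta z
        (ne_one_of_im_ne_zero (by linarith [(abs_le.1 (hball z hz).2).1] : 0 < z.im).ne'))
      (fun z hz => by
        have h1 := abs_le.1 (hball z hz).1
        have h2 := abs_le.1 (hball z hz).2
        refine (hup z ⟨by linarith [hc.1], by linarith [hc.2]⟩ (by linarith)).trans ?_
        exact mul_le_mul_of_nonneg_left (pow_le_pow_left₀ (by linarith) (by linarith) 2)
          (by linarith))
      (hφc.mono hsub) (fun x hx => hφ x (hsub hx)) (x := c - 3 / 4) ⟨le_rfl, by linarith⟩
    refine key.trans ?_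
    have hζ := hlow (c + t * I) (by simpa using hc.1)
    have hζ0 : 0 < ‖riemannZeta (c + t * I)‖ := hc₀.trans_le hζ
    have hlogM : Real.log (C * (t + 2) ^ 2 / ‖riemannZeta (c + t * I)‖) ≤
        (|Real.log (C / c₀)| + 2) * Real.log (t + 2) := by
      calc Real.log (C * (t + 2) ^ 2 / ‖riemannZeta (c + t * I)‖)
          ≤ Real.log (C / c₀ * (t + 2) ^ 2) := by
            refine Real.log_le_log (div_pos (by positivity) hζ0) ?_
            rw [div_mul_eq_mul_div]
            gcongr
        _ = Real.log (C / c₀) + 2 * Real.log (t + 2) := by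
            rw [Real.log_mul (by positivity) (by positivity), Real.log_pow]
            norm_num
        _ ≤ |Real.log (C / c₀)| * Real.log (t + 2) + 2 * Real.log (t + 2) := by
            gcongr
            exact (le_abs_self _).trans (le_mul_of_one_le_right (abs_nonneg _) hl1)
        _ = _ := by ring
    rw [show (9 / 10 : ℝ) / (3 / 4) = 6 / 5 by norm_num, hA]
    calc π * (Real.log (C * (t + 2) ^ 2 / ‖riemannZeta (c + t * I)‖) / Real.log (6 / 5) + 1)
        ≤ π * ((|Real.log (C / c₀)| + 2) * Real.log (t + 2) / Real.log (6 / 5) +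
            Real.log (t + 2)) := by
          have := Real.pi_pos
          gcongr
      _ = _ := by ring
  have s1 := step 2 ⟨by norm_num, le_rfl⟩
  have s2 := step (5 / 4) ⟨le_rfl, by norm_num⟩
  norm_num only at s1 s2
  have s3 := abs_sub_abs_le_abs_sub (φ (5 / 4)).im (φ 2).im
  have s4 := abs_sub_abs_le_abs_sub (φ (1 / 2)).im (φ (5 / 4)).im
  have hpi := Real.pi_lt_d2
  have hpi3 := Real.pi_gt_three
  rw [hSt, abs_div, abs_of_pos Real.pi_pos]
  refine (div_le_self (abs_nonneg _) (by linarith)).trans ?_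
  linarith

lemma countable_riemannZetaZeros : riemannZetaZeros.Countable := by
  have h : riemannZetaZeros = ⋃ n : ℕ, Metric.closedBall (0 : ℂ) n ∩ riemannZetaZeros := by
    rw [← iUnion_inter, Metric.iUnion_closedBall_nat, univ_inter]
  rw [h]
  exact countable_iUnion fun n =>
    (isCompact_closedBall (0 : ℂ) n).inter_riemannZetaZeros_finite.countable

/-- Almost no horizontal line contains a zero of `ζ`. -/
lemma ae_forall_riemannZeta_ne_zero :
    ∀ᵐ t : ℝ, ∀ σ : ℝ, riemannZeta (σ + t * I) ≠ 0 := by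
  have h := (countable_riemannZetaZeros.image Complex.im).ae_notMem (volume : Measure ℝ)
  filter_upwards [h] with t ht σ h0
  exact ht ⟨σ + t * I, h0, by simp⟩

lemma continuousOn_norm_riemannZeta_half_sq {a b : ℝ} (ha : 0 < a) :
    ContinuousOn (fun t : ℝ => ‖riemannZeta (1 / 2 + t * I)‖ ^ 2) (Icc a b) := by
  have h := continuousOn_line_riemannZeta (1 / 2) (b := b) ha
  push_cast at h
  exact h.norm.pow 2

/-- On a dyadic interval the integral of `|ζ|² |S|` is `O(T log T (log log T)^{3/2})`. -/
lemma exists_integral_dyadic_le :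
    ∃ D T₀ : ℝ, 0 < D ∧ 3 ≤ T₀ ∧ ∀ S, IsS S → ∀ T, T₀ ≤ T →
      ∫ t in T..2 * T, ‖‖riemannZeta (1 / 2 + t * I)‖ ^ 2 * S t‖ ≤
        D * (T * Real.log T * (Real.log (Real.log T) * √(Real.log (Real.log T)))) := by
  obtain ⟨A, hA0, hA⟩ := exists_exceptional_set_abs_S_le
  obtain ⟨B, hB0, hB⟩ := exists_abs_S_le_log
  obtain ⟨P, T₁, hP0, hT₁, hP⟩ := exists_integral_norm_riemannZeta_half_sq_le
  obtain ⟨Q, T₂, hQ0, hT₂, hQ⟩ := exists_setIntegral_norm_riemannZeta_half_sq_le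
  obtain ⟨T₃, hT₃⟩ := eventually_atTop.1 (hA.and (eventually_le_log_log 1))
  push_cast at hP hQ
  refine ⟨2 * B * Q + A * P, max (max T₁ T₂) T₃, by positivity,
    hT₁.trans ((le_max_left _ _).trans (le_max_left _ _)), fun S hS T hT => ?_⟩
  have h1 : T₁ ≤ T := ((le_max_left _ _).trans (le_max_left _ _)).trans hT
  have h2 : T₂ ≤ T := ((le_max_right _ _).trans (le_max_left _ _)).trans hT
  obtain ⟨⟨E, hET, hEm, hEv, hE⟩, hl1⟩ := hT₃ T ((le_max_right _ _).trans hT)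
  have hT3 : 3 ≤ T := hT₁.trans h1
  have hT0 : 0 < T := by linarith
  have hL := one_le_log_of_three_le hT3
  set L := Real.log T with hLdef
  set l := Real.log L with hldef
  have hsq : 1 ≤ √l := Real.one_le_sqrt.2 hl1
  have hll : 1 ≤ l * √l := one_le_mul_of_one_le_of_one_le hl1 hsq
  set Z : ℝ → ℝ := fun t => ‖riemannZeta (1 / 2 + t * I)‖ ^ 2 with hZ
  have hZ0 : ∀ t, 0 ≤ Z t := fun t => by positivity
  have hZi : IntegrableOn Z (Icc T (2 * T)) :=
    (continuousOn_norm_riemannZeta_half_sq hT0).integrableOn_Icc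
  set g : ℝ → ℝ := fun t => E.indicator (fun t => 2 * B * L * Z t) t + A * (l * √l) * Z t with hg
  have hg1 : IntegrableOn (fun t => E.indicator (fun t => 2 * B * L * Z t) t) (Icc T (2 * T)) :=
    (hZi.const_mul _).indicator hEm
  have hg2 : IntegrableOn (fun t => A * (l * √l) * Z t) (Icc T (2 * T)) := hZi.const_mul _
  have hgi : IntervalIntegrable g volume T (2 * T) := by
    rw [intervalIntegrable_iff_integrableOn_Icc_of_le (by linarith)]
    exact hg1.add hg2
  have hdom : ∀ᵐ t, t ∈ Ioc T (2 * T) → ‖‖Z t * S t‖‖ ≤ g t := by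
    filter_upwards [ae_forall_riemannZeta_ne_zero] with t ht htT
    rw [norm_norm, norm_mul, Real.norm_eq_abs, Real.norm_eq_abs, abs_of_nonneg (hZ0 t), hg]
    by_cases htE : t ∈ E
    · have hb := hB S hS t (by linarith [htT.1]) fun σ _ _ => ht σ
      have hlog : Real.log (t + 2) ≤ 2 * L := by
        calc Real.log (t + 2) ≤ Real.log (T ^ 2) :=
              Real.log_le_log (by linarith [htT.1]) (by nlinarith [htT.2])
          _ = 2 * L := by rw [Real.log_pow, hLdef]; norm_num
      have : |S t| ≤ 2 * B * L := by nlinarith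
      have h3 : 0 ≤ A * (l * √l) * Z t := by have := hZ0 t; positivity
      simp only [indicator_of_mem htE]
      nlinarith [hZ0 t]
    · have hb := hE S hS t ⟨⟨htT.1.le, htT.2⟩, htE⟩ fun σ _ _ => ht σ
      simp only [indicator_of_notMem htE, zero_add]
      nlinarith [hZ0 t]
  have hmain := intervalIntegral.norm_integral_le_of_norm_le (by linarith) hdom hgi
  have hEint : ∫ t in E, Z t ≤ Q * T := hQ T h2 E hET hEm hEv
  have hfull : ∫ t in Icc T (2 * T), Z t ≤ P * (T * L) := by
    refine le_trans ?_ (hP T h1)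
    rw [integral_Icc_eq_integral_Ioc, ← intervalIntegral.integral_of_le (by linarith)]
    refine intervalIntegral.integral_mono_interval (by linarith) (by linarith) (by linarith)
      (Eventually.of_forall hZ0) ?_
    rw [intervalIntegrable_iff_integrableOn_Icc_of_le (by linarith)]
    exact (continuousOn_norm_riemannZeta_half_sq (by positivity)).integrableOn_Icc
  have hgval : ∫ t in T..2 * T, g t ≤ 2 * B * L * (Q * T) + A * (l * √l) * (P * (T * L)) := by
    rw [intervalIntegral.integral_of_le (by linarith), ← integral_Icc_eq_integral_Ioc,
      hg, integral_add hg1 hg2, setIntegral_indicator hEm, inter_eq_right.2 hET,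
      integral_const_mul, integral_const_mul]
    gcongr
  refine (le_abs_self _).trans (hmain.trans (hgval.trans ?_))
  have : 2 * B * Q * (T * L) * 1 ≤ 2 * B * Q * (T * L) * (l * √l) := by gcongr
  linarith

/-- The integral of `|ζ|² |S|` over an initial segment is bounded. -/
lemma exists_integral_one_le (b : ℝ) (hb : 1 ≤ b) :
    ∃ K : ℝ, 0 ≤ K ∧ ∀ S, IsS S → ∀ T ∈ Icc 1 b,
      ∫ t in (1 : ℝ)..T, ‖‖riemannZeta (1 / 2 + t * I)‖ ^ 2 * S t‖ ≤ K := by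
  obtain ⟨B, hB0, hB⟩ := exists_abs_S_le_log
  set g : ℝ → ℝ := fun t => ‖riemannZeta (1 / 2 + t * I)‖ ^ 2 * (B * Real.log (b + 2)) with hg
  have hlog : 0 ≤ Real.log (b + 2) := Real.log_nonneg (by linarith)
  have hg0 : ∀ t, 0 ≤ g t := fun t => by positivity
  have hgi : ∀ T, 1 ≤ T → IntervalIntegrable g volume 1 T := fun T hT => by
    rw [intervalIntegrable_iff_integrableOn_Icc_of_le hT]
    exact (continuousOn_norm_riemannZeta_half_sq one_pos).integrableOn_Icc.mul_const _
  refine ⟨∫ t in (1 : ℝ)..b, g t, intervalIntegral.integral_nonneg hb fun t _ => hg0 t,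
    fun S hS T hT => ?_⟩
  have hdom : ∀ᵐ t, t ∈ Ioc 1 T → ‖‖‖riemannZeta (1 / 2 + t * I)‖ ^ 2 * S t‖‖ ≤ g t := by
    filter_upwards [ae_forall_riemannZeta_ne_zero] with t ht htT
    rw [norm_norm, norm_mul, Real.norm_eq_abs, Real.norm_eq_abs, abs_of_nonneg (by positivity)]
    refine mul_le_mul_of_nonneg_left
      ((hB S hS t htT.1.le fun σ _ _ => ht σ).trans ?_) (by positivity)
    exact mul_le_mul_of_nonneg_left (Real.log_le_log (by linarith [htT.1])
      (by linarith [htT.2, hT.2])) hB0.le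
  refine (le_abs_self _).trans
    ((intervalIntegral.norm_integral_le_of_norm_le hT.1 hdom (hgi T hT.1)).trans ?_)
  exact intervalIntegral.integral_mono_interval le_rfl hT.1 hT.2 (Eventually.of_forall hg0)
    (hgi b hb)

lemma mul_log_log_mul_sqrt_mono {a b : ℝ} (ha : 3 ≤ a) (hab : a ≤ b) :
    Real.log a * (Real.log (Real.log a) * √(Real.log (Real.log a))) ≤
      Real.log b * (Real.log (Real.log b) * √(Real.log (Real.log b))) := by
  have h1 := one_le_log_of_three_le ha
  have h2 : Real.log a ≤ Real.log b := Real.log_le_log (by linarith) hab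
  have h3 : Real.log (Real.log a) ≤ Real.log (Real.log b) := Real.log_le_log (by linarith) h2
  have h4 : 0 ≤ Real.log (Real.log a) := Real.log_nonneg h1
  have h5 : 0 ≤ Real.log b := by linarith
  have h6 : 0 ≤ Real.log (Real.log b) := h4.trans h3
  gcongr

/-- The bound for `∫ |ζ|² |S|` over `[1, T]`, obtained by summing over dyadic intervals. -/
lemma exists_integral_norm_le :
    ∃ K D : ℝ, 0 ≤ K ∧ 0 ≤ D ∧ ∀ S, IsS S → ∀ T, 3 ≤ T →
      IntervalIntegrable (fun t : ℝ => ‖riemannZeta (1 / 2 + t * I)‖ ^ 2 * S t) volume 1 T →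
      ∫ t in (1 : ℝ)..T, ‖‖riemannZeta (1 / 2 + t * I)‖ ^ 2 * S t‖ ≤
        K + D * (T * (Real.log T * (Real.log (Real.log T) * √(Real.log (Real.log T))))) := by
  obtain ⟨D, T₀, hD0, hT₀, hD⟩ := exists_integral_dyadic_le
  obtain ⟨K, hK0, hK⟩ := exists_integral_one_le (2 * T₀) (by linarith)
  refine ⟨K, 2 * D, hK0, by positivity, fun S hS => ?_⟩
  suffices h : ∀ n : ℕ, ∀ T, 3 ≤ T → T ≤ 2 ^ n * (2 * T₀) →
      IntervalIntegrable (fun t : ℝ => ‖riemannZeta (1 / 2 + t * I)‖ ^ 2 * S t) volume 1 T →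
      ∫ t in (1 : ℝ)..T, ‖‖riemannZeta (1 / 2 + t * I)‖ ^ 2 * S t‖ ≤
        K + 2 * D * (T * (Real.log T * (Real.log (Real.log T) * √(Real.log (Real.log T))))) by
    intro T hT
    obtain ⟨n, hn⟩ := pow_unbounded_of_one_lt T (one_lt_two : (1 : ℝ) < 2)
    have : (0 : ℝ) < 2 ^ n := by positivity
    exact h n T hT (by nlinarith)
  have hsmall : ∀ T, 3 ≤ T → T ≤ 2 * T₀ →
      ∫ t in (1 : ℝ)..T, ‖‖riemannZeta (1 / 2 + t * I)‖ ^ 2 * S t‖ ≤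
        K + 2 * D * (T * (Real.log T * (Real.log (Real.log T) * √(Real.log (Real.log T))))) := by
    intro T hT hTb
    have h1 := one_le_log_of_three_le hT
    have h4 : 0 ≤ Real.log (Real.log T) := Real.log_nonneg h1
    refine (hK S hS T ⟨by linarith, hTb⟩).trans (le_add_of_nonneg_right ?_)
    have : 0 ≤ Real.log T := by linarith
    have : 0 ≤ T := by linarith
    positivity
  intro n
  induction n with
  | zero => exact fun T hT hTb _ => hsmall T hT (by simpa using hTb)
  | succ n ih =>
    intro T hT hTb hi
    rcases le_or_gt T (2 * T₀) with hT2 | hT2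
    · exact hsmall T hT hT2
    have hi1 := hi.mono_set (c := 1) (d := T / 2) (by
      rw [uIcc_of_le (by linarith), uIcc_of_le (by linarith)]
      exact Icc_subset_Icc le_rfl (by linarith))
    have hi2 := hi.mono_set (c := T / 2) (d := T) (by
      rw [uIcc_of_le (by linarith), uIcc_of_le (by linarith)]
      exact Icc_subset_Icc (by linarith) le_rfl)
    rw [← intervalIntegral.integral_add_adjacent_intervals hi1.norm hi2.norm]
    have h1 := ih (T / 2) (by linarith) (by rw [pow_succ] at hTb; linarith) hi1
    have h2 := hD S hS (T / 2) (by linarith)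
    rw [mul_div_cancel₀ T two_ne_zero, mul_assoc] at h2
    have hmono := mul_log_log_mul_sqrt_mono (a := T / 2) (b := T) (by linarith) (by linarith)
    set G := Real.log T * (Real.log (Real.log T) * √(Real.log (Real.log T)))
    have hG1 : D * (T / 2 * _) ≤ D * (T / 2 * G) :=
      mul_le_mul_of_nonneg_left (mul_le_mul_of_nonneg_left hmono (by linarith)) hD0.le
    have hG0 : 0 ≤ D * (T / 2 * G) := by
      have h1 := one_le_log_of_three_le hT
      have h4 : 0 ≤ Real.log (Real.log T) := Real.log_nonneg h1
      have : 0 ≤ Real.log T := by linarith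
      have : 0 ≤ T := by linarith
      positivity
    linarith

theorem statement16 (S : ℝ → ℝ) (hS : IsS S) :
    ∀ ε : ℝ, 0 < ε → ∃ K : ℝ, ∀ T : ℝ, 3 ≤ T →
      |∫ t in (1:ℝ)..T, ‖riemannZeta (1/2 + t * I)‖ ^ 2 * S t| ≤
        K * T * Real.log T * (Real.log (Real.log T)) ^ (3/2 + ε : ℝ) := by
  intro ε hε
  obtain ⟨K, D, hK0, hD0, h⟩ := exists_integral_norm_le
  have hl3 : 0 < Real.log (Real.log 3) :=
    Real.log_pos ((Real.lt_log_iff_exp_lt (by norm_num)).2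
      (Real.exp_one_lt_d9.trans (by norm_num)))
  set m := Real.log (Real.log 3) with hm
  refine ⟨K / m ^ (3 / 2 + ε) + D / m ^ ε, fun T hT => ?_⟩
  have hL := one_le_log_of_three_le hT
  have hml : m ≤ Real.log (Real.log T) :=
    Real.log_le_log (Real.log_pos (by norm_num)) (Real.log_le_log (by norm_num) hT)
  set L := Real.log T with hLdef
  set l := Real.log L with hldef
  have hl0 : 0 < l := hl3.trans_le hml
  have hm1 : 0 < m ^ (3 / 2 + ε) := Real.rpow_pos_of_pos hl3 _
  have hm2 : 0 < m ^ ε := Real.rpow_pos_of_pos hl3 _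
  have hlp : 0 < l ^ (3 / 2 + ε) := Real.rpow_pos_of_pos hl0 _
  by_cases hi : IntervalIntegrable (fun t : ℝ => ‖riemannZeta (1 / 2 + t * I)‖ ^ 2 * S t)
    volume 1 T
  swap
  · rw [intervalIntegral.integral_undef hi, abs_zero]
    positivity
  refine (intervalIntegral.norm_integral_le_integral_norm (by linarith)).trans
    ((h S hS T hT hi).trans ?_)
  have h1 : K ≤ K / m ^ (3 / 2 + ε) * (T * L * l ^ (3 / 2 + ε)) := by
    rw [div_mul_eq_mul_div, le_div_iff₀ hm1]
    refine mul_le_mul_of_nonneg_left ?_ hK0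
    calc m ^ (3 / 2 + ε) ≤ l ^ (3 / 2 + ε) := Real.rpow_le_rpow hl3.le hml (by positivity)
      _ ≤ T * L * l ^ (3 / 2 + ε) := le_mul_of_one_le_left hlp.le (by nlinarith)
  have h2 : l * √l ≤ l ^ (3 / 2 + ε) / m ^ ε := by
    have h3 : l * √l = l ^ (3 / 2 : ℝ) := by
      rw [Real.sqrt_eq_rpow, ← Real.rpow_one_add' hl0.le (by norm_num)]
      norm_num
    rw [h3, le_div_iff₀ hm2, Real.rpow_add hl0]
    exact mul_le_mul_of_nonneg_left (Real.rpow_le_rpow hl3.le hml hε.le) (by positivity)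
  have h4 : D * (T * (L * (l * √l))) ≤ D * (T * (L * (l ^ (3 / 2 + ε) / m ^ ε))) := by gcongr
  calc K + D * (T * (L * (l * √l)))
      ≤ K / m ^ (3 / 2 + ε) * (T * L * l ^ (3 / 2 + ε)) +
        D * (T * (L * (l ^ (3 / 2 + ε) / m ^ ε))) := add_le_add h1 h4
    _ = _ := by ring
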